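/- (Igusa's rationality theorem, untwisted case over ℚ_p.) Let p be a prime, d ≥ 1, and f ∈ ℤ_p[x_1,…,x_d]. Then there exist an integer r ≥ 0, pairs of positive integers (a_1,b_1),…,(a_r,b_r), and a polynomial P ∈ ℚ[T], such that for every s ∈ ℂ with Re(s) > 0 one has (∫_{ℤ_p^d} |f(z)|_p^s dμ(z)) · ∏_{j=1}^{r} (1 − p^{−(a_j s + b_j)}) = P(p^{−s}). In particular, Z(f;s) = ∫_{ℤ_p^d} |f(z)|_p^s dμ(z) is a rational function of t = p^{−s}. -/

import Mathlib

open MeasureTheory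
open scoped ENNReal

noncomputable instance (p : ℕ) [Fact p.Prime] : MeasurableSpace ℤ_[p] := borel _
instance (p : ℕ) [Fact p.Prime] : BorelSpace ℤ_[p] := ⟨rfl⟩

namespace Igusa

open Filter Topology

section Analytic

variable {𝕜 : Type*} [NontriviallyNormedField 𝕜]
  {E : Type*} [NormedAddCommGroup E] [NormedSpace 𝕜 E]

/-- An analytic function vanishing near points arbitrarily close to `x` vanishes near `x`. -/
theorem eventuallyEq_zero_of_frequently [CompleteSpace 𝕜] {f : E → 𝕜} {x : E}
    (hf : AnalyticAt 𝕜 f x)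
    (h : ∃ᶠ y in 𝓝 x, f =ᶠ[𝓝 y] 0) : f =ᶠ[𝓝 x] 0 := by
  rcases hf with ⟨p, r, hp⟩
  have hr : 0 < r / 2 := ENNReal.half_pos hp.r_pos.ne'
  obtain ⟨y, yu, hxy⟩ := (h.and_eventually (Metric.eball_mem_nhds x hr)).exists
  replace hxy : edist x y < r / 2 := by rwa [edist_comm]
  let q := p.changeOrigin (y - x)
  have has_series : HasFPowerSeriesOnBall f q y (r / 2) := by
    have A : (‖y - x‖₊ : ENNReal) < r / 2 := by rwa [edist_comm, edist_eq_enorm_sub] at hxy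
    have := hp.changeOrigin (A.trans_le ENNReal.half_le_self)
    simp only [add_sub_cancel] at this
    apply this.mono hr
    apply ENNReal.le_sub_of_add_le_left ENNReal.coe_ne_top
    apply (add_le_add A.le (le_refl (r / 2))).trans (le_of_eq _)
    exact ENNReal.add_halves _
  filter_upwards [Metric.isOpen_eball.mem_nhds hxy] with z hz
  have A : HasSum (fun n : ℕ => q n fun _ : Fin n => z - y) (f z) := has_series.hasSum_sub hz
  have B : HasSum (fun n : ℕ => q n fun _ : Fin n => z - y) 0 := by
    have : HasFPowerSeriesAt 0 q y := has_series.hasFPowerSeriesAt.congr yu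
    convert! hasSum_zero (α := 𝕜) using 1
    ext n
    exact this.apply_eq_zero n _
  exact HasSum.unique A B

/-- Germs of analytic functions form an integral domain. -/
theorem eventuallyEq_zero_or_of_mul [CompleteSpace 𝕜] {f g : E → 𝕜} {x : E} (hf : AnalyticAt 𝕜 f x)
    (hg : AnalyticAt 𝕜 g x) (h : ∀ᶠ y in 𝓝 x, f y * g y = 0) :
    f =ᶠ[𝓝 x] 0 ∨ g =ᶠ[𝓝 x] 0 := by
  by_contra! hne
  have h1 := mt (eventuallyEq_zero_of_frequently hg) hne.2
  rw [not_frequently] at h1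
  have h2 : ∃ᶠ y in 𝓝 x, f y ≠ 0 :=
    not_eventually.1 (show ¬ ∀ᶠ y in 𝓝 x, f y = 0 from hne.1)
  obtain ⟨y, hy, hgy, hfy, hm⟩ :=
    (h2.and_eventually (h1.and (hf.eventually_analyticAt.and h.eventually_nhds))).exists
  refine hgy ?_
  filter_upwards [hm, hfy.continuousAt.eventually_ne hy] with z hz hz'
  simpa [hz'] using hz

theorem mul_not_eventuallyEq_zero [CompleteSpace 𝕜] {f g : E → 𝕜} {x : E} (hf : AnalyticAt 𝕜 f x)
    (hg : AnalyticAt 𝕜 g x) (hf0 : ¬ f =ᶠ[𝓝 x] 0) (hg0 : ¬ g =ᶠ[𝓝 x] 0) :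
    ¬ (f * g) =ᶠ[𝓝 x] 0 := fun h =>
  (eventuallyEq_zero_or_of_mul hf hg h).elim hf0 hg0

theorem mul_left_cancel_eventuallyEq [CompleteSpace 𝕜] {f g h : E → 𝕜} {x : E}
    (hf : AnalyticAt 𝕜 f x)
    (hg : AnalyticAt 𝕜 g x) (hh : AnalyticAt 𝕜 h x) (hf0 : ¬ f =ᶠ[𝓝 x] 0)
    (H : ∀ᶠ y in 𝓝 x, f y * g y = f y * h y) : g =ᶠ[𝓝 x] h := by
  have := (eventuallyEq_zero_or_of_mul hf (hg.sub hh) (by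
    filter_upwards [H] with y hy
    simp [mul_sub, hy])).resolve_left hf0
  filter_upwards [this] with y hy
  simpa [sub_eq_zero] using hy

/-- The series whose `n`-th term is
`v ↦ ∑ k, p (n+1) (π v₀, …, π v_{k-1}, e, v_k, …, v_{n-1})`. -/
noncomputable def quotientSeries (p : FormalMultilinearSeries 𝕜 E 𝕜) (π : E →L[𝕜] E) (e : E) :
    FormalMultilinearSeries 𝕜 E 𝕜 := fun n =>
  ∑ k : Fin (n + 1), ((p (n + 1)).curryMid k e).compContinuousLinearMap
    (fun j => if j.castSucc < k then π else ContinuousLinearMap.id 𝕜 E)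

theorem quotientSeries_apply (p : FormalMultilinearSeries 𝕜 E 𝕜) (ℓ : E →L[𝕜] 𝕜) (e : E)
    (π : E →L[𝕜] E) (hπ : ∀ x, π x = x - ℓ x • e) (n : ℕ) (x : E) :
    ℓ x * quotientSeries p π e n (fun _ => x) =
      p (n + 1) (fun _ => x) - p (n + 1) (fun _ => π x) := by
  let w : ℕ → Fin (n + 1) → E := fun k j => if (j : ℕ) < k then π x else x
  have key : ∀ k : Fin (n + 1), ℓ x * ((p (n + 1)).curryMid k e).compContinuousLinearMap
      (fun j => if j.castSucc < k then π else ContinuousLinearMap.id 𝕜 E) (fun _ => x) =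
      p (n + 1) (w k) - p (n + 1) (w (k + 1)) := by
    intro k
    have h1 : w k = Function.update (w k) k x := by
      rw [eq_comm, Function.update_eq_self_iff]; simp [w]
    have h2 : w (k + 1) = Function.update (w k) k (π x) := by
      ext j
      by_cases hj : j = k
      · subst hj; simp [w]
      · rw [Function.update_of_ne hj]
        have : (j : ℕ) ≠ k := fun h => hj (Fin.ext h)
        simp only [w]
        congr 1
        simp only [eq_iff_iff]; omega
    rw [h1, h2, ← (p (n + 1)).map_update_sub]
    have h3 : x - π x = ℓ x • e := by rw [hπ]; abel
    rw [h3, ContinuousMultilinearMap.map_update_smul, smul_eq_mul]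
    congr 1
    simp only [ContinuousMultilinearMap.compContinuousLinearMap_apply,
      ContinuousMultilinearMap.curryMid_apply]
    congr 1
    ext j
    refine Fin.succAboveCases k ?_ (fun i => ?_) j
    · simp
    · simp only [Fin.insertNth_apply_succAbove, ne_eq, Fin.succAbove_ne, not_false_eq_true,
        Function.update_of_ne, w]
      by_cases hi : i.castSucc < k
      · have : ((k.succAbove i : Fin (n + 1)) : ℕ) < k := by
          rw [Fin.succAbove_of_castSucc_lt _ _ hi]; exact hi
        simp [hi, this]
      · have : ¬ ((k.succAbove i : Fin (n + 1)) : ℕ) < k := by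
          rw [Fin.succAbove_of_le_castSucc _ _ (not_lt.1 hi)]
          have := Fin.le_def.1 (not_lt.1 hi)
          simp at this ⊢; omega
        simp [hi, this]
  rw [quotientSeries, sum_apply, Finset.mul_sum,
    Finset.sum_congr rfl (fun k _ => key k),
    Fin.sum_univ_eq_sum_range (fun k => p (n + 1) (w k) - p (n + 1) (w (k + 1))),
    Finset.sum_range_sub']
  have e0 : w 0 = fun _ => x := by ext j; simp [w]
  have e1 : w (n + 1) = fun _ => π x := by ext j; exact if_pos j.2
  rw [e0, e1]

theorem quotientSeries_norm_le (p : FormalMultilinearSeries 𝕜 E 𝕜) (π : E →L[𝕜] E) (e : E)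
    {C : ℝ} (hC : ‖π‖ ≤ C) (hC1 : 1 ≤ C) (n : ℕ) :
    ‖quotientSeries p π e n‖ ≤ (n + 1) * (‖p (n + 1)‖ * ‖e‖ * C ^ n) := by
  refine (norm_sum_le _ _).trans ?_
  refine (Finset.sum_le_card_nsmul _ _ (‖p (n + 1)‖ * ‖e‖ * C ^ n) fun k _ => ?_).trans ?_
  · refine (ContinuousMultilinearMap.norm_compContinuousLinearMap_le _ _).trans ?_
    gcongr
    · exact ((p (n + 1)).curryMid k).le_opNorm e |>.trans (by
        rw [ContinuousMultilinearMap.norm_curryMid])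
    · refine (Finset.prod_le_prod (fun _ _ => norm_nonneg _) (g := fun _ => C) fun j _ => ?_).trans
        (by simp)
      split_ifs
      · exact hC
      · exact ContinuousLinearMap.norm_id_le.trans hC1
  · simp

theorem quotientSeries_radius_pos (p : FormalMultilinearSeries 𝕜 E 𝕜) (π : E →L[𝕜] E) (e : E)
    (hp : 0 < p.radius) : 0 < (quotientSeries p π e).radius := by
  obtain ⟨C, r, hC, hr, h⟩ := p.le_mul_pow_of_radius_pos hp
  set D := max ‖π‖ 1
  have hD : 1 ≤ D := le_max_right _ _
  have hr' : 0 < r * D * 2 := by positivity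
  let ρ : NNReal := ⟨(r * D * 2)⁻¹, by positivity⟩
  have hρ : 0 < ρ := by
    rw [← NNReal.coe_pos]; exact inv_pos.2 hr'
  refine lt_of_lt_of_le (ENNReal.coe_pos.2 hρ)
    (FormalMultilinearSeries.le_radius_of_bound _ (C * r * ‖e‖) fun n => ?_)
  have h2 : (n + 1 : ℝ) ≤ 2 ^ n := by exact_mod_cast Nat.lt_two_pow_self
  calc ‖quotientSeries p π e n‖ * (ρ : ℝ) ^ n
      ≤ ((n + 1) * (‖p (n + 1)‖ * ‖e‖ * D ^ n)) * ((r * D * 2)⁻¹) ^ n := by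
        gcongr
        · exact quotientSeries_norm_le p π e (le_max_left _ _) hD n
        · exact le_rfl
    _ ≤ (2 ^ n * ((C * r ^ (n + 1)) * ‖e‖ * D ^ n)) * ((r * D * 2)⁻¹) ^ n := by
        gcongr
        exact h _
    _ = C * r * ‖e‖ := by
        rw [inv_pow, mul_pow, mul_pow]
        field_simp
        ring

/-- Analytic Hadamard lemma: `f x - f (x - ℓ x • e)` is divisible by `ℓ x`. -/
theorem exists_analyticAt_quotient [CompleteSpace 𝕜] {f : E → 𝕜} (hf : AnalyticAt 𝕜 f 0)
    (ℓ : E →L[𝕜] 𝕜) (e : E) :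
    ∃ g : E → 𝕜, AnalyticAt 𝕜 g 0 ∧ ∀ᶠ x in 𝓝 0, f x = f (x - ℓ x • e) + ℓ x * g x := by
  obtain ⟨p, hp⟩ := hf
  let π : E →L[𝕜] E := ContinuousLinearMap.id 𝕜 E - ℓ.smulRight e
  have hπ : ∀ x, π x = x - ℓ x • e := fun x => by simp [π]
  let q := quotientSeries p π e
  have hq : 0 < q.radius := quotientSeries_radius_pos p π e hp.radius_pos
  have hqs := q.hasFPowerSeriesOnBall hq
  refine ⟨q.sum, hqs.analyticAt, ?_⟩
  have hlim : Tendsto π (𝓝 0) (𝓝 0) := by simpa using π.continuous.tendsto 0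
  filter_upwards [hp.eventually_hasSum, hlim.eventually hp.eventually_hasSum,
    hqs.hasFPowerSeriesAt.eventually_hasSum] with x h1 h2 h3
  simp only [zero_add] at h1 h2 h3
  rw [← hπ]
  have h4 := (h1.sub h2)
  have h5 : HasSum (fun n => ℓ x * q n fun _ => x) (ℓ x * q.sum x) := h3.mul_left _
  have h6 : HasSum (fun n => p n (fun _ => x) - p n (fun _ => π x)) (0 + ℓ x * q.sum x) := by
    rw [← hasSum_nat_add_iff' 1]
    simp only [Finset.range_one, Finset.sum_singleton]
    convert! h5 using 1
    · ext n; exact (quotientSeries_apply p ℓ e π hπ n x).symm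
    · have : p 0 (fun _ => x) = p 0 (fun _ => π x) := by congr 1; ext i; exact i.elim0
      rw [this]; ring
  have := h4.unique h6
  linear_combination this

/-- A nonzero analytic germ restricts to a nonzero germ on some line on which `ℓ` is nonzero. -/
theorem exists_line_not_eventuallyEq_zero [CompleteSpace 𝕜] {f : E → 𝕜} (hf : AnalyticAt 𝕜 f 0)
    (hf0 : ¬ f =ᶠ[𝓝 0] 0) (ℓ : E →L[𝕜] 𝕜) (hℓ : ℓ ≠ 0) :
    ∃ y : E, ℓ y = 1 ∧ ¬ ∀ᶠ t in 𝓝 (0 : 𝕜), f (t • y) = 0 := by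
  have hℓ0 : ¬ (ℓ : E → 𝕜) =ᶠ[𝓝 0] 0 := by
    intro h
    obtain ⟨v, hv⟩ : ∃ v, ℓ v ≠ 0 := by
      by_contra! h'; exact hℓ (ContinuousLinearMap.ext h')
    have hl : Tendsto (fun t : 𝕜 => t • v) (𝓝[≠] 0) (𝓝 0) := by
      have : Continuous fun t : 𝕜 => t • v := by fun_prop
      simpa using (this.tendsto 0).mono_left nhdsWithin_le_nhds
    obtain ⟨t, ht, ht0⟩ := ((hl.eventually h).and self_mem_nhdsWithin).exists
    simp [hv] at ht
    exact ht0 ht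
  have hmul := mul_not_eventuallyEq_zero hf (ℓ.analyticAt 0) hf0 hℓ0
  obtain ⟨p, r, hp⟩ := hf
  obtain ⟨z, hz, hzr⟩ :=
    ((not_eventually.1 (show ¬ ∀ᶠ y in 𝓝 (0 : E), (f * ℓ) y = 0 from hmul)).and_eventually
      (Metric.eball_mem_nhds 0 hp.r_pos)).exists
  have hfz : f z ≠ 0 := left_ne_zero_of_mul hz
  have hℓz : ℓ z ≠ 0 := right_ne_zero_of_mul hz
  refine ⟨(ℓ z)⁻¹ • z, by simp [hℓz], fun h => hfz ?_⟩
  have hline : ∀ᶠ t in 𝓝 (0 : 𝕜), f (t • z) = 0 := by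
    have : Tendsto (fun t : 𝕜 => t * ℓ z) (𝓝 0) (𝓝 0) := by
      have : Continuous fun t : 𝕜 => t * ℓ z := by fun_prop
      simpa using this.tendsto 0
    filter_upwards [this.eventually h] with t ht
    rwa [smul_smul, mul_assoc, mul_inv_cancel₀ hℓz, mul_one] at ht
  let u : 𝕜 →L[𝕜] E := ContinuousLinearMap.toSpanSingleton 𝕜 z
  have hp' : HasFPowerSeriesAt (f ∘ u) (p.compContinuousLinearMap u) 0 := by
    apply HasFPowerSeriesAt.compContinuousLinearMap
    simpa using hp.hasFPowerSeriesAt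
  have hz0 : p.compContinuousLinearMap u = 0 := hp'.eq_zero_of_eventually (by
    filter_upwards [hline] with t ht
    simpa [u] using ht)
  have hs := hp.hasSum hzr
  rw [zero_add] at hs
  refine hs.unique ?_
  convert! hasSum_zero (α := 𝕜) using 1
  ext n
  have := congrArg (fun q : FormalMultilinearSeries 𝕜 𝕜 𝕜 => q n (fun _ => 1)) hz0
  simp only [FormalMultilinearSeries.compContinuousLinearMap_apply] at this
  simpa [u, Function.comp_def] using this

end Analytic

section Forms

open Matrix

variable {K : Type*} [NontriviallyNormedField K] {n : ℕ}

/-- The monomial `x ^ α`. -/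
def mono (α : Fin n → ℕ) (x : Fin n → K) : K := ∏ i, x i ^ α i

/-- Near the origin, `f` is the monomial `x ^ α` times an analytic unit. -/
def HasForm (f : (Fin n → K) → K) (α : Fin n → ℕ) : Prop :=
  ∃ u : (Fin n → K) → K, AnalyticAt K u 0 ∧ u 0 ≠ 0 ∧ ∀ᶠ x in 𝓝 0, f x = mono α x * u x

/-- Near the origin, `f` is a monomial times an analytic unit. -/
def IsNC (f : (Fin n → K) → K) : Prop := ∃ α, HasForm f α

theorem analyticAt_coord (i : Fin n) (x : Fin n → K) :
    AnalyticAt K (fun x : Fin n → K => x i) x :=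
  (ContinuousLinearMap.proj (R := K) (φ := fun _ : Fin n => K) i).analyticAt x

theorem analyticAt_of_coord {E : Type*} [NormedAddCommGroup E] [NormedSpace K E]
    {f : E → Fin n → K} {x : E} (h : ∀ i, AnalyticAt K (fun y => f y i) x) : AnalyticAt K f x :=
  (analyticAt_pi_iff).2 h

theorem analyticAt_update {E : Type*} [NormedAddCommGroup E] [NormedSpace K E]
    {f : E → Fin n → K} {g : E → K} {x : E} (hf : AnalyticAt K f x) (hg : AnalyticAt K g x)
    (i : Fin n) : AnalyticAt K (fun y => Function.update (f y) i (g y)) x := by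
  refine analyticAt_of_coord fun j => ?_
  by_cases h : j = i
  · subst h; simpa using hg
  · simpa [Function.update_of_ne h] using analyticAt_pi_iff.1 hf j

theorem analyticAt_vecCons {E : Type*} [NormedAddCommGroup E] [NormedSpace K E]
    {f : E → K} {g : E → Fin n → K} {x : E} (hf : AnalyticAt K f x) (hg : AnalyticAt K g x) :
    AnalyticAt K (fun y => vecCons (f y) (g y)) x := by
  refine analyticAt_of_coord fun j => ?_
  refine Fin.cases ?_ (fun i => ?_) j
  · simpa using hf
  · simpa using analyticAt_pi_iff.1 hg i

theorem analyticAt_vecTail (x : Fin (n + 1) → K) :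
    AnalyticAt K (fun y : Fin (n + 1) → K => vecTail y) x :=
  analyticAt_of_coord fun i => analyticAt_coord i.succ x

theorem analyticAt_mono (α : Fin n → ℕ) (x : Fin n → K) : AnalyticAt K (mono α) x := by
  refine Finset.analyticAt_fun_prod _ fun i _ => (analyticAt_coord i x).pow _

theorem mono_add (α β : Fin n → ℕ) (x : Fin n → K) : mono (α + β) x = mono α x * mono β x := by
  simp [mono, pow_add, Finset.prod_mul_distrib]

@[simp] theorem mono_zero (x : Fin n → K) : mono 0 x = 1 := by simp [mono]

theorem mono_single (i : Fin n) (k : ℕ) (x : Fin n → K) : mono (Pi.single i k) x = x i ^ k := by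
  rw [mono, Finset.prod_eq_single i] <;> simp +contextual

theorem mono_smul (k : ℕ) (α : Fin n → ℕ) (x : Fin n → K) : mono (k • α) x = mono α x ^ k := by
  simp [mono, Finset.prod_pow, pow_mul', Finset.prod_pow]

theorem mono_vecCons (k : ℕ) (α : Fin n → ℕ) (x : Fin (n + 1) → K) :
    mono (vecCons k α) x = x 0 ^ k * mono α (vecTail x) := by
  simp [mono, Fin.prod_univ_succ, vecTail]

theorem mono_update (α : Fin n → ℕ) (i : Fin n) (x : Fin n → K) (y : K) :
    mono α (Function.update x i y) = y ^ α i * mono (Function.update α i 0) x := by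
  rw [mono, mono, ← Finset.mul_prod_erase _ _ (Finset.mem_univ i),
    ← Finset.mul_prod_erase _ (fun j => x j ^ Function.update α i 0 j) (Finset.mem_univ i)]
  simp only [Function.update_self, pow_zero, one_mul]
  congr 1
  refine Finset.prod_congr rfl fun j hj => ?_
  simp [Function.update_of_ne (Finset.ne_of_mem_erase hj)]

theorem mono_eq_update (α : Fin n → ℕ) (i : Fin n) (x : Fin n → K) :
    mono α x = x i ^ α i * mono (Function.update α i 0) x := by
  conv_lhs => rw [← Function.update_eq_self i x]
  exact mono_update α i x _

theorem mono_eq_zero_of_pos {α : Fin n → ℕ} {i : Fin n} (h : 0 < α i) {x : Fin n → K}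
    (hx : x i = 0) : mono α x = 0 :=
  Finset.prod_eq_zero (Finset.mem_univ i) (by simp [hx, h.ne'])

theorem HasForm.congr {f g : (Fin n → K) → K} {α : Fin n → ℕ} (hf : HasForm f α)
    (h : ∀ᶠ x in 𝓝 0, g x = f x) : HasForm g α := by
  obtain ⟨u, hu, hu0, hfu⟩ := hf
  refine ⟨u, hu, hu0, ?_⟩
  filter_upwards [hfu, h] with x h1 h2
  rw [h2, h1]

theorem HasForm.mul {f g : (Fin n → K) → K} {α β : Fin n → ℕ} (hf : HasForm f α)
    (hg : HasForm g β) : HasForm (fun x => f x * g x) (α + β) := by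
  obtain ⟨u, hu, hu0, hfu⟩ := hf
  obtain ⟨v, hv, hv0, hgv⟩ := hg
  refine ⟨fun x => u x * v x, hu.mul hv, mul_ne_zero hu0 hv0, ?_⟩
  filter_upwards [hfu, hgv] with x h1 h2
  rw [h1, h2, mono_add]; ring

theorem HasForm.pow {f : (Fin n → K) → K} {α : Fin n → ℕ} (hf : HasForm f α) (k : ℕ) :
    HasForm (fun x => f x ^ k) (k • α) := by
  obtain ⟨u, hu, hu0, hfu⟩ := hf
  refine ⟨fun x => u x ^ k, hu.pow k, pow_ne_zero _ hu0, ?_⟩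
  filter_upwards [hfu] with x h1
  rw [h1, mono_smul]; ring

theorem hasForm_unit {u : (Fin n → K) → K} (hu : AnalyticAt K u 0) (hu0 : u 0 ≠ 0) :
    HasForm u 0 := ⟨u, hu, hu0, by simp⟩

theorem hasForm_mono (α : Fin n → ℕ) : HasForm (mono α : (Fin n → K) → K) α :=
  ⟨fun _ => 1, analyticAt_const, one_ne_zero, by simp⟩

theorem hasForm_coord (i : Fin n) :
    HasForm (fun x : Fin n → K => x i) (Pi.single i 1) :=
  (hasForm_mono _).congr (by simp [mono_single])

/-- Pullback of a form along a map under which monomials pull back to forms. -/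
theorem HasForm.comp {m : ℕ} {f : (Fin n → K) → K} {α : Fin n → ℕ} (hf : HasForm f α)
    {c : (Fin m → K) → Fin n → K} (hc : AnalyticAt K c 0) (hc0 : c 0 = 0) {β : Fin m → ℕ}
    (h : HasForm (fun x => mono α (c x)) β) : HasForm (fun x => f (c x)) β := by
  obtain ⟨u, hu, hu0, hfu⟩ := hf
  have hlim : Tendsto c (𝓝 0) (𝓝 0) := by
    simpa [ContinuousAt, hc0] using hc.continuousAt
  have := h.mul (hasForm_unit (u := fun x => u (c x))
    ((show AnalyticAt K u (c 0) by rwa [hc0]).comp hc) (by rwa [hc0]))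
  rw [add_zero] at this
  exact this.congr (by filter_upwards [hlim.eventually hfu] with x hx using hx)

theorem HasForm.comp_vecTail {f : (Fin n → K) → K} {α : Fin n → ℕ} (hf : HasForm f α) :
    HasForm (fun x => f (vecTail x)) (vecCons 0 α) :=
  hf.comp (analyticAt_vecTail 0) rfl ((hasForm_mono _).congr (by simp [mono_vecCons]))

theorem IsNC.congr {f g : (Fin n → K) → K} (hf : IsNC f) (h : ∀ᶠ x in 𝓝 0, g x = f x) :
    IsNC g := hf.imp fun _ h' => h'.congr h

theorem IsNC.mul {f g : (Fin n → K) → K} (hf : IsNC f) (hg : IsNC g) :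
    IsNC fun x => f x * g x := by
  obtain ⟨α, hα⟩ := hf
  obtain ⟨β, hβ⟩ := hg
  exact ⟨_, hα.mul hβ⟩

theorem IsNC.pow {f : (Fin n → K) → K} (hf : IsNC f) (k : ℕ) : IsNC fun x => f x ^ k :=
  ⟨_, hf.choose_spec.pow k⟩

theorem isNC_unit {u : (Fin n → K) → K} (hu : AnalyticAt K u 0) (hu0 : u 0 ≠ 0) : IsNC u :=
  ⟨_, hasForm_unit hu hu0⟩

theorem isNC_one : IsNC fun _ : Fin n → K => (1 : K) :=
  isNC_unit analyticAt_const one_ne_zero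

theorem isNC_coord (i : Fin n) : IsNC fun x : Fin n → K => x i := ⟨_, hasForm_coord i⟩

theorem tendsto_update_zero (i : Fin n) :
    Tendsto (fun x : Fin n → K => Function.update x i 0) (𝓝 0) (𝓝 0) := by
  have : Continuous fun x : Fin n → K => Function.update x i 0 := by fun_prop
  simpa [Function.update_eq_self_iff] using this.tendsto 0

theorem coord_not_eventuallyEq_zero (i : Fin n) :
    ¬ (fun x : Fin n → K => x i) =ᶠ[𝓝 0] 0 := by
  intro h
  have hl : Tendsto (fun t : K => Pi.single (M := fun _ : Fin n => K) i t) (𝓝[≠] 0) (𝓝 0) := by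
    have : Continuous fun t : K => Pi.single (M := fun _ : Fin n => K) i t :=
      continuous_single (A := fun _ : Fin n => K) i
    simpa using (this.tendsto 0).mono_left nhdsWithin_le_nhds
  obtain ⟨t, ht, ht0⟩ := ((hl.eventually h).and self_mem_nhdsWithin).exists
  simp at ht
  exact ht0 ht

theorem mono_update_mul (α : Fin n → ℕ) (i j : Fin n) (x : Fin n → K) :
    mono α (Function.update x i (x i * x j)) = mono (α + Pi.single j (α i)) x := by
  rw [mono_update, mono_add, mono_single, mono_eq_update α i, mul_pow]
  ring

theorem mono_update_pow (α : Fin n → ℕ) (i : Fin n) (ρ : K) (N : ℕ) (x : Fin n → K) :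
    mono α (Function.update x i (ρ * x i ^ N)) =
      mono (Function.update α i (N * α i)) x * ρ ^ α i := by
  rw [mono_update, mono_eq_update (Function.update α i (N * α i)) i, mul_pow, ← pow_mul]
  simp only [Function.update_self, Function.update_idem]
  ring

/-- A monomial times a unit does not vanish identically on a coordinate subspace on which the
exponent is trivial. -/
theorem exists_mono_mul_ne_zero {α : Fin n → ℕ} {u : (Fin n → K) → K} (hu : ContinuousAt u 0)
    (hu0 : u 0 ≠ 0) (S : Finset (Fin n)) (hS : ∀ i ∈ S, α i = 0)
    {p : (Fin n → K) → Prop} (hp : ∀ᶠ x in 𝓝 0, p x) :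
    ∃ x, p x ∧ (∀ i ∈ S, x i = 0) ∧ mono α x * u x ≠ 0 := by
  classical
  have hl : Tendsto (fun t : K => fun i : Fin n => if i ∈ S then (0 : K) else t)
      (𝓝[≠] 0) (𝓝 0) := by
    refine Tendsto.mono_left ?_ nhdsWithin_le_nhds
    have : Continuous (fun t : K => fun i : Fin n => if i ∈ S then (0 : K) else t) := by
      refine continuous_pi fun i => ?_
      split_ifs <;> fun_prop
    simpa [← Pi.zero_def] using this.tendsto 0
  obtain ⟨t, ⟨ht, hut⟩, ht0⟩ := (((hl.eventually hp).and
    (hl.eventually (hu.eventually_ne hu0))).and self_mem_nhdsWithin).exists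
  refine ⟨_, ht, fun i hi => by simp [hi], mul_ne_zero ?_ hut⟩
  refine Finset.prod_ne_zero_iff.2 fun i _ => ?_
  by_cases hi : i ∈ S
  · simp [hS i hi]
  · simpa [hi] using pow_ne_zero _ ht0

variable [CompleteSpace K]

/-- A germ vanishing on a coordinate hyperplane is divisible by the coordinate. -/
theorem exists_eq_coord_mul {f : (Fin n → K) → K} (hf : AnalyticAt K f 0) (i : Fin n)
    (h : ∀ᶠ x in 𝓝 0, f (Function.update x i 0) = 0) :
    ∃ g : (Fin n → K) → K, AnalyticAt K g 0 ∧ ∀ᶠ x in 𝓝 0, f x = x i * g x := by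
  obtain ⟨g, hg, hfg⟩ := exists_analyticAt_quotient hf
    (ContinuousLinearMap.proj (R := K) (φ := fun _ : Fin n => K) i) (Pi.single i 1)
  refine ⟨g, hg, ?_⟩
  filter_upwards [hfg, h] with x h1 h2
  have : x - (ContinuousLinearMap.proj (R := K) (φ := fun _ : Fin n => K) i) x • Pi.single i 1
      = Function.update x i 0 := by
    ext j
    by_cases hj : j = i
    · subst hj; simp
    · simp [Function.update_of_ne hj, Pi.single_eq_of_ne hj]
  rw [this, h2, zero_add] at h1
  simpa using h1

theorem exists_hasForm_of_mul (k : ℕ) : ∀ {f g : (Fin n → K) → K} {α : Fin n → ℕ},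
    ∑ i, α i = k → AnalyticAt K f 0 → AnalyticAt K g 0 → HasForm (fun x => f x * g x) α →
    IsNC f := by
  induction k with
  | zero =>
    intro f g α hα hf hg ⟨u, hu, hu0, h⟩
    have hα0 : α = 0 := by
      ext i; simpa using (Finset.sum_eq_zero_iff.1 hα) i (Finset.mem_univ i)
    refine isNC_unit hf fun h0 => hu0 ?_
    have := h.self_of_nhds
    simpa [hα0, h0] using this.symm
  | succ k ih =>
    intro f g α hα hf hg ⟨u, hu, hu0, h⟩
    obtain ⟨i, hi⟩ : ∃ i, 0 < α i := by
      by_contra! h'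
      have : ∑ i, α i = 0 := Finset.sum_eq_zero fun i _ => by simpa using h' i
      omega
    have hupd : AnalyticAt K (fun x : Fin n → K => Function.update x i 0) 0 :=
      analyticAt_update analyticAt_id analyticAt_const i
    have hupd0 : Function.update (0 : Fin n → K) i 0 = 0 := by simp
    have hfu : AnalyticAt K (fun x : Fin n → K => f (Function.update x i 0)) 0 :=
      AnalyticAt.comp (g := f) (by rwa [hupd0]) hupd
    have hgu : AnalyticAt K (fun x : Fin n → K => g (Function.update x i 0)) 0 :=
      AnalyticAt.comp (g := g) (by rwa [hupd0]) hupd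
    have hdec : α = Pi.single i 1 + (α - Pi.single i 1) := by
      ext j
      by_cases hj : j = i
      · subst hj; simp; omega
      · simp [hj]
    have hsum : ∑ j, (α - Pi.single i 1 : Fin n → ℕ) j = k := by
      have h1 : ∑ j, α j = ∑ j, (Pi.single i 1 + (α - Pi.single i 1) : Fin n → ℕ) j := by
        rw [← hdec]
      simp only [Pi.add_apply, Finset.sum_add_distrib, Finset.sum_pi_single', Finset.mem_univ,
        if_true] at h1
      omega
    have hcoord := analyticAt_coord (K := K) i (0 : Fin n → K)
    have hmonoα : ∀ x : Fin n → K, mono α x = x i * mono (α - Pi.single i 1) x := fun x => by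
      conv_lhs => rw [hdec, mono_add, mono_single, pow_one]
    rcases eventuallyEq_zero_or_of_mul hfu hgu (by
      filter_upwards [(tendsto_update_zero i).eventually h] with x hx
      rw [hx, mono_eq_zero_of_pos hi (by simp), zero_mul]) with h0 | h0
    · obtain ⟨f₁, hf₁, hff₁⟩ := exists_eq_coord_mul hf i h0
      have := mul_left_cancel_eventuallyEq (f := fun x => x i) (g := fun x => f₁ x * g x)
        (h := fun x => mono (α - Pi.single i 1) x * u x) hcoord
        (hf₁.mul hg) ((analyticAt_mono _ _).mul hu) (coord_not_eventuallyEq_zero i) (by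
          filter_upwards [h, hff₁] with x h1 h2
          rw [h2, hmonoα] at h1
          linear_combination h1)
      have := ih hsum hf₁ hg ⟨u, hu, hu0, this⟩
      exact ((isNC_coord i).mul this).congr hff₁
    · obtain ⟨g₁, hg₁, hgg₁⟩ := exists_eq_coord_mul hg i h0
      have := mul_left_cancel_eventuallyEq (f := fun x => x i) (g := fun x => f x * g₁ x)
        (h := fun x => mono (α - Pi.single i 1) x * u x) hcoord
        (hf.mul hg₁) ((analyticAt_mono _ _).mul hu) (coord_not_eventuallyEq_zero i) (by
          filter_upwards [h, hgg₁] with x h1 h2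
          rw [h2, hmonoα] at h1
          linear_combination h1)
      exact ih hsum hf hg₁ ⟨u, hu, hu0, this⟩

/-- A factor of a monomial times a unit is a monomial times a unit. -/
theorem IsNC.of_mul_left {f g : (Fin n → K) → K} (hf : AnalyticAt K f 0) (hg : AnalyticAt K g 0)
    (h : IsNC fun x => f x * g x) : IsNC f :=
  exists_hasForm_of_mul _ rfl hf hg h.choose_spec

/-- If two forms have a difference that vanishes or is again a form, then their exponents are
comparable. -/
theorem HasForm.le_or_le {f g : (Fin n → K) → K} {α β : Fin n → ℕ} (hf : HasForm f α)
    (hg : HasForm g β) (h : (∀ᶠ x in 𝓝 0, f x - g x = 0) ∨ IsNC fun x => f x - g x) :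
    α ≤ β ∨ β ≤ α := by
  by_contra! hcon
  obtain ⟨α', β', γ, rfl, rfl, hmin⟩ : ∃ α' β' γ : Fin n → ℕ, α = α' + γ ∧ β = β' + γ ∧
      ∀ k, α' k = 0 ∨ β' k = 0 := by
    refine ⟨α - α ⊓ β, β - α ⊓ β, α ⊓ β, ?_, ?_, fun k => ?_⟩
    · ext k; simp
    · ext k; simp
    · simp; omega
  obtain ⟨hαβ, hβα⟩ := hcon
  simp only [Pi.le_def, not_forall, not_le, Pi.add_apply, add_lt_add_iff_right] at hαβ hβα
  obtain ⟨i, hi⟩ := hβα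
  obtain ⟨j, hj⟩ := hαβ
  have hαi : α' i = 0 := by have := hmin i; omega
  have hβj : β' j = 0 := by have := hmin j; omega
  obtain ⟨u, hu, hu0, hfu⟩ := hf
  obtain ⟨v, hv, hv0, hgv⟩ := hg
  set d : (Fin n → K) → K := fun x => mono α' x * u x - mono β' x * v x with hd
  have hdan : AnalyticAt K d 0 :=
    ((analyticAt_mono _ _).mul hu).sub ((analyticAt_mono _ _).mul hv)
  have hfd : ∀ᶠ x in 𝓝 0, d x * mono γ x = f x - g x := by
    filter_upwards [hfu, hgv] with x h1 h2
    rw [h1, h2, mono_add, mono_add, hd]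
    ring
  have hα0 : ∀ k, α' k = 0 → ¬ ∀ᶠ x in 𝓝 0, x i = 0 → x k = 0 → d x = 0 := by
    intro k hk hev
    obtain ⟨x, hx, hxS, hne⟩ := exists_mono_mul_ne_zero (α := α') hu.continuousAt hu0 {i, k}
      (by simp [hαi, hk]) hev
    have := hx (hxS i (by simp)) (hxS k (by simp))
    simp only [hd, mono_eq_zero_of_pos (by omega : 0 < β' i) (hxS i (by simp))] at this
    exact hne (by simpa using this)
  have hβ0 : ∀ k, β' k = 0 → ¬ ∀ᶠ x in 𝓝 0, x j = 0 → x k = 0 → d x = 0 := by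
    intro k hk hev
    obtain ⟨x, hx, hxS, hne⟩ := exists_mono_mul_ne_zero (α := β') hv.continuousAt hv0 {j, k}
      (by simp [hβj, hk]) hev
    have := hx (hxS j (by simp)) (hxS k (by simp))
    simp only [hd, mono_eq_zero_of_pos (by omega : 0 < α' j) (hxS j (by simp))] at this
    exact hne (by simpa using this)
  rcases h with h | h
  · refine hα0 i hαi ?_
    have := mul_left_cancel_eventuallyEq (f := mono γ) (g := d) (h := 0) (analyticAt_mono γ 0)
      hdan analyticAt_const (fun h0 => ?_) (by
        filter_upwards [h, hfd] with x h1 h2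
        rw [mul_comm, h2, h1]; simp)
    · filter_upwards [this] with x hx _ _ using hx
    · obtain ⟨x, hx, -, hne⟩ := exists_mono_mul_ne_zero (α := γ) (u := fun _ => (1 : K))
        continuousAt_const one_ne_zero ∅ (by simp) h0
      exact hne (by simpa using hx)
  · obtain ⟨C, w, hw, hw0, hC⟩ := IsNC.of_mul_left hdan (analyticAt_mono γ 0) (h.congr hfd)
    have hC0 : C = 0 := by
      ext k
      by_contra hk
      have hk : 0 < C k := Nat.pos_of_ne_zero hk
      rcases hmin k with h' | h'
      · refine hα0 k h' ?_
        filter_upwards [hC] with x hx _ hxk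
        rw [hx, mono_eq_zero_of_pos hk hxk, zero_mul]
      · refine hβ0 k h' ?_
        filter_upwards [hC] with x hx _ hxk
        rw [hx, mono_eq_zero_of_pos hk hxk, zero_mul]
    have := hC.self_of_nhds
    rw [hC0, mono_zero, one_mul, hd] at this
    simp only [mono_eq_zero_of_pos (show 0 < β' i by omega) (show (0 : Fin n → K) i = 0 from rfl),
      mono_eq_zero_of_pos (show 0 < α' j by omega) (show (0 : Fin n → K) j = 0 from rfl)] at this
    exact hw0 (by simpa using this.symm)

end Forms

section Taylor

open Matrix

variable {K : Type*} [NontriviallyNormedField K]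

/-- Uniqueness of one-variable Taylor expansions. -/
theorem taylor_unique (m : ℕ) : ∀ {α : ℕ → K} {V W : K → K}, ContinuousAt V 0 →
    ContinuousAt W 0 →
    (∀ᶠ t in 𝓝[≠] 0, ∑ i ∈ Finset.range m, α i * t ^ i + t ^ m * V t = t ^ m * W t) →
    (∀ i < m, α i = 0) ∧ V 0 = W 0 := by
  induction m with
  | zero =>
    intro α V W hV hW h
    refine ⟨by simp, ?_⟩
    refine tendsto_nhds_unique_of_eventuallyEq (l := 𝓝[≠] 0) (hV.mono_left nhdsWithin_le_nhds)
      (hW.mono_left nhdsWithin_le_nhds) ?_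
    filter_upwards [h] with t ht
    simpa using ht
  | succ m ih =>
    intro α V W hV hW h
    have h1 : Tendsto (fun t => ∑ i ∈ Finset.range (m + 1), α i * t ^ i + t ^ (m + 1) * V t)
        (𝓝[≠] 0) (𝓝 (α 0)) := by
      refine Tendsto.mono_left ?_ nhdsWithin_le_nhds
      have : ContinuousAt
          (fun t => ∑ i ∈ Finset.range (m + 1), α i * t ^ i + t ^ (m + 1) * V t) 0 := by fun_prop
      simpa [ContinuousAt, Finset.sum_range_succ'] using this
    have h2 : Tendsto (fun t => t ^ (m + 1) * W t) (𝓝[≠] 0) (𝓝 0) := by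
      refine Tendsto.mono_left ?_ nhdsWithin_le_nhds
      have : ContinuousAt (fun t => t ^ (m + 1) * W t) 0 := by fun_prop
      simpa [ContinuousAt] using this
    have h0 : α 0 = 0 := tendsto_nhds_unique_of_eventuallyEq h1 h2 h
    obtain ⟨h3, h4⟩ := ih (α := fun i => α (i + 1)) hV hW (by
      filter_upwards [h, self_mem_nhdsWithin] with t ht (ht0 : t ≠ 0)
      rw [Finset.sum_range_succ', h0] at ht
      apply mul_left_cancel₀ ht0
      rw [mul_add, Finset.mul_sum]
      calc _ = ∑ i ∈ Finset.range m, α (i + 1) * t ^ (i + 1) + 0 * t ^ 0 + t ^ (m + 1) * V t := by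
            rw [zero_mul, add_zero]
            congr 1
            · exact Finset.sum_congr rfl fun i _ => by ring
            · ring
        _ = _ := by rw [ht]; ring)
    refine ⟨fun i hi => ?_, h4⟩
    rcases i with _ | i
    · exact h0
    · exact h3 i (by omega)

/-- Taylor expansion in the first variable. -/
theorem exists_taylor [CompleteSpace K] {n : ℕ} {g : (Fin (n + 1) → K) → K}
    (hg : AnalyticAt K g 0) (m : ℕ) :
    ∃ (a : ℕ → (Fin n → K) → K) (U : (Fin (n + 1) → K) → K), (∀ i, AnalyticAt K (a i) 0) ∧
      AnalyticAt K U 0 ∧ ∀ᶠ x in 𝓝 0,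
        g x = ∑ i ∈ Finset.range m, a i (vecTail x) * x 0 ^ i + x 0 ^ m * U x := by
  induction m with
  | zero => exact ⟨fun _ _ => 0, g, fun _ => analyticAt_const, hg, by simp⟩
  | succ m ih =>
    obtain ⟨a, U, ha, hU, h⟩ := ih
    obtain ⟨V, hV, hUV⟩ := exists_analyticAt_quotient hU
      (ContinuousLinearMap.proj (R := K) (φ := fun _ : Fin (n + 1) => K) 0) (Pi.single 0 1)
    have hc0 : vecCons (0 : K) (0 : Fin n → K) = 0 := by simp
    have hb : AnalyticAt K (fun y : Fin n → K => U (vecCons 0 y)) 0 :=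
      AnalyticAt.comp (g := U) (by rwa [hc0]) (analyticAt_vecCons analyticAt_const analyticAt_id)
    refine ⟨Function.update a m fun y => U (vecCons 0 y), V, fun i => ?_, hV, ?_⟩
    · by_cases hi : i = m
      · subst hi; simpa using hb
      · simpa [Function.update_of_ne hi] using ha i
    · filter_upwards [h, hUV] with x h1 h2
      have hx : x - (ContinuousLinearMap.proj (R := K) (φ := fun _ : Fin (n + 1) => K) 0) x •
          Pi.single 0 1 = vecCons 0 (vecTail x) := by
        ext j
        refine Fin.cases ?_ (fun i => ?_) j
        · simp
        · simp [vecTail]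
      rw [hx] at h2
      rw [h1, h2, Finset.sum_range_succ]
      have : ∑ i ∈ Finset.range m, Function.update a m (fun y => U (vecCons 0 y)) i (vecTail x) *
          x 0 ^ i = ∑ i ∈ Finset.range m, a i (vecTail x) * x 0 ^ i :=
        Finset.sum_congr rfl fun i hi => by
          rw [Function.update_of_ne (Finset.mem_range.1 hi).ne]
      rw [this]
      simp only [Function.update_self, ContinuousLinearMap.proj_apply]
      ring

/-- `g` is regular of order `m` in the first variable. -/
def IsReg {n : ℕ} (m : ℕ) (g : (Fin (n + 1) → K) → K) : Prop :=
  ∃ w : K → K, AnalyticAt K w 0 ∧ w 0 ≠ 0 ∧ ∀ᶠ t in 𝓝 0, g (vecCons t 0) = t ^ m * w t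

/-- The analytic implicit function theorem, solving for the first variable. -/
theorem exists_implicit [CompleteSpace K] {n : ℕ} {A : (Fin (n + 1) → K) → K}
    (hA : AnalyticAt K A 0) (hA0 : A 0 = 0) (hA' : fderiv K A 0 (Pi.single 0 1) ≠ 0) :
    ∃ φ : (Fin n → K) → K, AnalyticAt K φ 0 ∧ φ 0 = 0 ∧ ∀ᶠ y in 𝓝 0, A (vecCons (φ y) y) = 0 := by
  set Ψ : (Fin (n + 1) → K) → Fin (n + 1) → K := fun x => vecCons (A x) (vecTail x) with hΨ
  have hΨan : AnalyticAt K Ψ 0 := analyticAt_vecCons hA (analyticAt_vecTail 0)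
  have hΨ0 : Ψ 0 = 0 := by
    simp [hΨ, hA0]
  set L := fderiv K Ψ 0 with hL
  have hL0 : ∀ v, L v 0 = fderiv K A 0 v := fun v => by
    have h1 : HasFDerivAt (fun x => Ψ x 0)
      ((ContinuousLinearMap.proj (R := K) (φ := fun _ : Fin (n + 1) => K) 0).comp L) 0 :=
      hasFDerivAt_pi'.1 hΨan.differentiableAt.hasFDerivAt 0
    have h2 := h1.unique (f := A) (by simpa [hΨ] using hA.differentiableAt.hasFDerivAt)
    rw [← h2]; rfl
  have hLs : ∀ v (i : Fin n), L v i.succ = v i.succ := fun v i => by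
    have h1 : HasFDerivAt (fun x => Ψ x i.succ)
      ((ContinuousLinearMap.proj (R := K) (φ := fun _ : Fin (n + 1) => K) i.succ).comp L) 0 :=
      hasFDerivAt_pi'.1 hΨan.differentiableAt.hasFDerivAt i.succ
    have h2 := h1.unique
      ((ContinuousLinearMap.proj (R := K) (φ := fun _ : Fin (n + 1) => K) i.succ).hasFDerivAt)
    have := congrArg (fun T => T v) h2
    simpa using this
  have hinj : Function.Injective (L : (Fin (n + 1) → K) →ₗ[K] Fin (n + 1) → K) := by
    refine (injective_iff_map_eq_zero _).2 fun v hv => ?_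
    have hvs : ∀ i : Fin n, v i.succ = 0 := fun i => by
      rw [← hLs v i]; exact congrFun hv i.succ
    have hv1 : v = v 0 • Pi.single 0 1 := by
      ext j
      refine Fin.cases ?_ (fun i => ?_) j
      · simp
      · simp [hvs i]
    have h0 : fderiv K A 0 v = 0 := by rw [← hL0]; exact congrFun hv 0
    rw [hv1, map_smul, smul_eq_mul] at h0
    rw [hv1, (mul_eq_zero.1 h0).resolve_right hA', zero_smul]
  let e : (Fin (n + 1) → K) ≃L[K] (Fin (n + 1) → K) :=
    (LinearEquiv.ofInjectiveEndo _ hinj).toContinuousLinearEquiv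
  have he : (e : (Fin (n + 1) → K) →L[K] Fin (n + 1) → K) = L := by ext v : 1; rfl
  have hstrict : HasStrictFDerivAt Ψ (e : (Fin (n + 1) → K) →L[K] Fin (n + 1) → K) 0 := by
    rw [he]; exact hΨan.hasStrictFDerivAt
  set R := hstrict.toOpenPartialHomeomorph Ψ with hR
  have hRc : ⇑R = Ψ := hstrict.toOpenPartialHomeomorph_coe
  have h0s : (0 : Fin (n + 1) → K) ∈ R.source := hstrict.mem_toOpenPartialHomeomorph_source
  have h0t : (0 : Fin (n + 1) → K) ∈ R.target := by
    have := R.map_source h0s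
    rwa [hRc, hΨ0] at this
  have hsymm0 : R.symm 0 = 0 := by
    have := R.left_inv h0s
    rwa [hRc, hΨ0] at this
  have hsymm : AnalyticAt K R.symm 0 := by
    have h1 : AnalyticAt K R.symm (R 0) := by
      refine R.analyticAt_symm' (i := e) h0s ?_ ?_
      · rw [hRc]; exact hΨan
      · rw [hRc, he]
    rwa [hRc, hΨ0] at h1
  have hcons : AnalyticAt K (fun y : Fin n → K => vecCons (0 : K) y) 0 :=
    analyticAt_vecCons analyticAt_const analyticAt_id
  have hc0 : vecCons (0 : K) (0 : Fin n → K) = 0 := by simp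
  refine ⟨fun y => R.symm (vecCons 0 y) 0, ?_, by simp only [hc0, hsymm0]; rfl, ?_⟩
  · exact analyticAt_pi_iff.1 (AnalyticAt.comp (g := R.symm) (by rwa [hc0]) hcons) 0
  · have hcont : Tendsto (fun y : Fin n → K => vecCons (0 : K) y) (𝓝 0) (𝓝 0) := by
      simpa only [ContinuousAt, hc0] using hcons.continuousAt
    filter_upwards [hcont.eventually (R.open_target.mem_nhds h0t)] with y hy
    have h1 : Ψ (R.symm (vecCons 0 y)) = vecCons 0 y := by
      rw [← hRc]; exact R.right_inv hy
    have h2 : vecCons (R.symm (vecCons 0 y) 0) y = R.symm (vecCons 0 y) := by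
      ext j
      refine Fin.cases ?_ (fun i => ?_) j
      · simp
      · have := congrFun h1 i.succ
        simp only [hΨ, cons_val_succ] at this
        simpa [vecTail] using this.symm
    rw [h2]
    simpa [hΨ] using congrFun h1 0

/-- Completing the `m`-th power: after translating the first variable, a function which is regular
of order `m` has a Taylor expansion whose coefficient of order `m - 1` vanishes. -/
theorem exists_maximal_contact [CompleteSpace K] [CharZero K] {n m : ℕ}
    {g : (Fin (n + 1) → K) → K} (hg : AnalyticAt K g 0) (hreg : IsReg (m + 1) g) :
    ∃ (φ : (Fin n → K) → K) (a : ℕ → (Fin n → K) → K) (U : (Fin (n + 1) → K) → K),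
      AnalyticAt K φ 0 ∧ φ 0 = 0 ∧ (∀ i, AnalyticAt K (a i) 0) ∧ AnalyticAt K U 0 ∧ U 0 ≠ 0 ∧
      (∀ᶠ y in 𝓝 0, a m y = 0) ∧ ∀ᶠ x in 𝓝 0,
        g (vecCons (x 0 + φ (vecTail x)) (vecTail x)) =
          ∑ i ∈ Finset.range (m + 1), a i (vecTail x) * x 0 ^ i + x 0 ^ (m + 1) * U x := by
  obtain ⟨w, hw, hw0, hgw⟩ := hreg
  have hS : AnalyticAt K (fun x : Fin (n + 2) → K =>
      vecCons (x 1 + x 0) (vecTail (vecTail x))) 0 :=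
    analyticAt_vecCons ((analyticAt_coord 1 0).add (analyticAt_coord 0 0))
      (AnalyticAt.comp (g := fun y : Fin (n + 1) → K => vecTail y) (analyticAt_vecTail _)
        (analyticAt_vecTail 0))
  have hS0 : vecCons ((0 : Fin (n + 2) → K) 1 + (0 : Fin (n + 2) → K) 0)
      (vecTail (vecTail (0 : Fin (n + 2) → K))) = 0 := by
    ext j; refine Fin.cases ?_ (fun i => ?_) j <;> simp [vecTail]
  obtain ⟨A, U, hA, hU, hgA⟩ := exists_taylor
    (g := fun x : Fin (n + 2) → K => g (vecCons (x 1 + x 0) (vecTail (vecTail x))))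
    (AnalyticAt.comp (g := g) (by rwa [hS0]) hS) (m + 1)
  -- the line `t ↦ (t, s, 0)`
  have hline : Continuous fun q : K × K => (vecCons q.1 (vecCons q.2 0) : Fin (n + 2) → K) := by
    refine continuous_pi fun j => ?_
    refine Fin.cases ?_ (fun i => Fin.cases ?_ (fun i => ?_) i) j
    · simpa using continuous_fst
    · simpa using continuous_snd
    · simpa using continuous_const
  have hline0 : (vecCons (0 : K) (vecCons (0 : K) 0) : Fin (n + 2) → K) = 0 := by simp
  have hgts : ∀ᶠ t in 𝓝 (0 : K), ∀ᶠ s in 𝓝 (0 : K), (s + t) ^ (m + 1) * w (s + t) =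
      ∑ i ∈ Finset.range (m + 1), A i (vecCons s 0) * t ^ i +
        t ^ (m + 1) * U (vecCons t (vecCons s 0)) := by
    have h1 : ∀ᶠ q in 𝓝 ((0 : K), (0 : K)), (q.2 + q.1) ^ (m + 1) * w (q.2 + q.1) =
      ∑ i ∈ Finset.range (m + 1), A i (vecCons q.2 0) * q.1 ^ i +
        q.1 ^ (m + 1) * U (vecCons q.1 (vecCons q.2 0)) := by
      have h2 : Tendsto (fun q : K × K => q.2 + q.1) (𝓝 (0, 0)) (𝓝 0) := by
        have : Continuous fun q : K × K => q.2 + q.1 := by fun_prop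
        simpa using this.tendsto (0, 0)
      have h3 := hline.tendsto (0, 0)
      simp only [hline0] at h3
      filter_upwards [h2.eventually hgw, h3.eventually hgA] with q hq1 hq2
      simp at hq1 hq2
      rw [← hq1, ← hq2]
    rw [nhds_prod_eq] at h1
    exact h1.curry
  have hcont_t : Tendsto (fun t : K => (vecCons t (vecCons 0 0) : Fin (n + 2) → K)) (𝓝 0)
      (𝓝 0) := by
    have := hline.comp (show Continuous fun t : K => (t, (0 : K)) by fun_prop)
    have := this.tendsto 0
    simpa [Function.comp_def] using this
  have hU1 : ContinuousAt (fun t : K => U (vecCons t (vecCons 0 0))) 0 := by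
    have := hU.continuousAt.tendsto.comp hcont_t
    rw [ContinuousAt, hline0]; exact this
  obtain ⟨hA0, hU0⟩ := taylor_unique (m + 1) (α := fun i => A i 0)
    (V := fun t => U (vecCons t (vecCons 0 0))) (W := w) hU1 hw.continuousAt (by
      filter_upwards [nhdsWithin_le_nhds hgts] with t ht
      have := ht.self_of_nhds
      simpa using this.symm)
  have hder : (m + 1) * w 0 = fderiv K (A m) 0 (Pi.single 0 1) := by
    have hU' : ContinuousAt (fun t : K => fderiv K U (vecCons t (vecCons 0 0))
      (Pi.single 1 1)) 0 := by
      have h1 : ContinuousAt (fderiv K U) 0 := hU.fderiv.continuousAt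
      have h2 := h1.tendsto.comp hcont_t
      rw [ContinuousAt, hline0]
      exact ((ContinuousLinearMap.apply K K (Pi.single 1 1 : Fin (n + 2) → K)).continuous.tendsto
        _).comp h2
    have := (taylor_unique m (α := fun i => fderiv K (A i) 0 (Pi.single 0 1))
      (V := fun t => fderiv K (A m) 0 (Pi.single 0 1) +
        t * fderiv K U (vecCons t (vecCons 0 0)) (Pi.single 1 1))
      (W := fun t => (m + 1) * w t + t * deriv w t)
      (by fun_prop) (by
        have h1 := hw.continuousAt
        have h2 := hw.deriv.continuousAt
        fun_prop) ?_).2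
    · simpa using this.symm
    · refine nhdsWithin_le_nhds ?_
      filter_upwards [hgts, hw.eventually_analyticAt, hcont_t.eventually hU.eventually_analyticAt]
        with t ht hwt hUt
      have hl : HasDerivAt (fun s : K => (s + t) ^ (m + 1) * w (s + t))
          ((m + 1) * t ^ m * w t + t ^ (m + 1) * deriv w t) 0 := by
        have h1 : HasDerivAt (fun s : K => s + t) 1 0 := (hasDerivAt_id 0).add_const t
        have h2 : HasDerivAt w (deriv w t) (0 + t) := by
          rw [zero_add]; exact hwt.differentiableAt.hasDerivAt
        have h3 := (h1.pow (m + 1)).mul (h2.comp (0 : K) h1)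
        exact h3.congr_deriv (by simp)
      have hvs : ∀ s, HasDerivAt (fun s : K => (vecCons s 0 : Fin (n + 1) → K))
        (Pi.single 0 1) s := by
        intro s
        refine hasDerivAt_pi.2 fun j => ?_
        refine Fin.cases ?_ (fun i => ?_) j
        · simpa using hasDerivAt_id' s
        · simpa using hasDerivAt_const s (0 : K)
      have hvts : ∀ s, HasDerivAt (fun s : K => (vecCons t (vecCons s 0) : Fin (n + 2) → K))
          (Pi.single 1 1) s := by
        intro s
        refine hasDerivAt_pi.2 fun j => ?_
        refine Fin.cases ?_ (fun i => Fin.cases ?_ (fun i => ?_) i) j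
        · simpa using hasDerivAt_const s t
        · simpa using hasDerivAt_id' s
        · have : (Pi.single 1 1 : Fin (n + 2) → K) i.succ.succ = 0 := by
            rw [Pi.single_eq_of_ne]
            exact fun h => Fin.succ_ne_zero i (Fin.succ_injective _ h)
          rw [this]
          simpa using hasDerivAt_const s (0 : K)
      have hA1 : ∀ i, HasDerivAt (fun s : K => A i (vecCons s 0))
          (fderiv K (A i) 0 (Pi.single 0 1)) 0 := fun i => by
        have h1 : HasFDerivAt (A i) (fderiv K (A i) 0) (vecCons 0 0) := by
          simpa using (hA i).differentiableAt.hasFDerivAt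
        exact h1.comp_hasDerivAt 0 (hvs 0)
      have hU2 : HasDerivAt (fun s : K => U (vecCons t (vecCons s 0)))
          (fderiv K U (vecCons t (vecCons 0 0)) (Pi.single 1 1)) 0 :=
        hUt.differentiableAt.hasFDerivAt.comp_hasDerivAt 0 (hvts 0)
      have hr : HasDerivAt (fun s : K => ∑ i ∈ Finset.range (m + 1), A i (vecCons s 0) * t ^ i +
          t ^ (m + 1) * U (vecCons t (vecCons s 0)))
          (∑ i ∈ Finset.range (m + 1), fderiv K (A i) 0 (Pi.single 0 1) * t ^ i +
            t ^ (m + 1) * fderiv K U (vecCons t (vecCons 0 0)) (Pi.single 1 1)) 0 :=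
        (HasDerivAt.fun_sum fun i _ => (hA1 i).mul_const _).add (hU2.const_mul _)
      have := (hl.congr_of_eventuallyEq (f₁ := fun s : K => ∑ i ∈ Finset.range (m + 1),
        A i (vecCons s 0) * t ^ i + t ^ (m + 1) * U (vecCons t (vecCons s 0))) (by
        filter_upwards [ht] with s hs using hs.symm)).unique hr
      rw [Finset.sum_range_succ] at this
      linear_combination -this
  obtain ⟨φ, hφ, hφ0, hAφ⟩ := exists_implicit (hA m) (hA0 m (by omega)) (by
    rw [← hder]; exact mul_ne_zero (by exact_mod_cast m.succ_ne_zero) hw0)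
  have hcφ : AnalyticAt K (fun y => vecCons (φ y) y) 0 := analyticAt_vecCons hφ analyticAt_id
  have hcφ0 : vecCons (φ 0) (0 : Fin n → K) = 0 := by simp [hφ0]
  have hc : AnalyticAt K (fun x : Fin (n + 1) → K =>
      vecCons (x 0) (vecCons (φ (vecTail x)) (vecTail x))) 0 :=
    analyticAt_vecCons (analyticAt_coord 0 0)
      (AnalyticAt.comp (g := fun y => vecCons (φ y) y) hcφ (analyticAt_vecTail 0))
  have hc0 : vecCons ((0 : Fin (n + 1) → K) 0)
      (vecCons (φ (vecTail (0 : Fin (n + 1) → K))) (vecTail (0 : Fin (n + 1) → K))) = 0 := by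
    have : vecTail (0 : Fin (n + 1) → K) = 0 := rfl
    rw [this, hcφ0]; simp
  refine ⟨φ, fun i y => A i (vecCons (φ y) y),
    fun x => U (vecCons (x 0) (vecCons (φ (vecTail x)) (vecTail x))), hφ, hφ0, fun i => ?_, ?_, ?_,
    hAφ, ?_⟩
  · exact AnalyticAt.comp (g := A i) (by rw [hcφ0]; exact hA i) hcφ
  · exact AnalyticAt.comp (g := U) (by rw [hc0]; exact hU) hc
  · simp only [hc0]
    simp only [hline0] at hU0
    rw [hU0]; exact hw0
  · have h1 := hc.continuousAt.tendsto
    rw [hc0] at h1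
    filter_upwards [h1.eventually hgA] with x hx
    simp at hx
    rw [← hx, add_comm]

end Taylor

section Tree

open Matrix

theorem vecTail_update_succ {K : Type*} {n : ℕ} (x : Fin (n + 1) → K) (i : Fin n) (t : K) :
    vecTail (Function.update x i.succ t) = Function.update (vecTail x) i t := by
  ext j
  by_cases h : j = i
  · subst h; simp [vecTail]
  · have : j.succ ≠ i.succ := fun h' => h (Fin.succ_injective _ h')
    simp [vecTail, Function.update_of_ne h, Function.update_of_ne this]

theorem vecTail_update_zero {K : Type*} {n : ℕ} (x : Fin (n + 1) → K) (t : K) :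
    vecTail (Function.update x 0 t) = vecTail x := by
  ext j; simp [vecTail]

variable {K : Type*} [NontriviallyNormedField K]

/-- Finite-depth trees of elementary coordinate changes at the origin (shears, blowing ups of
codimension two coordinate subspaces, and power maps), acting on pairs consisting of a map `Φ` and
a Jacobian factor `J`, all of whose leaves satisfy `P`. -/
inductive Tree {n : ℕ} {Y : Type*} (P : ((Fin n → K) → Y) → ((Fin n → K) → K) → Prop) :
    ((Fin n → K) → Y) → ((Fin n → K) → K) → Prop
  | leaf {Φ J} (h : P Φ J) : Tree P Φ J
  | shear {Φ J} (i : Fin n) (φ : (Fin n → K) → K) (han : AnalyticAt K φ 0) (h0 : φ 0 = 0)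
      (hcont : Continuous φ) (hinv : ∀ x t, φ (Function.update x i t) = φ x)
      (h : Tree P (fun x => Φ (Function.update x i (x i + φ x)))
        (fun x => J (Function.update x i (x i + φ x)))) : Tree P Φ J
  | blowup {Φ J} (i j : Fin n) (hij : i ≠ j)
      (h : ∀ c : K, Tree P (fun x => Φ (Function.update x j (x i * (x j + c))))
        (fun x => J (Function.update x j (x i * (x j + c))) * x i))
      (h' : Tree P (fun x => Φ (Function.update x i (x i * x j)))
        (fun x => J (Function.update x i (x i * x j)) * x j)) : Tree P Φ J
  | power {Φ J} (i : Fin n) (N : ℕ) (hN : 0 < N)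
      (h : ∀ ρ : K, ρ ≠ 0 → Tree P (fun x => Φ (Function.update x i (ρ * x i ^ N)))
        (fun x => J (Function.update x i (ρ * x i ^ N)) * (ρ * x i ^ (N - 1)))) : Tree P Φ J

variable {n : ℕ} {Y Z : Type*}

theorem Tree.transport {P : ((Fin n → K) → Y) → ((Fin n → K) → K) → Prop}
    {Q : ((Fin n → K) → Z) → ((Fin n → K) → K) → Prop} (Φ₀ : Y → Z) (J₀ : Y → K)
    {Ψ : (Fin n → K) → Y} {J : (Fin n → K) → K} (hT : Tree P Ψ J)
    (hP : ∀ Ψ J, P Ψ J → Tree Q (fun x => Φ₀ (Ψ x)) (fun x => J₀ (Ψ x) * J x)) :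
    Tree Q (fun x => Φ₀ (Ψ x)) (fun x => J₀ (Ψ x) * J x) := by
  induction hT with
  | leaf h => exact hP _ _ h
  | shear i φ han h0 hcont hinv _ ih => exact .shear i φ han h0 hcont hinv ih
  | blowup i j hij _ _ ih ih' =>
    refine .blowup i j hij (fun c => ?_) ?_
    · simpa only [mul_assoc] using ih c
    · simpa only [mul_assoc] using ih'
  | power i N hN _ ih =>
    refine .power i N hN fun ρ hρ => ?_
    simpa only [mul_assoc] using ih ρ hρ

/-- Coordinate changes in the last variables act on functions of all variables. -/
theorem Tree.lift {P : ((Fin n → K) → Y) → ((Fin n → K) → K) → Prop}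
    {Q : ((Fin (n + 1) → K) → Z) → ((Fin (n + 1) → K) → K) → Prop} (Φ₀ : K → Y → Z)
    {Ψ : (Fin n → K) → Y} {J : (Fin n → K) → K} (hT : Tree P Ψ J)
    (hP : ∀ Ψ J, P Ψ J → Tree Q (fun x => Φ₀ (x 0) (Ψ (vecTail x))) (fun x => J (vecTail x))) :
    Tree Q (fun x => Φ₀ (x 0) (Ψ (vecTail x))) (fun x => J (vecTail x)) := by
  have h0 : ∀ (x : Fin (n + 1) → K) (i : Fin n) t, Function.update x i.succ t 0 = x 0 :=
    fun x i t => Function.update_of_ne (Fin.succ_ne_zero i).symm _ _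
  induction hT with
  | leaf h => exact hP _ _ h
  | shear i φ han hφ0 hcont hinv _ ih =>
    refine .shear i.succ (fun x => φ (vecTail x))
      (AnalyticAt.comp (g := φ) han (analyticAt_vecTail 0)) hφ0
      (hcont.comp (continuous_pi fun j => continuous_apply j.succ)) (fun x t => ?_) ?_
    · rw [vecTail_update_succ, hinv]
    · simp only [vecTail_update_succ, h0]; exact ih
  | blowup i j hij _ _ ih ih' =>
    refine .blowup i.succ j.succ (fun h' => hij (Fin.succ_injective _ h')) (fun c => ?_) ?_
    · simp only [vecTail_update_succ, h0]; exact ih c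
    · simp only [vecTail_update_succ, h0]; exact ih'
  | power i N hN _ ih =>
    refine .power i.succ N hN fun ρ hρ => ?_
    simp only [vecTail_update_succ, h0]; exact ih ρ hρ

/-- The composite coordinate changes in a tree are analytic and fix the origin. -/
theorem Tree.analytic {m : ℕ} {P : ((Fin n → K) → Fin m → K) → ((Fin n → K) → K) → Prop}
    {Φ : (Fin n → K) → Fin m → K} {J : (Fin n → K) → K} (hT : Tree P Φ J)
    (hΦ : AnalyticAt K Φ 0) (hΦ0 : Φ 0 = 0) :
    Tree (fun Φ J => P Φ J ∧ AnalyticAt K Φ 0 ∧ Φ 0 = 0) Φ J := by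
  have key : ∀ {Φ : (Fin n → K) → Fin m → K} (i : Fin n) (ψ : (Fin n → K) → K),
      AnalyticAt K Φ 0 → AnalyticAt K ψ 0 → ψ 0 = 0 →
      AnalyticAt K (fun x => Φ (Function.update x i (ψ x))) 0 ∧
        Φ (Function.update 0 i (ψ 0)) = Φ 0 := by
    intro Φ i ψ hΦ hψ hψ0
    have h0 : Function.update (0 : Fin n → K) i (ψ 0) = 0 := by rw [hψ0]; simp
    exact ⟨AnalyticAt.comp (g := Φ) (by rwa [h0]) (analyticAt_update analyticAt_id hψ i),
      by rw [h0]⟩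
  induction hT with
  | leaf h => exact .leaf ⟨h, hΦ, hΦ0⟩
  | shear i φ han h0 hcont hinv _ ih =>
    have := key i (fun x => x i + φ x) hΦ ((analyticAt_coord i 0).add han) (by simp [h0])
    exact .shear i φ han h0 hcont hinv (ih this.1 (this.2.trans hΦ0))
  | blowup i j hij _ _ ih ih' =>
    refine .blowup i j hij (fun c => ?_) ?_
    · have := key j (fun x => x i * (x j + c)) hΦ
        ((analyticAt_coord i 0).mul ((analyticAt_coord j 0).add analyticAt_const)) (by simp)
      exact ih c this.1 (this.2.trans hΦ0)
    · have := key i (fun x => x i * x j) hΦ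
        ((analyticAt_coord i 0).mul (analyticAt_coord j 0)) (by simp)
      exact ih' this.1 (this.2.trans hΦ0)
  | power i N hN _ ih =>
    refine .power i N hN fun ρ hρ => ?_
    have := key i (fun x => ρ * x i ^ N) hΦ
        (analyticAt_const.mul ((analyticAt_coord i 0).pow N)) (by simp [hN.ne'])
    exact ih ρ hρ this.1 (this.2.trans hΦ0)

/-- Pulling back `F` gives a monomial times a unit, as does the Jacobian. -/
def IsLeaf (F : Y → K) (Φ : (Fin n → K) → Y) (J : (Fin n → K) → K) : Prop :=
  IsNC (fun x => F (Φ x)) ∧ IsNC J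

/-- `F` can be monomialised by a tree of coordinate changes. -/
def Resolvable (F : (Fin n → K) → K) : Prop :=
  Tree (fun π J => IsLeaf F π J ∧ AnalyticAt K π 0 ∧ π 0 = 0) (fun x => x) (fun _ => 1)

theorem Resolvable.mk' {F : (Fin n → K) → K} (h : Tree (IsLeaf F) (fun x => x) (fun _ => 1)) :
    Resolvable F :=
  h.analytic analyticAt_id rfl

theorem hasForm_power {N : ℕ} (hN : 0 < N) {f : (Fin n → K) → K} {α : Fin n → ℕ}
    (hf : HasForm f α) (i : Fin n) {ρ : K} (hρ : ρ ≠ 0) :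
    HasForm (fun x => f (Function.update x i (ρ * x i ^ N))) (Function.update α i (N * α i)) := by
  refine hf.comp (c := fun x => Function.update x i (ρ * x i ^ N))
    (analyticAt_update analyticAt_id (analyticAt_const.mul ((analyticAt_coord i 0).pow N)) i)
    (by simp [hN.ne']) ?_
  have := (hasForm_mono (K := K) (Function.update α i (N * α i))).mul
    (hasForm_unit (u := fun _ => ρ ^ α i) analyticAt_const (pow_ne_zero _ hρ))
  rw [add_zero] at this
  exact this.congr (by simp [mono_update_pow])

/-- Power maps make all exponents divisible by `N`. -/
theorem tree_power {N : ℕ} (hN : 0 < N) (S : Finset (Fin n)) :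
    Tree (K := K) (fun (ψ : (Fin n → K) → Fin n → K) J => IsNC J ∧ ∀ f α, HasForm f α →
      ∃ α', HasForm (fun x => f (ψ x)) α' ∧ ∀ i ∈ S, N ∣ α' i) (fun x => x) (fun _ => 1) := by
  classical
  induction S using Finset.induction_on with
  | empty => exact .leaf ⟨isNC_one, fun f α h => ⟨α, h, by simp⟩⟩
  | insert i S hi ih =>
    have := ih.transport (Q := fun (ψ : (Fin n → K) → Fin n → K) J => IsNC J ∧ ∀ f α, HasForm f α →
      ∃ α', HasForm (fun x => f (ψ x)) α' ∧ ∀ j ∈ insert i S, N ∣ α' j) (fun y => y) (fun _ => 1) ?_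
    · simpa using this
    · rintro Ψ J ⟨hJ, hΨ⟩
      refine .power i N hN fun ρ hρ => .leaf ⟨?_, fun f α hf => ?_⟩
      · obtain ⟨β, hβ⟩ := hJ
        have h1 : IsNC fun x : Fin n → K => J (Function.update x i (ρ * x i ^ N)) :=
          ⟨_, hasForm_power hN hβ i hρ⟩
        have h2 : IsNC fun x : Fin n → K => ρ * x i ^ (N - 1) :=
          (isNC_unit analyticAt_const hρ).mul ((isNC_coord i).pow _)
        simpa using h1.mul h2
      · obtain ⟨α', h1, h2⟩ := hΨ f α hf
        refine ⟨_, hasForm_power hN h1 i hρ, fun j hj => ?_⟩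
        by_cases hji : j = i
        · subst hji; simp
        · rw [Function.update_of_ne hji]
          exact h2 j ((Finset.mem_insert.1 hj).resolve_left hji)

variable [CompleteSpace K]

/-- A finite set of nonzero analytic germs has a nonzero common multiple. -/
theorem exists_common_multiple {S : Set ((Fin n → K) → K)} (hS : S.Finite)
    (h : ∀ f ∈ S, AnalyticAt K f 0 ∧ ¬ f =ᶠ[𝓝 0] 0) :
    ∃ H : (Fin n → K) → K, AnalyticAt K H 0 ∧ ¬ H =ᶠ[𝓝 0] 0 ∧
      ∀ f ∈ S, ∃ b : (Fin n → K) → K, AnalyticAt K b 0 ∧ ∀ x, H x = f x * b x := by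
  induction S, hS using Set.Finite.induction_on with
  | empty =>
    refine ⟨fun _ => 1, analyticAt_const, fun h => ?_, by simp⟩
    simpa using h.self_of_nhds
  | @insert f S hf hS ih =>
    obtain ⟨H, hH, hH0, hd⟩ := ih fun f hf => h f (Set.mem_insert_of_mem _ hf)
    obtain ⟨hfa, hf0⟩ := h f (Set.mem_insert _ _)
    refine ⟨f * H, hfa.mul hH, mul_not_eventuallyEq_zero hfa hH hf0 hH0, ?_⟩
    rintro g (rfl | hg)
    · exact ⟨H, hH, fun x => rfl⟩
    · obtain ⟨b, hb, hHb⟩ := hd g hg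
      refine ⟨fun x => f x * b x, hfa.mul hb, fun x => ?_⟩
      simp only [Pi.mul_apply, hHb]; ring

/-- Simultaneous monomialisation of finitely many germs, with all exponents divisible by `N`. -/
theorem tree_finite (hmain : ∀ f : (Fin n → K) → K, AnalyticAt K f 0 → ¬ f =ᶠ[𝓝 0] 0 → Resolvable f)
    {N : ℕ} (hN : 0 < N) {S : Set ((Fin n → K) → K)} (hS : S.Finite)
    (h : ∀ f ∈ S, AnalyticAt K f 0 ∧ ¬ f =ᶠ[𝓝 0] 0) :
    Tree (K := K) (fun (π : (Fin n → K) → Fin n → K) J => (IsNC J ∧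
      ∀ f ∈ S, ∃ α, HasForm (fun x => f (π x)) (N • α)) ∧ AnalyticAt K π 0 ∧ π 0 = 0)
      (fun x => x) (fun _ => 1) := by
  refine Tree.analytic ?_ analyticAt_id rfl
  obtain ⟨H, hH, hH0, hd⟩ := exists_common_multiple hS h
  have := (hmain H hH hH0).transport (Q := fun (π : (Fin n → K) → Fin n → K) J => (IsNC J ∧
      ∀ f ∈ S, ∃ α, HasForm (fun x => f (π x)) (N • α))) (fun y => y) (fun _ => 1) ?_
  · simpa using this
  rintro π J ⟨⟨hHπ, hJ⟩, hπ, hπ0⟩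
  have := (tree_power (K := K) (n := n) hN Finset.univ).transport
    (Q := fun (π : (Fin n → K) → Fin n → K) J => (IsNC J ∧
      ∀ f ∈ S, ∃ α, HasForm (fun x => f (π x)) (N • α))) π J ?_
  · simpa using this
  rintro ψ Jψ ⟨hJψ, hψ⟩
  have hψ' : ∀ f, IsNC f → ∃ α, HasForm (fun x => f (ψ x)) (N • α) := by
    rintro f ⟨α, hα⟩
    obtain ⟨α', h1, h2⟩ := hψ f α hα
    choose q hq using fun i => h2 i (Finset.mem_univ i)
    refine ⟨q, ?_⟩
    have : N • q = α' := by ext i; simp [hq i]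
    rwa [this]
  refine .leaf ⟨?_, fun f hf => ?_⟩
  · obtain ⟨α, hα⟩ := hψ' J hJ
    exact IsNC.mul ⟨_, hα⟩ hJψ
  · obtain ⟨b, hb, hHb⟩ := hd f hf
    refine hψ' (fun x => f (π x)) (IsNC.of_mul_left (g := fun x => b (π x)) ?_ ?_ ?_)
    · exact AnalyticAt.comp (g := f) (by rw [hπ0]; exact (h f hf).1) hπ
    · exact AnalyticAt.comp (g := b) (by rwa [hπ0]) hπ
    · simpa only [hHb] using hHπ

end Tree

section Monomialisation

open Matrix

variable {K : Type*} [NontriviallyNormedField K] {n : ℕ}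

theorem analyticAt_vecCons_zero : AnalyticAt K (fun t : K => (vecCons t 0 : Fin (n + 1) → K)) 0 :=
  analyticAt_vecCons analyticAt_id analyticAt_const

theorem mono_not_eventuallyEq_zero (γ : Fin n → ℕ) : ¬ (mono γ : (Fin n → K) → K) =ᶠ[𝓝 0] 0 := by
  intro h
  obtain ⟨x, hx, -, hne⟩ := exists_mono_mul_ne_zero (K := K) (α := γ) (u := fun _ => 1)
    continuousAt_const one_ne_zero ∅ (by simp) h
  exact hne (by simpa using hx)

theorem hasForm_vecCons_zero_iff {f : (Fin (n + 1) → K) → K} {γ : Fin n → ℕ} :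
    HasForm f (vecCons 0 γ) ↔ ∃ u : (Fin (n + 1) → K) → K, AnalyticAt K u 0 ∧ u 0 ≠ 0 ∧
      ∀ᶠ x in 𝓝 0, f x = mono γ (vecTail x) * u x := by
  simp [HasForm, mono_vecCons]

theorem HasForm.comp_update_zero {f : (Fin (n + 1) → K) → K} {γ : Fin n → ℕ}
    (hf : HasForm f (vecCons 0 γ)) {ψ : (Fin (n + 1) → K) → K} (hψ : AnalyticAt K ψ 0)
    (hψ0 : ψ 0 = 0) : HasForm (fun x => f (Function.update x 0 (ψ x))) (vecCons 0 γ) :=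
  hf.comp (c := fun x => Function.update x 0 (ψ x)) (analyticAt_update analyticAt_id hψ 0)
    (by simp [hψ0]) ((hasForm_mono _).congr (by simp [mono_vecCons, vecTail_update_zero]))

theorem HasForm.mul_coord_pow {f : (Fin (n + 1) → K) → K} {γ : Fin n → ℕ}
    (hf : HasForm f (vecCons 0 γ)) (j : Fin n) (k : ℕ) :
    HasForm (fun x => f x * x j.succ ^ k) (vecCons 0 (γ + Pi.single j k)) := by
  obtain ⟨u, hu, hu0, hfu⟩ := hasForm_vecCons_zero_iff.1 hf
  refine hasForm_vecCons_zero_iff.2 ⟨u, hu, hu0, ?_⟩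
  filter_upwards [hfu] with x hx
  rw [hx, mono_add, mono_single]
  simp only [vecTail, Function.comp_apply]
  ring

/-- Translating a polynomial of degree `m + 1` without term of degree `m`. -/
theorem exists_translate_coeff (u : K) (d : ℕ → K) (m : ℕ) (hd : d m = 0) (c : K) :
    ∃ e : ℕ → K, e m = (m + 1) * c * u ∧ ∀ t,
      ∑ i ∈ Finset.range (m + 1), d i * (t + c) ^ i + (t + c) ^ (m + 1) * u =
        ∑ i ∈ Finset.range (m + 1), e i * t ^ i + t ^ (m + 1) * u := by
  classical
  set q : Polynomial K := ∑ i ∈ Finset.range (m + 1),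
    Polynomial.C (d i) * (Polynomial.X + Polynomial.C c) ^ i +
      Polynomial.C u * (Polynomial.X + Polynomial.C c) ^ (m + 1) with hq
  have hdeg : q.natDegree < m + 2 := by
    rw [Nat.lt_succ_iff, hq]
    refine Polynomial.natDegree_add_le_of_degree_le
      (Polynomial.natDegree_sum_le_of_forall_le _ _ fun i hi => ?_) ?_
    · refine (Polynomial.natDegree_C_mul_le _ _).trans ?_
      rw [Polynomial.natDegree_pow, Polynomial.natDegree_X_add_C]
      have := Finset.mem_range.1 hi
      omega
    · refine (Polynomial.natDegree_C_mul_le _ _).trans ?_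
      rw [Polynomial.natDegree_pow, Polynomial.natDegree_X_add_C, mul_one]
  have hcoeff : ∀ k, q.coeff k = ∑ i ∈ Finset.range (m + 1), d i * (c ^ (i - k) * (i.choose k)) +
      u * (c ^ (m + 1 - k) * ((m + 1).choose k)) := fun k => by
    simp only [hq, Polynomial.coeff_add, Polynomial.finsetSum_coeff, Polynomial.coeff_C_mul,
      Polynomial.coeff_X_add_C_pow]
  refine ⟨q.coeff, ?_, fun t => ?_⟩
  · rw [hcoeff, Finset.sum_eq_zero fun i hi => ?_]
    · simp [Nat.choose_succ_self_right]; ring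
    · have := Finset.mem_range.1 hi
      rcases Nat.lt_or_ge i m with h | h
      · simp [Nat.choose_eq_zero_of_lt h]
      · rw [show i = m by omega, hd, zero_mul]
  · have h1 : q.eval t = ∑ i ∈ Finset.range (m + 1), d i * (t + c) ^ i + (t + c) ^ (m + 1) * u := by
      simp [hq, Polynomial.eval_finsetSum, mul_comm u]
    rw [← h1, Polynomial.eval_eq_sum_range' hdeg, Finset.sum_range_succ]
    have h2 : q.coeff (m + 1) = u := by
      rw [hcoeff, Finset.sum_eq_zero fun i hi => ?_]
      · simp
      · simp [Nat.choose_eq_zero_of_lt (Finset.mem_range.1 hi)]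
    rw [h2, mul_comm u]

/-- A function whose restriction to the first axis does not vanish is regular. -/
theorem exists_isReg {G : (Fin (n + 1) → K) → K} (hG : AnalyticAt K G 0)
    (h : ¬ ∀ᶠ t in 𝓝 (0 : K), G (vecCons t 0) = 0) : ∃ m, IsReg m G := by
  have h1 : AnalyticAt K (fun t : K => G (vecCons t 0)) 0 :=
    AnalyticAt.comp (g := G) (by simpa using hG) analyticAt_vecCons_zero
  obtain ⟨m, w, hw, hw0, hGw⟩ := h1.exists_eventuallyEq_pow_smul_nonzero_iff.2 h
  exact ⟨m, w, hw, hw0, by simpa using hGw⟩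

theorem AnalyticAt.comp_vecTail' {f : (Fin n → K) → K} (hf : AnalyticAt K f 0) :
    AnalyticAt K (fun x : Fin (n + 1) → K => f (vecTail x)) 0 :=
  AnalyticAt.comp (g := f) hf (analyticAt_vecTail 0)

/-- A function having a nonzero Taylor coefficient of order less than `m` along the first axis is
regular of order less than `m`. -/
theorem exists_isReg_lt {G : (Fin (n + 1) → K) → K} (hG : AnalyticAt K G 0) {m : ℕ} {d : ℕ → K}
    {V : K → K} (hV : ContinuousAt V 0)
    (h : ∀ᶠ t in 𝓝 (0 : K), G (vecCons t 0) = ∑ i ∈ Finset.range m, d i * t ^ i + t ^ m * V t)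
    (hd : ∃ i < m, d i ≠ 0) : ∃ m' < m, IsReg m' G := by
  obtain ⟨i, him, hdi⟩ := hd
  obtain ⟨m', hm'⟩ := exists_isReg hG fun h0 => by
    refine hdi ((taylor_unique m hV (W := fun _ => 0) continuousAt_const ?_).1 i him)
    filter_upwards [nhdsWithin_le_nhds h, nhdsWithin_le_nhds h0] with t h1 h2
    rw [← h1, h2, mul_zero]
  refine ⟨m', ?_, hm'⟩
  by_contra! hle
  obtain ⟨w, hw, hw0, hGw⟩ := hm'
  refine hdi ((taylor_unique m hV (W := fun t => t ^ (m' - m) * w t) ?_ ?_).1 i him)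
  · have := hw.continuousAt
    fun_prop
  · filter_upwards [nhdsWithin_le_nhds h, nhdsWithin_le_nhds hGw] with t h1 h2
    rw [← h1, h2, ← mul_assoc, ← pow_add, Nat.add_sub_cancel' hle]

variable [CompleteSpace K]

/-- Germs on `K ^ (n + 1)` which are regular of order `m` in the first variable, times germs in the
remaining variables, are resolvable. -/
def RegResolvable (K : Type*) [NontriviallyNormedField K] (n m : ℕ) : Prop :=
  ∀ (g : (Fin (n + 1) → K) → K) (h : (Fin n → K) → K), AnalyticAt K g 0 → IsReg m g →
    AnalyticAt K h 0 → ¬ h =ᶠ[𝓝 0] 0 → Resolvable fun x => g x * h (vecTail x)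

theorem tree_of_regResolvable {Y : Type*} {F : Y → K} {Φ : (Fin (n + 1) → K) → Y}
    {J g N : (Fin (n + 1) → K) → K} {m : ℕ} (hm : RegResolvable K n m) (hg : AnalyticAt K g 0)
    (hreg : IsReg m g) {γ δ : Fin n → ℕ} (hN : HasForm N (vecCons 0 γ))
    (hF : ∀ᶠ x in 𝓝 0, F (Φ x) = g x * N x) (hJ : HasForm J (vecCons 0 δ)) :
    Tree (IsLeaf F) Φ J := by
  have := (hm g (mono (γ + δ)) hg hreg (analyticAt_mono _ _)
    (mono_not_eventuallyEq_zero _)).transport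
    (Q := IsLeaf F) Φ J ?_
  · simpa using this
  rintro π Jπ ⟨⟨hπF, hJπ⟩, hπ, hπ0⟩
  have hlim : Tendsto π (𝓝 0) (𝓝 0) := by simpa [ContinuousAt, hπ0] using hπ.continuousAt
  have hcomp : ∀ f : (Fin (n + 1) → K) → K, AnalyticAt K f 0 → AnalyticAt K (fun x => f (π x)) 0 :=
    fun f hf => AnalyticAt.comp (g := f) (by rwa [hπ0]) hπ
  have htail : ∀ γ : Fin n → ℕ, AnalyticAt K (fun x => mono γ (vecTail (π x))) 0 := fun γ =>
    hcomp (fun x => mono γ (vecTail x))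
      (AnalyticAt.comp (g := mono γ) (analyticAt_mono _ _) (analyticAt_vecTail 0))
  have hgπ : IsNC fun x => g (π x) := .of_mul_left (hcomp g hg) (htail (γ + δ)) hπF
  have hmono : IsNC fun x => mono (γ + δ) (vecTail (π x)) :=
    .of_mul_left (g := fun x => g (π x)) (htail (γ + δ)) (hcomp g hg)
      (hπF.congr (.of_forall fun x => mul_comm _ _))
  have hγ : IsNC fun x => mono γ (vecTail (π x)) :=
    .of_mul_left (htail γ) (htail δ) (hmono.congr (.of_forall fun x => (mono_add _ _ _).symm))
  have hδ : IsNC fun x => mono δ (vecTail (π x)) :=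
    .of_mul_left (htail δ) (htail γ)
      (hmono.congr (.of_forall fun x => by simp only [mono_add, mul_comm]))
  have key : ∀ {f : (Fin (n + 1) → K) → K} {γ : Fin n → ℕ}, HasForm f (vecCons 0 γ) →
      (IsNC fun x => mono γ (vecTail (π x))) → IsNC fun x => f (π x) := by
    intro f γ hf hγ
    obtain ⟨u, hu, hu0, hfu⟩ := hasForm_vecCons_zero_iff.1 hf
    refine (hγ.mul (isNC_unit (hcomp u hu) (by rwa [hπ0]))).congr ?_
    filter_upwards [hlim.eventually hfu] with x hx using hx
  refine .leaf ⟨(hgπ.mul (key hN hγ)).congr ?_, (key hJ hδ).mul hJπ⟩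
  filter_upwards [hlim.eventually hF] with x hx using hx

/-- Resolution of a polynomial-like germ whose coefficients have been monomialised. -/
theorem tree_of_prepared [CharZero K] {Y : Type*} {F : Y → K} {m : ℕ}
    (hC : ∀ m' < m + 1, RegResolvable K n m') {c : ℕ → (Fin n → K) → K}
    (hc : ∀ i, AnalyticAt K (c i) 0) (hcm : ∀ᶠ y in 𝓝 0, c m y = 0)
    (hc0 : ∃ i < m + 1, c i 0 ≠ 0) (k : ℕ) :
    ∀ {β γ δ : Fin n → ℕ} {U N J : (Fin (n + 1) → K) → K} {Φ : (Fin (n + 1) → K) → Y},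
      ∑ i, β i = k → AnalyticAt K U 0 → U 0 ≠ 0 → HasForm N (vecCons 0 γ) →
      HasForm J (vecCons 0 δ) →
      (∀ᶠ x in 𝓝 0, F (Φ x) = (∑ i ∈ Finset.range (m + 1), mono ((m + 1 - i) • β) (vecTail x) *
        c i (vecTail x) * x 0 ^ i + x 0 ^ (m + 1) * U x) * N x) →
      Tree (IsLeaf F) Φ J := by
  induction k with
  | zero =>
    intro β γ δ U N J Φ hβ hU hU0 hN hJ hF
    have hβ0 : β = 0 := by
      ext i; simpa using (Finset.sum_eq_zero_iff.1 hβ) i (Finset.mem_univ i)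
    subst hβ0
    simp only [smul_zero, mono_zero, one_mul] at hF
    have hg : AnalyticAt K (fun x : Fin (n + 1) → K =>
        ∑ i ∈ Finset.range (m + 1), c i (vecTail x) * x 0 ^ i + x 0 ^ (m + 1) * U x) 0 :=
      (Finset.analyticAt_fun_sum _ fun i _ => (AnalyticAt.comp_vecTail' (hc i)).mul
        ((analyticAt_coord 0 0).pow i)).add (((analyticAt_coord 0 0).pow _).mul hU)
    have hUt : ContinuousAt (fun t : K => U (vecCons t 0)) 0 :=
      (AnalyticAt.comp (g := U) (by simpa using hU) analyticAt_vecCons_zero).continuousAt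
    obtain ⟨m', hm', hreg⟩ := exists_isReg_lt hg (m := m + 1) (d := fun i => c i 0) hUt
      (.of_forall fun t => by simp) hc0
    exact tree_of_regResolvable (hC m' hm') hg hreg hN hF hJ
  | succ k ih =>
    intro β γ δ U N J Φ hβ hU hU0 hN hJ hF
    obtain ⟨j, hj⟩ : ∃ j, 0 < β j := by
      by_contra! h'
      have : ∑ i, β i = 0 := Finset.sum_eq_zero fun i _ => by simpa using h' i
      omega
    obtain ⟨β', rfl⟩ : ∃ β' : Fin n → ℕ, β = β' + Pi.single j 1 := by
      refine ⟨β - Pi.single j 1, ?_⟩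
      ext i
      by_cases hi : i = j
      · subst hi; simp; omega
      · simp [hi]
    have hβ' : ∑ i, β' i = k := by
      simp only [Pi.add_apply, Finset.sum_add_distrib, Finset.sum_pi_single', Finset.mem_univ,
        if_true] at hβ
      omega
    have hmono : ∀ (i : ℕ) (y : Fin n → K), mono ((m + 1 - i) • (β' + Pi.single j 1)) y =
        mono ((m + 1 - i) • β') y * y j ^ (m + 1 - i) := fun i y => by
      rw [smul_add, mono_add, mono_smul _ (Pi.single j 1), mono_single, pow_one]
    refine .blowup j.succ 0 (Fin.succ_ne_zero j) (fun l => ?_) ?_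
    · set ψ : (Fin (n + 1) → K) → K := fun x => x j.succ * (x 0 + l) with hψ
      have hψan : AnalyticAt K ψ 0 :=
        (analyticAt_coord _ 0).mul ((analyticAt_coord _ 0).add analyticAt_const)
      have hψ0 : ψ 0 = 0 := by simp [hψ]
      have hupd : AnalyticAt K (fun x : Fin (n + 1) → K => Function.update x 0 (ψ x)) 0 :=
        analyticAt_update analyticAt_id hψan 0
      have hupd0 : Function.update (0 : Fin (n + 1) → K) 0 (ψ 0) = 0 := by simp [hψ0]
      have hlim : Tendsto (fun x : Fin (n + 1) → K => Function.update x 0 (ψ x)) (𝓝 0) (𝓝 0) := by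
        simpa only [ContinuousAt, hupd0] using hupd.continuousAt
      have hU' : AnalyticAt K (fun x => U (Function.update x 0 (ψ x))) 0 :=
        AnalyticAt.comp (g := U) (by rwa [hupd0]) hupd
      have hN' := (hN.comp_update_zero hψan hψ0).mul_coord_pow j (m + 1)
      have hJ' := (hJ.comp_update_zero hψan hψ0).mul_coord_pow j 1
      simp only [pow_one] at hJ'
      have hF' : ∀ᶠ x in 𝓝 0, F (Φ (Function.update x 0 (ψ x))) =
          (∑ i ∈ Finset.range (m + 1), mono ((m + 1 - i) • β') (vecTail x) * c i (vecTail x) *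
            (x 0 + l) ^ i + (x 0 + l) ^ (m + 1) * U (Function.update x 0 (ψ x))) *
            (N (Function.update x 0 (ψ x)) * x j.succ ^ (m + 1)) := by
        filter_upwards [hlim.eventually hF] with x hx
        rw [hx]
        simp only [vecTail_update_zero, Function.update_self, hmono]
        have : ∀ i ∈ Finset.range (m + 1), mono ((m + 1 - i) • β') (vecTail x) *
            vecTail x j ^ (m + 1 - i) * c i (vecTail x) * ψ x ^ i =
            (mono ((m + 1 - i) • β') (vecTail x) * c i (vecTail x) * (x 0 + l) ^ i) *
              x j.succ ^ (m + 1) := fun i hi => by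
          have hi := Finset.mem_range.1 hi
          have h1 : x j.succ ^ (m + 1) = x j.succ ^ (m + 1 - i) * x j.succ ^ i := by
            rw [← pow_add, Nat.sub_add_cancel hi.le]
          have h2 : ψ x ^ i = x j.succ ^ i * (x 0 + l) ^ i := mul_pow _ _ _
          have h3 : vecTail x j = x j.succ := rfl
          rw [h1, h2, h3]
          ring
        have hψx : ψ x ^ (m + 1) = x j.succ ^ (m + 1) * (x 0 + l) ^ (m + 1) := mul_pow _ _ _
        rw [Finset.sum_congr rfl this, ← Finset.sum_mul, hψx]
        ring
      by_cases hl : l = 0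
      · subst hl
        simp only [add_zero] at hF'
        exact ih hβ' hU' (by simpa only [hupd0] using hU0) hN' hJ' hF'
      · have hg : AnalyticAt K (fun x : Fin (n + 1) → K =>
            ∑ i ∈ Finset.range (m + 1), mono ((m + 1 - i) • β') (vecTail x) * c i (vecTail x) *
            (x 0 + l) ^ i + (x 0 + l) ^ (m + 1) * U (Function.update x 0 (ψ x))) 0 :=
          (Finset.analyticAt_fun_sum _ fun i _ => ((AnalyticAt.comp_vecTail'
            (analyticAt_mono _ _)).mul (AnalyticAt.comp_vecTail' (hc i))).mul
            (((analyticAt_coord 0 0).add analyticAt_const).pow i)).add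
            ((((analyticAt_coord 0 0).add analyticAt_const).pow _).mul hU')
        obtain ⟨e, he, het⟩ := exists_translate_coeff (U 0)
          (fun i => mono ((m + 1 - i) • β') (0 : Fin n → K) * c i 0) m
          (by rw [hcm.self_of_nhds, mul_zero]) l
        obtain ⟨m', hm', hreg⟩ := exists_isReg_lt hg (m := m + 1) (d := e) (V := fun _ => U 0)
          continuousAt_const (.of_forall fun t => by
            have h1 : Function.update (vecCons t (0 : Fin n → K)) 0 (ψ (vecCons t 0)) = 0 := by
              have : ψ (vecCons t 0) = 0 := by simp [hψ]
              rw [this]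
              ext i
              refine Fin.cases ?_ (fun i => ?_) i <;> simp
            rw [← het]
            simp only [h1, cons_val_zero, tail_cons])
          ⟨m, by omega, by
            rw [he]
            exact mul_ne_zero (mul_ne_zero (by exact_mod_cast m.succ_ne_zero) hl) hU0⟩
        exact tree_of_regResolvable (hC m' hm') hg hreg hN' hF' hJ'
    · set χ : (Fin (n + 1) → K) → Fin (n + 1) → K :=
        fun x => Function.update x j.succ (x j.succ * x 0) with hχ
      have hχan : AnalyticAt K χ 0 := analyticAt_update analyticAt_id
        ((analyticAt_coord _ 0).mul (analyticAt_coord _ 0)) _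
      have hχ0 : χ 0 = 0 := by simp [hχ]
      have hlim : Tendsto χ (𝓝 0) (𝓝 0) := by
        simpa only [ContinuousAt, hχ0] using hχan.continuousAt
      have hpull : ∀ {f : (Fin (n + 1) → K) → K} {α : Fin (n + 1) → ℕ}, HasForm f α →
          IsNC fun x => f (χ x) := fun hf =>
        ⟨_, hf.comp hχan hχ0 ((hasForm_mono _).congr (.of_forall fun x => mono_update_mul _ _ _ _))⟩
      have hχt : AnalyticAt K (fun x => vecTail (χ x)) 0 :=
        AnalyticAt.comp (g := fun y : Fin (n + 1) → K => vecTail y) (analyticAt_vecTail _) hχan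
      have hχt0 : vecTail (χ 0) = 0 := by rw [hχ0]; rfl
      set V : (Fin (n + 1) → K) → K := fun x => ∑ i ∈ Finset.range (m + 1),
        mono ((m + 1 - i) • β') (vecTail (χ x)) * vecTail x j ^ (m + 1 - i) *
          c i (vecTail (χ x)) + U (χ x) with hV
      have hVan : AnalyticAt K V 0 := by
        refine (Finset.analyticAt_fun_sum _ fun i _ => ((AnalyticAt.comp (g := mono _)
          (analyticAt_mono _ _) hχt).mul ((analyticAt_coord j.succ 0).pow _)).mul
          (AnalyticAt.comp (g := c i) (by rw [hχt0]; exact hc i) hχt)).add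
          (AnalyticAt.comp (g := U) (by rwa [hχ0]) hχan)
      have hV0 : V 0 ≠ 0 := by
        have : V 0 = U 0 := by
          simp only [hV, hχ0]
          rw [Finset.sum_eq_zero fun i hi => ?_, zero_add]
          have hi := Finset.mem_range.1 hi
          have : (0 : K) ^ (m + 1 - i) = 0 := zero_pow (by omega)
          simp [vecTail, this]
        rwa [this]
      refine .leaf ⟨?_, (hpull hJ).mul (isNC_coord 0)⟩
      refine ((((isNC_coord 0).pow (m + 1)).mul (isNC_unit hVan hV0)).mul (hpull hN)).congr ?_
      filter_upwards [hlim.eventually hF] with x hx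
      change F (Φ (χ x)) = _
      have hx0 : χ x 0 = x 0 := Function.update_of_ne (Fin.succ_ne_zero j).symm _ _
      have hxj : vecTail (χ x) j = vecTail x j * x 0 := by
        simp [hχ, vecTail]
      rw [hx, hx0, hV]
      congr 1
      simp only [mul_add, Finset.mul_sum]
      congr 1
      refine Finset.sum_congr rfl fun i hi => ?_
      have hi := Finset.mem_range.1 hi
      rw [hmono, hxj, mul_pow]
      conv_rhs => rw [← Nat.sub_add_cancel hi.le, pow_add (x 0), Nat.add_sub_cancel]
      ring

end Monomialisation

section Main

open Matrix

variable {K : Type*} [NontriviallyNormedField K] {n : ℕ}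

theorem regResolvable_zero
    (hmain : ∀ f : (Fin n → K) → K, AnalyticAt K f 0 → ¬ f =ᶠ[𝓝 0] 0 → Resolvable f) :
    RegResolvable K n 0 := by
  intro g h hg ⟨w, hw, hw0, hgw⟩ hh hh0
  have hg0 : g 0 ≠ 0 := by
    have := hgw.self_of_nhds
    simp only [cons_zero_zero, pow_zero, one_mul] at this
    rwa [this]
  refine .mk' ?_
  have := (hmain h hh hh0).lift (Q := IsLeaf fun x => g x * h (vecTail x))
    (fun t y => vecCons t y) ?_
  · have h1 : (fun x : Fin (n + 1) → K => vecCons (x 0) (vecTail x)) = fun x => x := by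
      funext x; exact Matrix.cons_head_tail x
    simpa only [h1] using this
  rintro π J ⟨⟨⟨α, hα⟩, ⟨β, hβ⟩⟩, hπ, hπ0⟩
  refine .leaf ⟨IsNC.mul (isNC_unit (AnalyticAt.comp (g := g) (by simpa [vecTail, hπ0] using hg) ?_)
    ?_) ?_, _, hβ.comp_vecTail⟩
  · exact analyticAt_vecCons (analyticAt_coord 0 0)
      (AnalyticAt.comp (g := π) hπ (analyticAt_vecTail 0))
  · have : vecTail (0 : Fin (n + 1) → K) = 0 := rfl
    simpa [this, hπ0] using hg0
  · exact ⟨_, hα.comp_vecTail.congr (by simp)⟩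

/-- Linear shears in the direction of the first axis. -/
theorem tree_shear {F : (Fin (n + 1) → K) → K} (y : Fin n → K)
    (h : Resolvable fun x => F (vecCons (x 0) (vecTail x + x 0 • y))) : Resolvable F := by
  classical
  have key : ∀ S : Finset (Fin n), Tree (IsLeaf F)
      (fun x => vecCons (x 0) (vecTail x + x 0 • fun j => if j ∈ S then 0 else y j))
        (fun _ => 1) := by
    intro S
    induction S using Finset.induction_on with
    | empty =>
      have := h.transport (Q := IsLeaf F) (fun x => vecCons (x 0) (vecTail x + x 0 • y))
        (fun _ => 1) fun π J hπ => .leaf ⟨hπ.1.1, by simpa using hπ.1.2⟩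
      simpa using this
    | insert j S hj ih =>
      refine .shear j.succ (fun x => x 0 * y j) ((analyticAt_coord 0 0).mul analyticAt_const)
        (by simp) (by fun_prop) (fun x t => ?_) ?_
      · rw [Function.update_of_ne (Fin.succ_ne_zero j).symm]
      · have h0 : ∀ (x : Fin (n + 1) → K) t, Function.update x j.succ t 0 = x 0 := fun x t =>
          Function.update_of_ne (Fin.succ_ne_zero j).symm _ _
        convert ih using 3 with x
        · exact h0 x _
        · rw [vecTail_update_succ, h0]
          ext k
          by_cases hk : k = j
          · subst hk; simp [hj, vecTail]
          · simp [hk]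
  refine .mk' ?_
  convert key Finset.univ using 2 with x
  refine (Matrix.cons_head_tail x).symm.trans ?_
  congr 1
  ext k
  simp

variable [CompleteSpace K] [IsUltrametricDist K]

/-- Every analytic germ over an ultrametric field has a globally continuous representative. -/
theorem exists_continuous_eventuallyEq {φ : (Fin n → K) → K} (hφ : AnalyticAt K φ 0) :
    ∃ ψ : (Fin n → K) → K, Continuous ψ ∧ ψ =ᶠ[𝓝 0] φ := by
  obtain ⟨r, hr, hball⟩ := Metric.eventually_nhds_iff_ball.1 hφ.eventually_analyticAt
  have hclopen : IsClopen (Metric.ball (0 : Fin n → K) r) := IsUltrametricDist.isClopen_ball 0 r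
  refine ⟨(Metric.ball 0 r).indicator φ, ?_, ?_⟩
  · refine continuous_indicator (by simp [hclopen.frontier_eq]) ?_
    rw [hclopen.isClosed.closure_eq]
    exact fun x hx => (hball x hx).continuousAt.continuousWithinAt
  · filter_upwards [Metric.ball_mem_nhds 0 hr] with x hx
    exact Set.indicator_of_mem hx φ

variable [CharZero K]

theorem regResolvable_succ
    (hmain : ∀ f : (Fin n → K) → K, AnalyticAt K f 0 → ¬ f =ᶠ[𝓝 0] 0 → Resolvable f) {m : ℕ}
    (hC : ∀ m' < m + 1, RegResolvable K n m') : RegResolvable K n (m + 1) := by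
  classical
  intro g h hg hreg hh hh0
  obtain ⟨φ, a, U, hφ, hφ0, ha, hU, hU0, ham, hgφ⟩ := exists_maximal_contact hg hreg
  obtain ⟨ψ, hψc, hψφ⟩ := exists_continuous_eventuallyEq hφ
  set N : ℕ := (m + 1).factorial with hN
  have hNpos : 0 < N := Nat.factorial_pos _
  set e : ℕ → ℕ := fun i => N / (m + 1 - i) with he
  have hei : ∀ i < m + 1, (m + 1 - i) * e i = N := fun i hi =>
    Nat.mul_div_cancel' (Nat.dvd_factorial (by omega) (by omega))
  set T : Set ((Fin n → K) → K) := {h} ∪ (a '' Set.Iio (m + 1)) ∪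
    (fun q : ℕ × ℕ => fun y => a q.1 y ^ e q.1 - a q.2 y ^ e q.2) ''
      (Set.Iio (m + 1) ×ˢ Set.Iio (m + 1)) with hT
  have hTfin : T.Finite := ((Set.finite_singleton h).union ((Set.finite_Iio _).image _)).union
    (((Set.finite_Iio _).prod (Set.finite_Iio _)).image _)
  have hTan : ∀ f ∈ T, AnalyticAt K f 0 := by
    rintro f ((rfl | ⟨i, -, rfl⟩) | ⟨q, -, rfl⟩)
    · exact hh
    · exact ha i
    · exact ((ha _).pow _).sub ((ha _).pow _)
  set S := {f ∈ T | ¬ f =ᶠ[𝓝 0] 0} with hS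
  refine .mk' (.shear 0 (fun x => ψ (vecTail x))
    (AnalyticAt.comp_vecTail' (hφ.congr hψφ.symm)) (by
      have : vecTail (0 : Fin (n + 1) → K) = 0 := rfl
      simp only [this, hψφ.self_of_nhds, hφ0])
    (hψc.comp (continuous_pi fun j => continuous_apply j.succ))
    (fun x t => by rw [vecTail_update_zero]) ?_)
  set F : (Fin (n + 1) → K) → K := fun x => g x * h (vecTail x) with hFdef
  have htree := (tree_finite hmain hNpos (hTfin.subset (Set.sep_subset T _))
    (S := S) fun f hf => ⟨hTan f hf.1, hf.2⟩).lift (Q := IsLeaf F)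
    (fun t y => vecCons (t + ψ y) y) ?_
  · have h1 : (fun x : Fin (n + 1) → K => Function.update x 0 (x 0 + ψ (vecTail x))) =
        fun x => vecCons (x 0 + ψ (vecTail x)) (vecTail x) := by
      funext x
      ext i
      refine Fin.cases ?_ (fun i => ?_) i <;> simp [vecTail]
    rw [h1]
    exact htree
  rintro π J ⟨⟨⟨δ, hJ⟩, hform⟩, hπ, hπ0⟩
  have hπlim : Tendsto π (𝓝 0) (𝓝 0) := by simpa only [ContinuousAt, hπ0] using hπ.continuousAt
  have htail : Tendsto (fun x : Fin (n + 1) → K => vecTail x) (𝓝 0) (𝓝 0) :=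
    (analyticAt_vecTail (K := K) (0 : Fin (n + 1) → K)).continuousAt
  have hz : AnalyticAt K (fun x : Fin (n + 1) → K => (vecCons (x 0) (π (vecTail x)) :
      Fin (n + 1) → K)) 0 :=
    analyticAt_vecCons (analyticAt_coord 0 0) (AnalyticAt.comp (g := π) hπ (analyticAt_vecTail 0))
  have hz0 : (vecCons ((0 : Fin (n + 1) → K) 0) (π (vecTail (0 : Fin (n + 1) → K))) :
      Fin (n + 1) → K) = 0 := by
    have : vecTail (0 : Fin (n + 1) → K) = 0 := rfl
    simp [this, hπ0]
  have hzlim : Tendsto (fun x : Fin (n + 1) → K => (vecCons (x 0) (π (vecTail x)) :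
      Fin (n + 1) → K)) (𝓝 0) (𝓝 0) := by
    simpa only [ContinuousAt, hz0] using hz.continuousAt
  have hUz : AnalyticAt K (fun x : Fin (n + 1) → K => U (vecCons (x 0) (π (vecTail x)))) 0 :=
    AnalyticAt.comp (g := U) (by rwa [hz0]) hz
  have hUz0 : U (vecCons ((0 : Fin (n + 1) → K) 0) (π (vecTail (0 : Fin (n + 1) → K)))) ≠ 0 := by
    rwa [hz0]
  have hF : ∀ᶠ x : Fin (n + 1) → K in 𝓝 0, F (vecCons (x 0 + ψ (π (vecTail x))) (π (vecTail x))) =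
      (∑ i ∈ Finset.range (m + 1), a i (π (vecTail x)) * x 0 ^ i +
        x 0 ^ (m + 1) * U (vecCons (x 0) (π (vecTail x)))) * h (π (vecTail x)) := by
    filter_upwards [hzlim.eventually hgφ, (hπlim.comp htail).eventually hψφ] with x h1 h2
    simp only [Function.comp_apply, cons_val_zero, tail_cons] at h1 h2
    simp only [hFdef, tail_cons, h2, h1]
  obtain ⟨γ, hγ⟩ := hform h ⟨.inl (.inl rfl), hh0⟩
  by_cases hall : ∀ i < m + 1, a i =ᶠ[𝓝 0] 0
  · refine .leaf ⟨((((isNC_coord 0).pow (m + 1)).mul (isNC_unit hUz hUz0)).mul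
      ⟨_, hγ.comp_vecTail⟩).congr ?_, _, hJ.comp_vecTail⟩
    have : ∀ᶠ x : Fin (n + 1) → K in 𝓝 0, ∀ i ∈ Finset.range (m + 1), a i (π (vecTail x)) = 0 :=
      (Filter.eventually_all_finset _).2 fun i hi =>
        (hπlim.comp htail).eventually (hall i (Finset.mem_range.1 hi))
    filter_upwards [hF, this] with x h1 h2
    rw [h1, Finset.sum_eq_zero fun i hi => by rw [h2 i hi, zero_mul], zero_add]
  set I : Finset ℕ := (Finset.range (m + 1)).filter fun i => ¬ a i =ᶠ[𝓝 0] 0 with hI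
  have hIlt : ∀ i ∈ I, i < m + 1 := fun i hi => Finset.mem_range.1 (Finset.mem_filter.1 hi).1
  have hIne : I.Nonempty := by
    push Not at hall
    obtain ⟨i, hi, hai⟩ := hall
    exact ⟨i, Finset.mem_filter.2 ⟨Finset.mem_range.2 hi, hai⟩⟩
  have hIform : ∀ i ∈ I, ∃ α, HasForm (fun x => a i (π x)) (N • α) := fun i hi =>
    hform _ ⟨.inl (.inr ⟨i, hIlt i hi, rfl⟩), (Finset.mem_filter.1 hi).2⟩
  choose! α hα using hIform
  set β : ℕ → Fin n → ℕ := fun i => e i • α i with hβ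
  have hNα : ∀ i ∈ I, N • α i = (m + 1 - i) • β i := fun i hi => by
    rw [hβ, smul_smul, hei i (hIlt i hi)]
  have hpow : ∀ i ∈ I, HasForm (fun x => a i (π x) ^ e i) (N • β i) := fun i hi => by
    have := (hα i hi).pow (e i)
    rwa [smul_comm] at this
  have hcomp : ∀ i ∈ I, ∀ k ∈ I, β i ≤ β k ∨ β k ≤ β i := by
    intro i hi k hk
    have hcancel : ∀ {b c : Fin n → ℕ}, N • b ≤ N • c → b ≤ c := fun h' l =>
      Nat.le_of_mul_le_mul_left (by simpa using h' l) hNpos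
    refine ((hpow i hi).le_or_le (hpow k hk) ?_).imp hcancel hcancel
    by_cases h0 : (fun y => a i y ^ e i - a k y ^ e k) =ᶠ[𝓝 0] 0
    · exact .inl (hπlim.eventually h0)
    · obtain ⟨η, hη⟩ := hform _ ⟨.inr ⟨(i, k), ⟨hIlt i hi, hIlt k hk⟩, rfl⟩, h0⟩
      exact .inr ⟨_, hη⟩
  obtain ⟨i₀, hi₀⟩ := I.exists_minimalFor β hIne
  have hmin : ∀ i ∈ I, β i₀ ≤ β i := fun i hi => (hcomp i₀ hi₀.1 i hi).elim id (hi₀.2 hi)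
  choose! u hu hu0 hau using hα
  set c : ℕ → (Fin n → K) → K := fun i =>
    if i ∈ I then fun y => mono ((m + 1 - i) • (β i - β i₀)) y * u i y else fun _ => 0 with hc
  have hcan : ∀ i, AnalyticAt K (c i) 0 := by
    intro i
    by_cases hi : i ∈ I
    · simp only [hc, if_pos hi]
      exact (analyticAt_mono _ _).mul (hu i hi)
    · simpa only [hc, if_neg hi] using analyticAt_const
  have hac : ∀ i < m + 1, ∀ᶠ y in 𝓝 0, a i (π y) = mono ((m + 1 - i) • β i₀) y * c i y := by
    intro i hi
    by_cases hi' : i ∈ I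
    · filter_upwards [hau i hi'] with y hy
      rw [hy, hNα i hi']
      simp only [hc, if_pos hi']
      rw [← mul_assoc, ← mono_add, ← smul_add, add_tsub_cancel_of_le (hmin i hi')]
    · have : a i =ᶠ[𝓝 0] 0 := by
        by_contra h'
        exact hi' (Finset.mem_filter.2 ⟨Finset.mem_range.2 hi, h'⟩)
      filter_upwards [hπlim.eventually this] with y hy
      simp only [hc, if_neg hi', mul_zero]
      exact hy
  refine tree_of_prepared hC hcan ?_ ⟨i₀, hIlt _ hi₀.1, ?_⟩ _ (β := β i₀) rfl hUz hUz0
    hγ.comp_vecTail hJ.comp_vecTail ?_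
  · have : m ∉ I := fun hm => (Finset.mem_filter.1 hm).2 ham
    simp [hc, this]
  · simp only [hc, if_pos hi₀.1, tsub_self, smul_zero, mono_zero, one_mul]
    exact hu0 _ hi₀.1
  · have : ∀ᶠ x : Fin (n + 1) → K in 𝓝 0, ∀ i ∈ Finset.range (m + 1), a i (π (vecTail x)) =
        mono ((m + 1 - i) • β i₀) (vecTail x) * c i (vecTail x) :=
      (Filter.eventually_all_finset _).2 fun i hi =>
        htail.eventually (hac i (Finset.mem_range.1 hi))
    filter_upwards [hF, this] with x h1 h2
    rw [h1, Finset.sum_congr rfl fun i hi => by rw [h2 i hi]]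

theorem regResolvable
    (hmain : ∀ f : (Fin n → K) → K, AnalyticAt K f 0 → ¬ f =ᶠ[𝓝 0] 0 → Resolvable f) (m : ℕ) :
    RegResolvable K n m := by
  induction m using Nat.strong_induction_on with
  | _ m ih =>
    cases m with
    | zero => exact regResolvable_zero hmain
    | succ m => exact regResolvable_succ hmain ih

/-- Local monomialisation of analytic functions over a complete ultrametric field of
characteristic zero. -/
theorem resolvable (n : ℕ) : ∀ f : (Fin n → K) → K, AnalyticAt K f 0 → ¬ f =ᶠ[𝓝 0] 0 →
    Resolvable f := by
  induction n with
  | zero =>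
    intro f hf hf0
    refine .mk' (.leaf ⟨isNC_unit hf fun h => hf0 (.of_forall fun x => ?_), isNC_one⟩)
    rw [Subsingleton.elim x 0, h]; rfl
  | succ n ih =>
    intro f hf hf0
    obtain ⟨y, hy, hfy⟩ := exists_line_not_eventuallyEq_zero hf hf0
      (ContinuousLinearMap.proj (R := K) (φ := fun _ : Fin (n + 1) => K) 0) (fun h => by
        simpa using DFunLike.congr_fun h (fun _ => 1))
    refine tree_shear (vecTail y) ?_
    set g : (Fin (n + 1) → K) → K := fun x =>
      f (vecCons (x 0) (vecTail x + x 0 • vecTail y)) with hg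
    have hc : AnalyticAt K (fun x : Fin (n + 1) → K => (vecCons (x 0)
        (vecTail x + x 0 • vecTail y) : Fin (n + 1) → K)) 0 :=
      analyticAt_vecCons (analyticAt_coord 0 0)
        ((analyticAt_vecTail 0).add (AnalyticAt.fun_smul (analyticAt_coord 0 0) analyticAt_const))
    have hgan : AnalyticAt K g 0 := AnalyticAt.comp (g := f) (by
      have : vecTail (0 : Fin (n + 1) → K) = 0 := rfl
      simpa [this] using hf) hc
    obtain ⟨m, hm⟩ := exists_isReg hgan (fun h => hfy (by
      filter_upwards [h] with t ht
      rw [← ht, hg]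
      congr 1
      ext i
      refine Fin.cases ?_ (fun i => ?_) i
      · have hy0 : y 0 = 1 := hy
        simp [hy0]
      · simp [vecTail]))
    have := regResolvable ih m g (fun _ => 1) hgan hm analyticAt_const
      fun h => one_ne_zero h.self_of_nhds
    simpa using this

end Main

section PadicMeasure

open Matrix

variable {p : ℕ} [Fact p.Prime]

noncomputable instance measurableSpacePadic : MeasurableSpace ℚ_[p] := borel _

instance borelSpacePadic : BorelSpace ℚ_[p] := ⟨rfl⟩

/-- The Haar measure on `ℚ_[p]` giving measure one to the unit ball. -/
noncomputable instance measureSpacePadic : MeasureSpace ℚ_[p] where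
  volume := Measure.addHaarMeasure ⟨⟨Metric.closedBall 0 1, isCompact_closedBall 0 1⟩,
    ⟨0, Metric.ball_subset_interior_closedBall (Metric.mem_ball_self one_pos)⟩⟩

instance isAddHaarMeasurePadic : (volume : Measure ℚ_[p]).IsAddHaarMeasure := by
  unfold volume measureSpacePadic
  infer_instance

theorem volume_closedBall_one : volume (Metric.closedBall (0 : ℚ_[p]) 1) = 1 :=
  Measure.addHaarMeasure_self

theorem volume_closedBall_center (x : ℚ_[p]) (r : ℝ) :
    volume (Metric.closedBall x r) = volume (Metric.closedBall (0 : ℚ_[p]) r) := by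
  rw [← measure_preimage_add volume (-x) (Metric.closedBall 0 r)]
  congr 1
  ext y
  simp [dist_eq_norm, neg_add_eq_sub]

theorem closedBall_norm_eq_iUnion {a : ℚ_[p]} (ha : a ≠ 0) :
    Metric.closedBall (0 : ℚ_[p]) ‖a‖ =
      ⋃ i ∈ Finset.range p, Metric.closedBall (i * a) ‖(p : ℚ_[p]) * a‖ := by
  have ha' : 0 < ‖a‖ := norm_pos_iff.2 ha
  ext x
  simp only [Metric.mem_closedBall, dist_zero_right, Set.mem_iUnion, Finset.mem_range,
    exists_prop]
  constructor
  · intro hx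
    have h1 : ‖x / a‖ ≤ 1 := by rw [norm_div]; exact div_le_one_of_le₀ hx ha'.le
    set y : ℤ_[p] := ⟨x / a, h1⟩ with hy
    obtain ⟨n, hn, hyn⟩ := PadicInt.exists_mem_range (x := y)
    rw [PadicInt.maximalIdeal_eq_span_p, Ideal.mem_span_singleton] at hyn
    obtain ⟨z, hz⟩ := hyn
    refine ⟨n, hn, ?_⟩
    have h2 : x / a - n = p * z := by
      have := congrArg (fun w : ℤ_[p] => (w : ℚ_[p])) hz
      simpa only [PadicInt.coe_sub, PadicInt.coe_mul, PadicInt.coe_natCast] using this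
    have h3 : x - n * a = p * a * z := by
      rw [div_sub' ha, div_eq_iff ha] at h2
      linear_combination h2
    rw [dist_eq_norm, h3, norm_mul]
    exact mul_le_of_le_one_right (norm_nonneg _) z.2
  · rintro ⟨n, -, hx⟩
    have hp : ‖(p : ℚ_[p])‖ ≤ 1 := by simpa using Padic.norm_int_le_one (p := p) (p : ℤ)
    have hn : ‖(n : ℚ_[p])‖ ≤ 1 := by simpa using Padic.norm_int_le_one (p := p) (n : ℤ)
    rw [dist_eq_norm, norm_mul] at hx
    calc ‖x‖ = ‖(x - n * a) + n * a‖ := by ring_nf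
      _ ≤ max ‖x - n * a‖ ‖n * a‖ := IsUltrametricDist.norm_add_le_max _ _
      _ ≤ ‖a‖ := max_le (hx.trans (mul_le_of_le_one_left ha'.le hp)) (by
        rw [norm_mul]; exact mul_le_of_le_one_left ha'.le hn)

theorem volume_closedBall_norm_eq_mul {a : ℚ_[p]} (ha : a ≠ 0) :
    volume (Metric.closedBall (0 : ℚ_[p]) ‖a‖) =
      p * volume (Metric.closedBall (0 : ℚ_[p]) ‖(p : ℚ_[p]) * a‖) := by
  rw [closedBall_norm_eq_iUnion ha, measure_biUnion_finset _ fun i _ =>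
    Metric.isClosed_closedBall.measurableSet]
  · simp [volume_closedBall_center ((_ : ℚ_[p]) * a)]
  · intro i hi j hj hij
    refine Set.disjoint_left.2 fun x hxi hxj => hij ?_
    have ha' : 0 < ‖a‖ := norm_pos_iff.2 ha
    rw [Metric.mem_closedBall, dist_eq_norm, norm_mul, Padic.norm_p] at hxi hxj
    have h1 : ‖((i : ℤ) - (j : ℤ) : ℤ) * a‖ ≤ (p : ℝ)⁻¹ * ‖a‖ :=
      calc ‖(((i : ℤ) - (j : ℤ) : ℤ) : ℚ_[p]) * a‖ = ‖(x - j * a) - (x - i * a)‖ := by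
            push_cast; ring_nf
        _ ≤ max ‖x - j * a‖ ‖x - i * a‖ := by
          rw [← norm_neg (x - i * a), sub_eq_add_neg]
          exact IsUltrametricDist.norm_add_le_max _ _
        _ ≤ _ := max_le hxj hxi
    rw [norm_mul, mul_le_mul_iff_left₀ ha'] at h1
    have h2 : (p : ℤ) ∣ (i : ℤ) - j := Padic.norm_intCast_lt_one_iff.1
      (h1.trans_lt (inv_lt_one_of_one_lt₀ (by exact_mod_cast (Fact.out : p.Prime).one_lt)))
    have h3 := (Nat.modEq_iff_dvd.2 h2).symm
    rw [Nat.ModEq, Nat.mod_eq_of_lt (Finset.mem_range.1 hi),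
      Nat.mod_eq_of_lt (Finset.mem_range.1 hj)] at h3
    exact h3

theorem volume_closedBall_norm (x : ℚ_[p]) {a : ℚ_[p]} (ha : a ≠ 0) :
    volume (Metric.closedBall x ‖a‖) = ‖a‖ₑ := by
  rw [volume_closedBall_center]
  have hp0 : (p : ℚ_[p]) ≠ 0 := Nat.cast_ne_zero.2 (Fact.out : p.Prime).ne_zero
  have hpe0 : (p : ℝ≥0∞) ≠ 0 := Nat.cast_ne_zero.2 (Fact.out : p.Prime).ne_zero
  have hpe : ‖(p : ℚ_[p])‖ₑ = (p : ℝ≥0∞)⁻¹ := by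
    rw [← ofReal_norm, Padic.norm_p, ENNReal.ofReal_inv_of_pos (by
      exact_mod_cast (Fact.out : p.Prime).pos), ENNReal.ofReal_natCast]
  have key : ∀ k : ℤ, volume (Metric.closedBall (0 : ℚ_[p]) ‖(p : ℚ_[p]) ^ k‖) =
      ‖(p : ℚ_[p]) ^ k‖ₑ := by
    have step : ∀ k : ℤ, volume (Metric.closedBall (0 : ℚ_[p]) ‖(p : ℚ_[p]) ^ k‖) =
      ‖(p : ℚ_[p]) ^ k‖ₑ ↔ volume (Metric.closedBall (0 : ℚ_[p]) ‖(p : ℚ_[p]) ^ (k + 1)‖) =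
      ‖(p : ℚ_[p]) ^ (k + 1)‖ₑ := by
      intro k
      rw [volume_closedBall_norm_eq_mul (zpow_ne_zero k hp0), zpow_add_one₀ hp0,
        mul_comm (p : ℚ_[p]), enorm_mul _ (p : ℚ_[p]), hpe,
        ← ENNReal.eq_div_iff hpe0 (ENNReal.natCast_ne_top p), div_eq_mul_inv]
    intro k
    induction k using Int.induction_on with
    | zero => simp [volume_closedBall_one]
    | succ k ih => exact (step _).1 ih
    | pred k ih => exact (step _).2 (by simpa using ih)
  have h := Padic.norm_eq_zpow_neg_valuation ha
  have h' : ‖a‖ = ‖(p : ℚ_[p]) ^ a.valuation‖ := by rw [h]; simp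
  rw [h', key, ← ofReal_norm, ← h', ofReal_norm]

theorem map_mul_volume {a : ℚ_[p]} (ha : a ≠ 0) :
    (volume : Measure ℚ_[p]).map (a * ·) = ‖a‖ₑ⁻¹ • volume := by
  have hiso : ((volume : Measure ℚ_[p]).map (a * ·)).IsAddHaarMeasure :=
    Measure.MapLinearEquiv.isAddHaarMeasure (𝕜 := ℚ_[p]) volume
      (LinearEquiv.smulOfNeZero ℚ_[p] ℚ_[p] a ha)
  have h := Measure.isAddLeftInvariant_eq_smul ((volume : Measure ℚ_[p]).map (a * ·)) volume
  have h1 : (volume : Measure ℚ_[p]).map (a * ·) (Metric.closedBall 0 1) = ‖a‖ₑ⁻¹ := by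
    rw [Measure.map_apply (by fun_prop) Metric.isClosed_closedBall.measurableSet]
    have : (a * ·) ⁻¹' Metric.closedBall (0 : ℚ_[p]) 1 = Metric.closedBall 0 ‖a⁻¹‖ := by
      ext y
      have ha' : 0 < ‖a‖ := norm_pos_iff.2 ha
      simp only [Set.mem_preimage, mem_closedBall_zero_iff, norm_mul, norm_inv]
      rw [inv_eq_one_div, le_div_iff₀' ha']
    rw [this, volume_closedBall_norm _ (inv_ne_zero ha), enorm_inv ha]
  rw [h, Measure.smul_apply, volume_closedBall_one, ENNReal.smul_def, smul_eq_mul, mul_one] at h1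
  rw [h, ← h1]
  rfl

/-- Scaling of Haar measure. -/
theorem lintegral_mul_left {a : ℚ_[p]} (ha : a ≠ 0) {H : ℚ_[p] → ℝ≥0∞} (hH : Measurable H) :
    ‖a‖ₑ * ∫⁻ y, H (a * y) = ∫⁻ y, H y := by
  have h := lintegral_map (μ := volume) hH (measurable_const_mul a)
  rw [← h, map_mul_volume ha, lintegral_smul_measure, smul_eq_mul, ← mul_assoc,
    ENNReal.mul_inv_cancel (by simpa using ha) (by simp), one_mul]

end PadicMeasure

section Power

variable {p : ℕ} [Fact p.Prime]

theorem exists_pow_eq_mem_nhds {N : ℕ} (hN : 0 < N) {ρ : ℚ_[p]} (hρ : ρ ≠ 0) :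
    {x : ℚ_[p] | ∃ w, x = ρ * w ^ N} ∈ 𝓝 ρ := by
  have h1 : HasStrictDerivAt (fun x : ℚ_[p] => x ^ N) (N * 1 ^ (N - 1)) 1 :=
    hasStrictDerivAt_pow N 1
  have h2 : map (fun x : ℚ_[p] => ρ * x ^ N) (𝓝 1) = 𝓝 (ρ * 1 ^ N) :=
    (h1.const_mul ρ).map_nhds_eq (by simp [hρ, hN.ne'])
  rw [one_pow, mul_one] at h2
  rw [← h2]
  exact Filter.mem_map.2 (Filter.univ_mem' fun w => ⟨w, rfl⟩)

instance finite_quotient_pow (N : ℕ) [NeZero N] :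
    Finite (ℚ_[p]ˣ ⧸ (powMonoidHom N : ℚ_[p]ˣ →* ℚ_[p]ˣ).range) := by
  classical
  have hN : 0 < N := Nat.pos_of_ne_zero (NeZero.ne N)
  have hp0 : (p : ℚ_[p]) ≠ 0 := Nat.cast_ne_zero.2 (Fact.out : p.Prime).ne_zero
  have hp1 : (1 : ℝ) < p := by exact_mod_cast (Fact.out : p.Prime).one_lt
  set A : Set ℚ_[p] := {x | (p : ℝ) ^ (-(N : ℤ)) ≤ ‖x‖} ∩ Metric.closedBall 0 1 with hA
  have hAc : IsCompact A := (isCompact_closedBall _ _).inter_left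
    (isClosed_le continuous_const continuous_norm)
  have hA0 : ∀ x ∈ A, x ≠ 0 := by
    rintro x ⟨hx, -⟩ rfl
    have : 0 < (p : ℝ) ^ (-(N : ℤ)) := zpow_pos (by linarith) _
    simp only [Set.mem_ofPred_eq, norm_zero] at hx
    linarith
  obtain ⟨t, ht, hcover⟩ := hAc.elim_nhds_subcover (fun ρ => {x : ℚ_[p] | ∃ w, x = ρ * w ^ N})
    fun ρ hρ => exists_pow_eq_mem_nhds hN (hA0 ρ hρ)
  refine Set.finite_univ_iff.1 ((t.finite_toSet.image fun ρ : ℚ_[p] => if h : ρ = 0 then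
    (1 : ℚ_[p]ˣ ⧸ (powMonoidHom N : ℚ_[p]ˣ →* ℚ_[p]ˣ).range)
    else QuotientGroup.mk (Units.mk0 ρ h)).subset fun q _ => ?_)
  obtain ⟨x, rfl⟩ := QuotientGroup.mk_surjective q
  set v : ℤ := (x : ℚ_[p]).valuation with hv
  have hxn : ‖(x : ℚ_[p])‖ = (p : ℝ) ^ (-v) := Padic.norm_eq_zpow_neg_valuation x.ne_zero
  have ha : (x : ℚ_[p]) * ((p : ℚ_[p]) ^ (-(v / N))) ^ N ∈ A := by
    have h1 : ‖(x : ℚ_[p]) * ((p : ℚ_[p]) ^ (-(v / N))) ^ N‖ = (p : ℝ) ^ (-(v % N)) := by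
      rw [norm_mul, norm_pow, hxn, norm_zpow, Padic.norm_p, _root_.inv_zpow', ← zpow_natCast,
        ← zpow_mul, ← zpow_add₀ (by positivity)]
      congr 1
      have := Int.mul_ediv_add_emod v N
      linarith
    have h2 := Int.emod_lt_of_pos v (b := N) (by exact_mod_cast hN)
    have h3 := Int.emod_nonneg v (b := N) (by exact_mod_cast hN.ne')
    refine ⟨?_, ?_⟩
    · rw [Set.mem_ofPred_eq, h1]
      exact zpow_le_zpow_right₀ hp1.le (by linarith)
    · rw [mem_closedBall_zero_iff, h1]
      exact zpow_le_one_of_nonpos₀ hp1.le (by linarith)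
  obtain ⟨ρ, hρ, w, hw⟩ := Set.mem_iUnion₂.1 (hcover ha)
  have hρ0 : ρ ≠ 0 := hA0 ρ (ht ρ hρ)
  have hw0 : w ≠ 0 := by
    rintro rfl
    rw [zero_pow hN.ne', mul_zero] at hw
    exact mul_ne_zero x.ne_zero (pow_ne_zero _ (zpow_ne_zero _ hp0)) hw
  refine ⟨ρ, hρ, ?_⟩
  simp only [dif_neg hρ0]
  rw [QuotientGroup.eq]
  refine ⟨Units.mk0 w hw0 * (Units.mk0 (p : ℚ_[p]) hp0) ^ (v / N), ?_⟩
  ext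
  simp only [powMonoidHom_apply, Units.val_pow_eq_pow_val, Units.val_mul, Units.val_mk0,
    Units.val_zpow_eq_zpow_val, Units.val_inv_eq_inv_val]
  rw [mul_pow, eq_inv_mul_iff_mul_eq₀ hρ0, ← mul_assoc, ← hw, mul_assoc, ← mul_pow, ← zpow_add₀ hp0]
  simp

/-- The multiplicative Haar measure. -/
noncomputable def mulHaar (p : ℕ) [Fact p.Prime] : Measure ℚ_[p] :=
  volume.withDensity fun y => ‖y‖ₑ⁻¹

instance : SFinite (mulHaar p) := by unfold mulHaar; infer_instance

theorem lintegral_mulHaar {H : ℚ_[p] → ℝ≥0∞} (hH : Measurable H) :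
    ∫⁻ y, H y ∂mulHaar p = ∫⁻ y, ‖y‖ₑ⁻¹ * H y :=
  lintegral_withDensity_eq_lintegral_mul _ (by fun_prop) hH

theorem mulHaar_ae_ne_zero : ∀ᵐ y ∂mulHaar p, y ≠ 0 :=
  (withDensity_absolutelyContinuous _ _).ae_le (Measure.ae_ne volume 0)

theorem lintegral_mulHaar_mul_left {a : ℚ_[p]} (ha : a ≠ 0) {H : ℚ_[p] → ℝ≥0∞}
    (hH : Measurable H) : ∫⁻ y, H (a * y) ∂mulHaar p = ∫⁻ y, H y ∂mulHaar p := by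
  rw [lintegral_mulHaar hH, lintegral_mulHaar (by fun_prop),
    ← lintegral_mul_left ha (H := fun y => ‖y‖ₑ⁻¹ * H y) (by fun_prop), ← lintegral_const_mul' _ _
      enorm_ne_top]
  refine lintegral_congr fun y => ?_
  rw [enorm_mul, ENNReal.mul_inv (by simp [ha]) (by simp), ← mul_assoc, ← mul_assoc,
    ENNReal.mul_inv_cancel (by simpa using ha) (by simp), one_mul]

/-- The integral with respect to the sum of the images of multiplicative Haar measure under the maps
`y ↦ ρ * y ^ N`. -/
theorem sum_lintegral_mulHaar_mul_left (N : ℕ) [NeZero N]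
    [Fintype (ℚ_[p]ˣ ⧸ (powMonoidHom N : ℚ_[p]ˣ →* ℚ_[p]ˣ).range)]
    {a : ℚ_[p]} (ha : a ≠ 0) {H : ℚ_[p] → ℝ≥0∞} (hH : Measurable H) :
    ∑ q : ℚ_[p]ˣ ⧸ (powMonoidHom N : ℚ_[p]ˣ →* ℚ_[p]ˣ).range,
        ∫⁻ y, H (a * ((q.out : ℚ_[p]ˣ) * y ^ N)) ∂mulHaar p =
      ∑ q : ℚ_[p]ˣ ⧸ (powMonoidHom N : ℚ_[p]ˣ →* ℚ_[p]ˣ).range,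
        ∫⁻ y, H ((q.out : ℚ_[p]ˣ) * y ^ N) ∂mulHaar p := by
  have hN : 0 < N := Nat.pos_of_ne_zero (NeZero.ne N)
  have key : ∀ x x' : ℚ_[p]ˣ,
    (QuotientGroup.mk x : ℚ_[p]ˣ ⧸ (powMonoidHom N : ℚ_[p]ˣ →* ℚ_[p]ˣ).range) =
      QuotientGroup.mk x' → ∫⁻ y, H (x * y ^ N) ∂mulHaar p = ∫⁻ y, H (x' * y ^ N) ∂mulHaar p := by
    intro x x' h
    obtain ⟨w, hw⟩ := QuotientGroup.eq.1 h
    have hw' : x' = x * w ^ N := by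
      rw [powMonoidHom_apply] at hw
      rw [hw, mul_inv_cancel_left]
    rw [hw', ← lintegral_mulHaar_mul_left w.ne_zero (by fun_prop)]
    refine lintegral_congr fun y => ?_
    push_cast
    ring_nf
  refine Eq.trans ?_ (Equiv.sum_comp (Equiv.mulLeft (QuotientGroup.mk (Units.mk0 a ha)))
    fun q : ℚ_[p]ˣ ⧸ (powMonoidHom N : ℚ_[p]ˣ →* ℚ_[p]ˣ).range =>
      ∫⁻ y, H ((q.out : ℚ_[p]ˣ) * y ^ N) ∂mulHaar p)
  refine Finset.sum_congr rfl fun q _ => ?_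
  rw [key (Quotient.out _) (Units.mk0 a ha * q.out)]
  · simp only [Units.val_mul, Units.val_mk0, mul_assoc]
  · simp

theorem exists_power_reps (N : ℕ) [NeZero N] : ∃ (ι : Type) (_ : Fintype ι) (ρ : ι → ℚ_[p]) (C : ℕ),
    C ≠ 0 ∧ (∀ i, ρ i ≠ 0) ∧ ∀ H : ℚ_[p] → ℝ≥0∞, Measurable H →
      C * ∫⁻ y, H y = ∑ i, ∫⁻ y, ‖ρ i * y ^ (N - 1)‖ₑ * H (ρ i * y ^ N) := by
  classical
  have hN : 0 < N := Nat.pos_of_ne_zero (NeZero.ne N)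
  have := Fintype.ofFinite (ℚ_[p]ˣ ⧸ (powMonoidHom N : ℚ_[p]ˣ →* ℚ_[p]ˣ).range)
  set Q := ℚ_[p]ˣ ⧸ (powMonoidHom N : ℚ_[p]ˣ →* ℚ_[p]ˣ).range with hQ
  set ρ : Q → ℚ_[p] := fun q => (q.out : ℚ_[p]ˣ) with hρ
  have hρ0 : ∀ q, ρ q ≠ 0 := fun q => q.out.ne_zero
  set g : ℚ_[p] → ℝ≥0∞ := (Metric.sphere (0 : ℚ_[p]) 1).indicator 1 with hg
  have hgm : Measurable g := measurable_one.indicator Metric.isClosed_sphere.measurableSet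
  have hginv : ∀ x, g x⁻¹ = g x := fun x => by simp [hg, Set.indicator, inv_eq_one]
  set σ : ℝ≥0∞ := ∫⁻ y, g y ∂mulHaar p with hσ
  have hσv : σ = volume (Metric.sphere (0 : ℚ_[p]) 1) := by
    rw [hσ, lintegral_mulHaar hgm, ← lintegral_indicator_one Metric.isClosed_sphere.measurableSet]
    refine lintegral_congr fun y => ?_
    by_cases hy : ‖y‖ = 1
    · have : ‖y‖ₑ = 1 := by rw [← ofReal_norm, hy, ENNReal.ofReal_one]
      simp [this, hg]
    · simp [hg, hy]
  have hσ0 : σ ≠ 0 := by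
    rw [hσv]
    exact ((IsUltrametricDist.isOpen_sphere 0 one_ne_zero).measure_pos volume ⟨1, by simp⟩).ne'
  have hσt : σ ≠ ∞ := by rw [hσv]; exact (isCompact_sphere _ _).measure_lt_top.ne
  set I : Finset Q := Finset.univ.filter fun q => ∃ y : ℚ_[p], ‖ρ q‖ * ‖y‖ ^ N = 1 with hI
  have hgsum : ∑ q, ∫⁻ y, g (ρ q * y ^ N) ∂mulHaar p = I.card * σ := by
    rw [Finset.card_eq_sum_ones, Nat.cast_sum, Finset.sum_mul, hI, Finset.sum_filter]
    refine Finset.sum_congr rfl fun q _ => ?_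
    split_ifs with h
    · obtain ⟨y₀, hy₀⟩ := h
      have hy0 : y₀ ≠ 0 := by rintro rfl; simp [hN.ne'] at hy₀
      rw [Nat.cast_one, one_mul, hσ, ← lintegral_mulHaar_mul_left (inv_ne_zero hy0) hgm]
      refine lintegral_congr fun y => ?_
      have : ‖ρ q * y ^ N‖ = 1 ↔ ‖y₀⁻¹ * y‖ = 1 := by
        rw [norm_mul, norm_pow, norm_mul, norm_inv, inv_mul_eq_one₀ (norm_ne_zero_iff.2 hy0), ← hy₀,
          mul_right_inj' (norm_ne_zero_iff.2 (hρ0 q)),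
            pow_left_inj₀ (norm_nonneg _) (norm_nonneg _) hN.ne',
          eq_comm]
      simp only [hg, Set.indicator, mem_sphere_zero_iff_norm, this, Pi.one_apply]
    · push Not at h
      have : ∀ y, g (ρ q * y ^ N) = 0 := fun y => by
        simpa [hg] using h y
      simp [this]
  refine ⟨Q, inferInstance, ρ, I.card, ?_, hρ0, fun H hH => ?_⟩
  · refine (Finset.card_pos.2 ⟨(1 : Q), Finset.mem_filter.2 ⟨Finset.mem_univ _, ?_⟩⟩).ne'
    have : (QuotientGroup.mk (1 : Q).out : Q) = QuotientGroup.mk 1 := by simp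
    obtain ⟨w, hw⟩ := QuotientGroup.eq.1 this
    refine ⟨w, ?_⟩
    rw [powMonoidHom_apply, mul_one] at hw
    have : ρ 1 * (w : ℚ_[p]) ^ N = 1 := by
      rw [hρ, ← Units.val_pow_eq_pow_val, hw]
      simp
    rw [← norm_pow, ← norm_mul, this, norm_one]
  have main : ∀ H : ℚ_[p] → ℝ≥0∞, Measurable H →
      σ * ∑ q, ∫⁻ y, H (ρ q * y ^ N) ∂mulHaar p = σ * (I.card * ∫⁻ y, H y ∂mulHaar p) := by
    intro H hH
    calc σ * ∑ q, ∫⁻ y, H (ρ q * y ^ N) ∂mulHaar p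
        = ∫⁻ x, g x * ∑ q, ∫⁻ y, H (ρ q * y ^ N) ∂mulHaar p ∂mulHaar p :=
          (lintegral_mul_const _ hgm).symm
      _ = ∫⁻ x, g x * ∑ q, ∫⁻ y, H (x * (ρ q * y ^ N)) ∂mulHaar p ∂mulHaar p := by
          refine lintegral_congr_ae ?_
          filter_upwards [mulHaar_ae_ne_zero] with x hx
          rw [sum_lintegral_mulHaar_mul_left N hx hH]
      _ = ∑ q, ∫⁻ x, ∫⁻ y, g x * H (x * (ρ q * y ^ N)) ∂mulHaar p ∂mulHaar p := by
          rw [← lintegral_finsetSum]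
          · refine lintegral_congr fun x => ?_
            rw [Finset.mul_sum]
            refine Finset.sum_congr rfl fun q _ => ?_
            rw [lintegral_const_mul _ (by fun_prop)]
          · intro q _
            refine Measurable.lintegral_prod_right ?_
            fun_prop
      _ = ∑ q, ∫⁻ y, ∫⁻ x, g x * H (x * (ρ q * y ^ N)) ∂mulHaar p ∂mulHaar p := by
          refine Finset.sum_congr rfl fun q _ => lintegral_lintegral_swap ?_
          exact Measurable.aemeasurable (by fun_prop)
      _ = ∑ q, ∫⁻ y, ∫⁻ x, g (x⁻¹ * (ρ q * y ^ N)) * H x ∂mulHaar p ∂mulHaar p := by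
          refine Finset.sum_congr rfl fun q _ => lintegral_congr_ae ?_
          filter_upwards [mulHaar_ae_ne_zero] with y hy
          have hb : ρ q * y ^ N ≠ 0 := mul_ne_zero (hρ0 q) (pow_ne_zero _ hy)
          rw [← lintegral_mulHaar_mul_left hb (H := fun x => g (x⁻¹ * (ρ q * y ^ N)) * H x)
            (by fun_prop)]
          refine lintegral_congr fun x => ?_
          rw [_root_.mul_inv_rev, inv_mul_cancel_right₀ hb, hginv, mul_comm x]
      _ = ∑ q, ∫⁻ x, ∫⁻ y, g (x⁻¹ * (ρ q * y ^ N)) * H x ∂mulHaar p ∂mulHaar p := by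
          refine Finset.sum_congr rfl fun q _ => lintegral_lintegral_swap ?_
          exact Measurable.aemeasurable (by fun_prop)
      _ = ∫⁻ x, (∑ q, ∫⁻ y, g (x⁻¹ * (ρ q * y ^ N)) ∂mulHaar p) * H x ∂mulHaar p := by
          rw [← lintegral_finsetSum]
          · refine lintegral_congr fun x => ?_
            rw [Finset.sum_mul]
            refine Finset.sum_congr rfl fun q _ => ?_
            rw [lintegral_mul_const _ (by fun_prop)]
          · intro q _
            refine Measurable.lintegral_prod_right ?_
            fun_prop
      _ = ∫⁻ x, (I.card * σ) * H x ∂mulHaar p := by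
          refine lintegral_congr_ae ?_
          filter_upwards [mulHaar_ae_ne_zero] with x hx
          rw [sum_lintegral_mulHaar_mul_left N (inv_ne_zero hx) hgm, hgsum]
      _ = σ * (I.card * ∫⁻ y, H y ∂mulHaar p) := by
          rw [lintegral_const_mul _ hH]; ring
  have := (ENNReal.mul_right_inj hσ0 hσt).1 (main (fun y => ‖y‖ₑ * H y) (by fun_prop))
  have hcancel : ∀ y : ℚ_[p], y ≠ 0 → ‖y‖ₑ⁻¹ * ‖y‖ₑ = 1 := fun y hy =>
    ENNReal.inv_mul_cancel (by simpa using hy) (by simp)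
  convert this.symm using 2
  · rw [lintegral_mulHaar (by fun_prop)]
    refine lintegral_congr_ae ?_
    filter_upwards [Measure.ae_ne volume 0] with y hy
    rw [← mul_assoc, hcancel y hy, one_mul]
  · rename_i q _
    rw [lintegral_mulHaar (by fun_prop)]
    refine lintegral_congr_ae ?_
    filter_upwards [Measure.ae_ne volume 0] with y hy
    obtain ⟨k, rfl⟩ : ∃ k, N = k + 1 := ⟨N - 1, by omega⟩
    rw [Nat.add_sub_cancel, pow_succ, ← mul_assoc (ρ q), enorm_mul _ y, ← mul_assoc,
      mul_comm _ ‖y‖ₑ, ← mul_assoc, hcancel y hy, one_mul]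

end Power

section RationalFunctions

open Polynomial

/-- The polynomials in `T = p ^ (-s)` allowed as denominators of local zeta functions, up to powers
of `T`. -/
noncomputable def denoms (p : ℕ) : Submonoid ℚ[X] :=
  Submonoid.closure ({X} ∪ {q | ∃ a b : ℕ+, q = 1 - C ((p : ℚ)⁻¹ ^ (b : ℕ)) * X ^ (a : ℕ)})

/-- On the right half-plane, `Z` is a rational function of `p ^ (-s)` with denominator in
`denoms p`. -/
def IsRatFun (p : ℕ) (Z : ℂ → ℂ) : Prop :=
  ∃ D ∈ denoms p, ∃ P : ℚ[X], ∀ s : ℂ, 0 < s.re →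
    Z s * aeval ((p : ℂ) ^ (-s)) D = aeval ((p : ℂ) ^ (-s)) P

variable {p : ℕ} {Z Z₁ Z₂ : ℂ → ℂ}

theorem IsRatFun.congr (h : IsRatFun p Z₁) (he : ∀ s : ℂ, 0 < s.re → Z₁ s = Z₂ s) :
    IsRatFun p Z₂ := by
  obtain ⟨D, hD, P, hP⟩ := h
  exact ⟨D, hD, P, fun s hs => by rw [← he s hs, hP s hs]⟩

theorem IsRatFun.const (c : ℚ) : IsRatFun p fun _ => (c : ℂ) :=
  ⟨1, one_mem _, C c, fun s _ => by simp⟩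

theorem IsRatFun.add (h₁ : IsRatFun p Z₁) (h₂ : IsRatFun p Z₂) :
    IsRatFun p fun s => Z₁ s + Z₂ s := by
  obtain ⟨D₁, hD₁, P₁, hP₁⟩ := h₁
  obtain ⟨D₂, hD₂, P₂, hP₂⟩ := h₂
  refine ⟨D₁ * D₂, mul_mem hD₁ hD₂, P₁ * D₂ + P₂ * D₁, fun s hs => ?_⟩
  simp only [map_add, map_mul, ← hP₁ s hs, ← hP₂ s hs]
  ring

theorem IsRatFun.mul (h₁ : IsRatFun p Z₁) (h₂ : IsRatFun p Z₂) :
    IsRatFun p fun s => Z₁ s * Z₂ s := by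
  obtain ⟨D₁, hD₁, P₁, hP₁⟩ := h₁
  obtain ⟨D₂, hD₂, P₂, hP₂⟩ := h₂
  refine ⟨D₁ * D₂, mul_mem hD₁ hD₂, P₁ * P₂, fun s hs => ?_⟩
  simp only [map_mul, ← hP₁ s hs, ← hP₂ s hs]
  ring

theorem IsRatFun.prod {ι : Type*} (t : Finset ι) {Z : ι → ℂ → ℂ} (h : ∀ i ∈ t, IsRatFun p (Z i)) :
    IsRatFun p fun s => ∏ i ∈ t, Z i s := by
  classical
  induction t using Finset.induction_on with
  | empty => simpa using IsRatFun.const (p := p) 1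
  | insert a t ha ih =>
    simp only [Finset.prod_insert ha]
    exact (h a (Finset.mem_insert_self _ _)).mul
      (ih fun i hi => h i (Finset.mem_insert_of_mem hi))

theorem IsRatFun.zpow [Fact p.Prime] (k : ℤ) : IsRatFun p fun s => ((p : ℂ) ^ (-s)) ^ k := by
  have hp : (p : ℂ) ≠ 0 := Nat.cast_ne_zero.2 (Fact.out : p.Prime).ne_zero
  obtain ⟨n, rfl | rfl⟩ := k.eq_nat_or_neg
  · exact ⟨1, one_mem _, X ^ n, fun s _ => by simp⟩
  · have hX : (X : ℚ[X]) ∈ denoms p := Submonoid.subset_closure (Set.mem_union_left _ rfl)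
    refine ⟨X ^ n, pow_mem hX n, 1, fun s _ => ?_⟩
    have hT : (p : ℂ) ^ (-s) ≠ 0 := by simp [Complex.cpow_eq_zero_iff, hp]
    simp [hT]

theorem IsRatFun.of_mul_one_sub (a b : ℕ+)
    (h : IsRatFun p fun s => Z s * (1 - ((p : ℂ)⁻¹) ^ (b : ℕ) * ((p : ℂ) ^ (-s)) ^ (a : ℕ))) :
    IsRatFun p Z := by
  obtain ⟨D, hD, P, hP⟩ := h
  refine ⟨D * (1 - C ((p : ℚ)⁻¹ ^ (b : ℕ)) * X ^ (a : ℕ)),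
    mul_mem hD (Submonoid.subset_closure (Set.mem_union_right _ ⟨a, b, rfl⟩)), P, fun s hs => ?_⟩
  rw [← hP s hs]
  simp
  ring

/-- The Mellin transform of `ν` is a rational function of `p ^ (-s)`. -/
def IsRatMeasure (p : ℕ) (ν : Measure ℝ) : Prop :=
  (∀ s : ℂ, 0 < s.re → Integrable (fun t : ℝ => (t : ℂ) ^ s) ν) ∧
    IsRatFun p fun s => ∫ t : ℝ, (t : ℂ) ^ s ∂ν

variable {ν ν₁ ν₂ : Measure ℝ}

theorem IsRatMeasure.zero : IsRatMeasure p 0 :=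
  ⟨fun _ _ => integrable_zero_measure, by simpa using IsRatFun.const (p := p) 0⟩

theorem IsRatMeasure.add (h₁ : IsRatMeasure p ν₁) (h₂ : IsRatMeasure p ν₂) :
    IsRatMeasure p (ν₁ + ν₂) :=
  ⟨fun s hs => (h₁.1 s hs).add_measure (h₂.1 s hs), (h₁.2.add h₂.2).congr fun s hs =>
    (integral_add_measure (h₁.1 s hs) (h₂.1 s hs)).symm⟩

theorem IsRatMeasure.sum {ι : Type*} (t : Finset ι) {ν : ι → Measure ℝ}
    (h : ∀ i ∈ t, IsRatMeasure p (ν i)) : IsRatMeasure p (∑ i ∈ t, ν i) := by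
  classical
  induction t using Finset.induction_on with
  | empty => simpa using IsRatMeasure.zero
  | insert a t ha ih =>
    rw [Finset.sum_insert ha]
    exact (h a (Finset.mem_insert_self _ _)).add
      (ih fun i hi => h i (Finset.mem_insert_of_mem hi))

theorem IsRatMeasure.of_smul {C : ℕ} (hC : C ≠ 0) (h : IsRatMeasure p ((C : ℝ≥0∞) • ν)) :
    IsRatMeasure p ν := by
  have hC0 : (C : ℝ≥0∞) ≠ 0 := Nat.cast_ne_zero.2 hC
  refine ⟨fun s hs => (integrable_smul_measure hC0 (ENNReal.natCast_ne_top C)).1 (h.1 s hs), ?_⟩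
  refine ((IsRatFun.const ((C : ℚ)⁻¹)).mul h.2).congr fun s hs => ?_
  rw [integral_smul_measure]
  have : (C : ℂ) ≠ 0 := Nat.cast_ne_zero.2 hC
  simp [this]

end RationalFunctions

section Levels

variable {p : ℕ} [Fact p.Prime] {n : ℕ}

/-- The distribution of `‖f‖` on `U`, weighted by `‖J‖`. -/
noncomputable def lvl (f J : (Fin n → ℚ_[p]) → ℚ_[p]) (U : Set (Fin n → ℚ_[p])) : Measure ℝ :=
  ((volume.restrict U).withDensity fun x => ‖J x‖ₑ).map fun x => ‖f x‖

variable {f J : (Fin n → ℚ_[p]) → ℚ_[p]} {U B W : Set (Fin n → ℚ_[p])}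

theorem lintegral_lvl (hf : Measurable f) (hJ : Measurable J) (hU : MeasurableSet U)
    {H : ℝ → ℝ≥0∞} (hH : Measurable H) :
    ∫⁻ t, H t ∂lvl f J U = ∫⁻ x, U.indicator (fun x => ‖J x‖ₑ * H ‖f x‖) x := by
  rw [lvl, lintegral_map hH hf.norm, lintegral_withDensity_eq_lintegral_mul _ hJ.enorm
    (by fun_prop : Measurable fun x => H ‖f x‖), lintegral_indicator hU]
  rfl

theorem lvl_inter_add_diff (hf : Measurable f) (hB : MeasurableSet B) :
    lvl f J (U ∩ B) + lvl f J (U \ B) = lvl f J U := by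
  rw [lvl, lvl, lvl, ← Measure.map_add _ _ hf.norm, ← withDensity_add_measure,
    Measure.restrict_inter_add_sdiff _ hB]

theorem lvl_eq_sum_of_lintegral_eq {ι : Type*} [Fintype ι] {C : ℕ}
    {c : ι → (Fin n → ℚ_[p]) → Fin n → ℚ_[p]} {j : ι → (Fin n → ℚ_[p]) → ℚ_[p]}
    {S : ι → Set (Fin n → ℚ_[p])} (hc : ∀ i, Measurable (c i)) (hj : ∀ i, Measurable (j i))
    (hS : ∀ i, MeasurableSet (S i))
    (h : ∀ G : (Fin n → ℚ_[p]) → ℝ≥0∞, Measurable G →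
      C * ∫⁻ x, G x = ∑ i, ∫⁻ x, (S i).indicator (fun x => ‖j i x‖ₑ * G (c i x)) x)
    (hf : Measurable f) (hJ : Measurable J) (hU : MeasurableSet U) :
    (C : ℝ≥0∞) • lvl f J U =
      ∑ i, lvl (fun x => f (c i x)) (fun x => J (c i x) * j i x) (c i ⁻¹' U ∩ S i) := by
  refine Measure.ext_of_lintegral _ fun H hH => ?_
  rw [lintegral_smul_measure, lintegral_lvl hf hJ hU hH, smul_eq_mul,
    h _ ((by fun_prop : Measurable fun x => ‖J x‖ₑ * H ‖f x‖).indicator hU),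
    lintegral_finsetSum_measure]
  refine Finset.sum_congr rfl fun i _ => ?_
  have hci := hc i
  have hji := hj i
  rw [lintegral_lvl (by fun_prop) (by fun_prop) ((hc i hU).inter (hS i)) hH]
  refine lintegral_congr fun x => ?_
  by_cases hx : x ∈ S i <;> by_cases hx' : c i x ∈ U <;>
    simp [hx, hx', enorm_mul, mul_assoc, mul_left_comm]

/-- On compact open subsets of `W`, the distribution of `‖f‖` weighted by `‖J‖` has a rational
Mellin transform. -/
def IsGood (f J : (Fin n → ℚ_[p]) → ℚ_[p]) (W : Set (Fin n → ℚ_[p])) : Prop :=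
  ∀ U ⊆ W, IsCompact U → IsOpen U → IsRatMeasure p (lvl f J U)

/-- The point `a` has a neighbourhood in the sense of `IsGood`. -/
def RatAt (f J : (Fin n → ℚ_[p]) → ℚ_[p]) (a : Fin n → ℚ_[p]) : Prop :=
  ∃ W, IsOpen W ∧ a ∈ W ∧ IsGood f J W

theorem IsGood.mono {V : Set (Fin n → ℚ_[p])} (h : IsGood f J W) (hV : V ⊆ W) : IsGood f J V :=
  fun U hU => h U (hU.trans hV)

theorem IsGood.union {V : Set (Fin n → ℚ_[p])} (hf : Measurable f) (h : IsGood f J W)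
    (hV : IsGood f J V) (hW : IsClopen W) : IsGood f J (W ∪ V) := by
  intro U hU hUc hUo
  rw [← lvl_inter_add_diff hf hW.isOpen.measurableSet]
  refine (h _ Set.inter_subset_right (hUc.inter_right hW.isClosed) (hUo.inter hW.isOpen)).add
    (hV _ ?_ (hUc.diff hW.isOpen) (hUo.sdiff hW.isClosed))
  rintro x ⟨hx, hxW⟩
  exact (hU hx).resolve_left hxW

theorem exists_isGood_of_isCompact (hf : Measurable f) {C : Set (Fin n → ℚ_[p])} (hC : IsCompact C)
    (h : ∀ a ∈ C, RatAt f J a) : ∃ W, IsOpen W ∧ C ⊆ W ∧ IsGood f J W := by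
  classical
  have h1 : ∀ a ∈ C, ∃ B, IsClopen B ∧ a ∈ B ∧ IsGood f J B := by
    intro a ha
    obtain ⟨W, hWo, haW, hW⟩ := h a ha
    obtain ⟨ε, hε, hB⟩ := Metric.nhds_basis_closedBall.mem_iff.1 (hWo.mem_nhds haW)
    exact ⟨_, IsUltrametricDist.isClopen_closedBall a hε.ne', Metric.mem_closedBall_self hε.le,
      hW.mono hB⟩
  choose! B hBc haB hB using h1
  obtain ⟨t, ht, hcover⟩ := hC.elim_nhds_subcover B
    fun a ha => (hBc a ha).isOpen.mem_nhds (haB a ha)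
  refine ⟨⋃ a ∈ t, B a, isOpen_biUnion fun a ha => (hBc a (ht a ha)).isOpen, hcover, ?_⟩
  clear hcover
  induction t using Finset.induction_on with
  | empty =>
    intro U hU _ _
    have : U = ∅ := by simpa using hU
    rw [this]
    simpa [lvl] using IsRatMeasure.zero
  | insert a t ha ih =>
    have haC := ht a (Finset.mem_insert_self _ _)
    rw [Finset.set_biUnion_insert]
    exact (hB a haC).union hf (ih fun b hb => ht b (Finset.mem_insert_of_mem hb)) (hBc a haC)

theorem RatAt.of_lintegral_eq {ι : Type*} [Fintype ι] {C : ℕ} (hC : C ≠ 0)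
    {c : ι → (Fin n → ℚ_[p]) → Fin n → ℚ_[p]} {j : ι → (Fin n → ℚ_[p]) → ℚ_[p]}
    {S : ι → Set (Fin n → ℚ_[p])} (hc : ∀ i, Continuous (c i)) (hj : ∀ i, Measurable (j i))
    (hS : ∀ i, IsClopen (S i))
    (h : ∀ G : (Fin n → ℚ_[p]) → ℝ≥0∞, Measurable G →
      C * ∫⁻ x, G x = ∑ i, ∫⁻ x, (S i).indicator (fun x => ‖j i x‖ₑ * G (c i x)) x)
    (hf : Measurable f) (hJ : Measurable J) {a : Fin n → ℚ_[p]} {W : Set (Fin n → ℚ_[p])}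
    (hW : W ∈ 𝓝 a) {V : ι → Set (Fin n → ℚ_[p])}
    (hgood : ∀ i, IsGood (fun x => f (c i x)) (fun x => J (c i x) * j i x) (V i))
    (hsub : ∀ i, ∀ x ∈ S i, c i x ∈ W → x ∈ V i)
    (hbdd : ∀ i, ∀ U ⊆ W, IsCompact U → Bornology.IsBounded (c i ⁻¹' U ∩ S i)) :
    RatAt f J a := by
  refine ⟨interior W, isOpen_interior, mem_interior_iff_mem_nhds.2 hW, fun U hU hUc hUo => ?_⟩
  replace hU := hU.trans interior_subset
  refine .of_smul hC ?_
  rw [lvl_eq_sum_of_lintegral_eq (fun i => (hc i).measurable) hj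
    (fun i => (hS i).isOpen.measurableSet) h
    hf hJ hUo.measurableSet]
  refine .sum _ fun i _ => hgood i _ (fun x hx => hsub i x hx.2 (hU hx.1)) ?_
    ((hUo.preimage (hc i)).inter (hS i).isOpen)
  exact Metric.isCompact_of_isClosed_isBounded
    ((hUc.isClosed.preimage (hc i)).inter (hS i).isClosed) (hbdd i U hU hUc)

theorem RatAt.of_translate (hf : Measurable f) (hJ : Measurable J) {a : Fin n → ℚ_[p]}
    (h : RatAt (fun x => f (x + a)) (fun x => J (x + a)) 0) : RatAt f J a := by
  obtain ⟨V, hVo, hV0, hV⟩ := h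
  have hW : (fun x => x - a) ⁻¹' V ∈ 𝓝 a :=
    (by fun_prop : Continuous fun x => x - a).continuousAt.preimage_mem_nhds
      (by simpa using hVo.mem_nhds hV0)
  refine RatAt.of_lintegral_eq (ι := Unit) one_ne_zero (c := fun _ x => x + a) (j := fun _ _ => 1)
    (S := fun _ => Set.univ) (fun _ => by fun_prop) (fun _ => measurable_const)
    (fun _ => isClopen_univ) (fun G hG => ?_) hf hJ hW (V := fun _ => V) ?_ ?_ ?_
  · simp [lintegral_add_right_eq_self]
  · simpa using hV
  · intro _ x _ hx
    simpa using hx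
  · intro _ U _ hU
    have : (fun x => x + a) ⁻¹' U ∩ Set.univ = (Homeomorph.addRight a) ⁻¹' U := by simp
    rw [this]
    exact ((Homeomorph.addRight a).isCompact_preimage.2 hU).isBounded

end Levels

section Steps

variable {p : ℕ} [Fact p.Prime] {n : ℕ} {f J : (Fin n → ℚ_[p]) → ℚ_[p]}

theorem lintegral_eq_of_update (i : Fin n) {G G' : (Fin n → ℚ_[p]) → ℝ≥0∞} (hG : Measurable G)
    (hG' : Measurable G')
    (h : ∀ x, ∫⁻ t, G (Function.update x i t) = ∫⁻ t, G' (Function.update x i t)) :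
    ∫⁻ x, G x = ∫⁻ x, G' x := by
  rw [volume_pi]
  refine lintegral_eq_of_lmarginal_eq {i} hG hG' (funext fun x => ?_)
  rw [lmarginal_singleton, lmarginal_singleton]
  exact h x

theorem RatAt.of_shear (hf : Measurable f) (hJ : Measurable J) (i : Fin n)
    {φ : (Fin n → ℚ_[p]) → ℚ_[p]} (h0 : φ 0 = 0) (hcont : Continuous φ)
    (hinv : ∀ x t, φ (Function.update x i t) = φ x)
    (h : RatAt (fun x => f (Function.update x i (x i + φ x)))
      (fun x => J (Function.update x i (x i + φ x))) 0) : RatAt f J 0 := by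
  obtain ⟨V, hVo, hV0, hV⟩ := h
  set d : (Fin n → ℚ_[p]) → Fin n → ℚ_[p] := fun x => Function.update x i (x i - φ x) with hd
  have hdc : Continuous d := by fun_prop
  have hdx : ∀ x, d (Function.update x i (x i + φ x)) = x := fun x => by simp [hd, hinv]
  have hd0 : d 0 = 0 := by simp [hd, h0]
  refine RatAt.of_lintegral_eq (ι := Unit) one_ne_zero
    (c := fun _ x => Function.update x i (x i + φ x)) (j := fun _ _ => 1)
    (S := fun _ => Set.univ) (fun _ => by fun_prop) (fun _ => measurable_const)
    (fun _ => isClopen_univ) (fun G hG => ?_) hf hJ (W := d ⁻¹' V) (V := fun _ => V) ?_ ?_ ?_ ?_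
  · have hφ := hcont.measurable
    simp only [Nat.cast_one, one_mul, Finset.univ_unique, enorm_one, Set.indicator_univ,
      Finset.sum_const, Finset.card_singleton, one_smul]
    refine lintegral_eq_of_update i hG (by fun_prop) fun x => ?_
    simp only [Function.update_self, Function.update_idem, hinv]
    exact (lintegral_add_right_eq_self (fun t => G (Function.update x i t)) (φ x)).symm
  · exact hdc.continuousAt.preimage_mem_nhds (by rw [hd0]; exact hVo.mem_nhds hV0)
  · simpa using hV
  · intro _ x _ hx
    rwa [Set.mem_preimage, hdx] at hx
  · intro _ U _ hU
    refine (hU.image hdc).isBounded.subset ?_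
    rintro x ⟨hx, -⟩
    exact ⟨_, hx, hdx x⟩

theorem RatAt.of_power (hf : Measurable f) (hJ : Measurable J) (i : Fin n) {N : ℕ} (hN : 0 < N)
    (h : ∀ ρ : ℚ_[p], ρ ≠ 0 → RatAt (fun x => f (Function.update x i (ρ * x i ^ N)))
      (fun x => J (Function.update x i (ρ * x i ^ N)) * (ρ * x i ^ (N - 1))) 0) : RatAt f J 0 := by
  have : NeZero N := ⟨hN.ne'⟩
  obtain ⟨ι, _, ρ, C, hC, hρ, hcov⟩ := exists_power_reps (p := p) N
  have hball : ∀ k, ∃ r > 0, IsGood (fun x => f (Function.update x i (ρ k * x i ^ N)))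
      (fun x => J (Function.update x i (ρ k * x i ^ N)) * (ρ k * x i ^ (N - 1)))
      (Metric.ball 0 r) := by
    intro k
    obtain ⟨V, hVo, hV0, hV⟩ := h (ρ k) (hρ k)
    obtain ⟨r, hr, hrV⟩ := Metric.isOpen_iff.1 hVo 0 hV0
    exact ⟨r, hr, hV.mono hrV⟩
  choose r hr hgood using hball
  have hsub : ∀ k x, Function.update x i (ρ k * x i ^ N) ∈
      Metric.ball (0 : Fin n → ℚ_[p]) (min (r k) (‖ρ k‖ * r k ^ N)) → x ∈ Metric.ball 0 (r k) := by
    intro k x hx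
    have hρk : 0 < ‖ρ k‖ := norm_pos_iff.2 (hρ k)
    rw [mem_ball_zero_iff, pi_norm_lt_iff (lt_min (hr k) (mul_pos hρk (pow_pos (hr k) N)))] at hx
    rw [mem_ball_zero_iff, pi_norm_lt_iff (hr k)]
    intro l
    by_cases hl : l = i
    · subst hl
      have := (hx l).trans_le (min_le_right _ _)
      rw [Function.update_self, norm_mul, norm_pow, mul_lt_mul_iff_right₀ hρk] at this
      exact lt_of_pow_lt_pow_left₀ N (hr k).le this
    · have := (hx l).trans_le (min_le_left _ _)
      rwa [Function.update_of_ne hl] at this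
  refine RatAt.of_lintegral_eq hC (c := fun k x => Function.update x i (ρ k * x i ^ N))
    (j := fun k x => ρ k * x i ^ (N - 1)) (S := fun _ => Set.univ) (fun k => by fun_prop)
    (fun k => by fun_prop) (fun _ => isClopen_univ) (fun G hG => ?_) hf hJ
    (W := ⋂ k, Metric.ball 0 (min (r k) (‖ρ k‖ * r k ^ N))) ?_ hgood ?_ ?_
  · simp only [Set.indicator_univ]
    rw [← lintegral_finsetSum _ fun k _ => by fun_prop, ← lintegral_const_mul _ hG]
    refine lintegral_eq_of_update i (by fun_prop) (by fun_prop) fun x => ?_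
    simp only [Function.update_self, Function.update_idem]
    rw [lintegral_finsetSum _ fun k _ => by fun_prop, lintegral_const_mul _ (by fun_prop)]
    exact hcov (fun t => G (Function.update x i t)) (by fun_prop)
  · exact iInter_mem.2 fun k => Metric.ball_mem_nhds _
      (lt_min (hr k) (mul_pos (norm_pos_iff.2 (hρ k)) (pow_pos (hr k) N)))
  · exact fun k x _ hx => hsub k x (Set.mem_iInter.1 hx k)
  · exact fun k U hU _ => Metric.isBounded_ball.subset fun x hx =>
      hsub k x (Set.mem_iInter.1 (hU hx.1) k)

theorem lintegral_scale_closedBall (y : ℚ_[p]) {r : ℝ} {H : ℚ_[p] → ℝ≥0∞}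
    (hH : Measurable H) :
    ∫⁻ t, {t | ‖t‖ ≤ r⁻¹ * ‖y‖}.indicator H t =
      ∫⁻ t, {t | ‖t‖ ≤ r⁻¹}.indicator (fun t => ‖y‖ₑ * H (y * t)) t := by
  have hm : ∀ r : ℝ, MeasurableSet {t : ℚ_[p] | ‖t‖ ≤ r} := fun r =>
    measurableSet_le measurable_norm measurable_const
  rcases eq_or_ne y 0 with rfl | hy
  · have h1 : {t : ℚ_[p] | ‖t‖ ≤ r⁻¹ * ‖(0 : ℚ_[p])‖} = {0} := by ext; simp
    rw [h1, lintegral_indicator (measurableSet_singleton 0)]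
    simp
  · rw [← lintegral_mul_left hy (hH.indicator (hm _)), ← lintegral_const_mul' _ _ enorm_ne_top]
    refine lintegral_congr fun t => ?_
    have : ‖y * t‖ ≤ r⁻¹ * ‖y‖ ↔ ‖t‖ ≤ r⁻¹ := by
      rw [norm_mul, mul_comm, mul_le_mul_iff_left₀ (norm_pos_iff.2 hy)]
    by_cases ht : ‖t‖ ≤ r⁻¹ <;> simp only [Set.indicator, Set.mem_ofPred_eq, this, ht, if_true,
      if_false, mul_zero]

theorem lintegral_scale_ball (y : ℚ_[p]) {r : ℝ} (hr : 0 < r) {H : ℚ_[p] → ℝ≥0∞}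
    (hH : Measurable H) :
    ∫⁻ t, {t | ‖y‖ ≤ r⁻¹ * ‖t‖}ᶜ.indicator H t =
      ∫⁻ t, {t | ‖t‖ < r}.indicator (fun t => ‖y‖ₑ * H (y * t)) t := by
  have hm : MeasurableSet {t : ℚ_[p] | ‖y‖ ≤ r⁻¹ * ‖t‖} :=
    measurableSet_le measurable_const (by fun_prop)
  rcases eq_or_ne y 0 with rfl | hy
  · have h1 : {t : ℚ_[p] | ‖(0 : ℚ_[p])‖ ≤ r⁻¹ * ‖t‖}ᶜ = ∅ := by
      ext t
      simp only [norm_zero, Set.mem_compl_iff, Set.mem_ofPred_eq, not_le, Set.mem_empty_iff_false,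
        iff_false, not_lt]
      positivity
    rw [h1]
    simp
  · rw [← lintegral_mul_left hy (hH.indicator hm.compl), ← lintegral_const_mul' _ _ enorm_ne_top]
    refine lintegral_congr fun t => ?_
    have : ‖y‖ ≤ r⁻¹ * ‖y * t‖ ↔ ¬ ‖t‖ < r := by
      rw [norm_mul, inv_mul_eq_div, le_div_iff₀ hr,
        mul_le_mul_iff_right₀ (norm_pos_iff.2 hy), not_lt]
    by_cases ht : ‖t‖ < r <;> simp only [Set.indicator, Set.mem_compl_iff, Set.mem_ofPred_eq, this,
      ht, not_true, not_false_eq_true,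
        if_true, if_false, mul_zero]

theorem lintegral_blowup {i j : Fin n} (hij : i ≠ j) {r : ℝ} (hr : 0 < r)
    {G : (Fin n → ℚ_[p]) → ℝ≥0∞} (hG : Measurable G) :
    ∫⁻ x, G x =
      (∫⁻ x, {x : Fin n → ℚ_[p] | ‖x j‖ ≤ r⁻¹}.indicator
        (fun x => ‖x i‖ₑ * G (Function.update x j (x i * x j))) x) +
      ∫⁻ x, {x : Fin n → ℚ_[p] | ‖x i‖ < r}.indicator
        (fun x => ‖x j‖ₑ * G (Function.update x i (x i * x j))) x := by
  set A : Set (Fin n → ℚ_[p]) := {x | ‖x j‖ ≤ r⁻¹ * ‖x i‖} with hA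
  have hAm : MeasurableSet A := measurableSet_le (by fun_prop) (by fun_prop)
  rw [← lintegral_add_compl G hAm, ← lintegral_indicator hAm, ← lintegral_indicator hAm.compl]
  congr 1
  · refine lintegral_eq_of_update j (hG.indicator hAm) (Measurable.indicator (by fun_prop)
      (measurableSet_le (by fun_prop) (by fun_prop))) fun x => ?_
    have := lintegral_scale_closedBall (x i) (r := r) (H := fun t => G (Function.update x j t))
      (by fun_prop)
    simpa [hA, Set.indicator, Function.update_of_ne hij] using this
  · refine lintegral_eq_of_update i (hG.indicator hAm.compl) (Measurable.indicator (by fun_prop)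
      (measurableSet_lt (by fun_prop) (by fun_prop))) fun x => ?_
    have := lintegral_scale_ball (x j) hr (H := fun t => G (Function.update x i t)) (by fun_prop)
    simpa [hA, Set.indicator, Function.update_of_ne hij.symm, mul_comm (x j)] using this

theorem RatAt.of_blowup (hf : Measurable f) (hJ : Measurable J) {i j : Fin n} (hij : i ≠ j)
    (h : ∀ c : ℚ_[p], RatAt (fun x => f (Function.update x j (x i * (x j + c))))
      (fun x => J (Function.update x j (x i * (x j + c))) * x i) 0)
    (h' : RatAt (fun x => f (Function.update x i (x i * x j)))
      (fun x => J (Function.update x i (x i * x j)) * x j) 0) : RatAt f J 0 := by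
  obtain ⟨V₁, hV₁o, hV₁0, hV₁⟩ := h'
  obtain ⟨r, hr, hrV⟩ := Metric.isOpen_iff.1 hV₁o 0 hV₁0
  have hC : IsCompact ((fun c : ℚ_[p] => (Pi.single j c : Fin n → ℚ_[p])) ''
      Metric.closedBall 0 r⁻¹) :=
    (isCompact_closedBall _ _).image (continuous_single (A := fun _ : Fin n => ℚ_[p]) j)
  obtain ⟨V₀, hV₀o, hCV₀, hV₀⟩ := exists_isGood_of_isCompact
    (f := fun x => f (Function.update x j (x i * x j)))
    (J := fun x => J (Function.update x j (x i * x j)) * x i) (by fun_prop) hC (by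
      rintro _ ⟨c, -, rfl⟩
      refine RatAt.of_translate (by fun_prop) (by fun_prop) ?_
      have hu : ∀ (x : Fin n → ℚ_[p]) y, Function.update (x + Pi.single j c) j y =
          Function.update x j y := by
        intro x y
        ext l
        by_cases hl : l = j
        · subst hl; simp
        · simp [hl]
      simpa [hu, hij] using h c)
  obtain ⟨ε, hε, hεV⟩ := hC.exists_thickening_subset_open hV₀o hCV₀
  have hsub₀ : ∀ x : Fin n → ℚ_[p], ‖x j‖ ≤ r⁻¹ → Function.update x j (x i * x j) ∈
      Metric.ball (0 : Fin n → ℚ_[p]) (min ε r) → x ∈ Metric.ball (Pi.single j (x j)) ε := by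
    intro x hxj hx
    rw [mem_ball_zero_iff, pi_norm_lt_iff (lt_min hε hr)] at hx
    rw [mem_ball_iff_norm, pi_norm_lt_iff hε]
    intro l
    by_cases hl : l = j
    · subst hl; simpa using hε
    · simpa [Function.update_of_ne hl, hl] using (hx l).trans_le (min_le_left _ _)
  have hsub₁ : ∀ x : Fin n → ℚ_[p], ‖x i‖ < r → Function.update x i (x i * x j) ∈
      Metric.ball (0 : Fin n → ℚ_[p]) (min ε r) → x ∈ Metric.ball 0 r := by
    intro x hxi hx
    rw [mem_ball_zero_iff, pi_norm_lt_iff (lt_min hε hr)] at hx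
    rw [mem_ball_zero_iff, pi_norm_lt_iff hr]
    intro l
    by_cases hl : l = i
    · subst hl; exact hxi
    · simpa [Function.update_of_ne hl] using (hx l).trans_le (min_le_right _ _)
  refine RatAt.of_lintegral_eq (ι := Bool) one_ne_zero
    (c := fun b => cond b (fun x => Function.update x j (x i * x j))
      fun x => Function.update x i (x i * x j))
    (j := fun b => cond b (fun x => x i) fun x => x j)
    (S := fun b => cond b {x | ‖x j‖ ≤ r⁻¹} {x | ‖x i‖ < r})
    ?_ ?_ ?_ (fun G hG => ?_) hf hJ (W := Metric.ball 0 (min ε r))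
    (Metric.ball_mem_nhds _ (lt_min hε hr)) (V := fun b => cond b V₀ V₁) ?_ ?_ ?_
  · rintro (_ | _) <;> dsimp only [cond] <;> fun_prop
  · rintro (_ | _) <;> dsimp only [cond] <;> fun_prop
  · rintro (_ | _) <;> dsimp only [cond]
    · have := (IsUltrametricDist.isClopen_ball (0 : ℚ_[p]) r).preimage
        (continuous_apply i : Continuous fun x : Fin n → ℚ_[p] => x i)
      simpa [Set.preimage] using this
    · have := (IsUltrametricDist.isClopen_closedBall (0 : ℚ_[p]) (inv_ne_zero hr.ne')).preimage
        (continuous_apply j : Continuous fun x : Fin n → ℚ_[p] => x j)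
      simpa [Set.preimage] using this
  · rw [Fintype.sum_bool, Nat.cast_one, one_mul]
    exact lintegral_blowup hij hr hG
  · rintro (_ | _)
    · exact hV₁
    · exact hV₀
  · rintro (_ | _) x hx hxW
    · exact hrV (hsub₁ x hx hxW)
    · exact hεV (Metric.mem_thickening_iff.2 ⟨_, ⟨x j, by simpa using hx, rfl⟩, hsub₀ x hx hxW⟩)
  · rintro (_ | _) U hU -
    · exact Metric.isBounded_ball.subset fun x hx => hsub₁ x hx.2 (hU hx.1)
    · refine (hC.isBounded.thickening (δ := ε)).subset fun x hx => Metric.mem_thickening_iff.2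
        ⟨_, ⟨x j, by simpa using hx.2, rfl⟩, hsub₀ x hx.2 (hU hx.1)⟩

end Steps

section Monomial

variable {p : ℕ} [Fact p.Prime]

theorem norm_eq_of_norm_sub_lt {x y : ℚ_[p]} (h : ‖x - y‖ < ‖y‖) : ‖x‖ = ‖y‖ := by
  rw [← norm_neg y]
  refine IsUltrametricDist.norm_eq_of_add_norm_lt_max ?_
  rw [← sub_eq_add_neg, norm_neg]
  exact h.trans_le (le_max_right _ _)

theorem IsRatFun.norm (a : ℚ_[p]) : IsRatFun p fun _ => (‖a‖ : ℂ) := by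
  obtain ⟨q, hq⟩ := Padic.padicNormE.is_rat a
  rw [hq]
  simpa using IsRatFun.const (p := p) q

theorem norm_cpow_eq_zpow {a : ℚ_[p]} (ha : a ≠ 0) (s : ℂ) :
    (‖a‖ : ℂ) ^ s = ((p : ℂ) ^ (-s)) ^ a.valuation := by
  have hp : (p : ℂ) ≠ 0 := Nat.cast_ne_zero.2 (Fact.out : p.Prime).ne_zero
  have ha' : (‖a‖ : ℂ) ≠ 0 := by simpa using ha
  rw [Complex.cpow_def_of_ne_zero ha', Complex.cpow_def_of_ne_zero hp, ← Complex.exp_int_mul,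
    ← Complex.ofReal_log (norm_nonneg _), Padic.norm_eq_zpow_neg_valuation ha, Real.log_zpow,
    ← Complex.natCast_log]
  push_cast
  ring_nf

theorem IsRatFun.norm_cpow {a : ℚ_[p]} (ha : a ≠ 0) : IsRatFun p fun s => (‖a‖ : ℂ) ^ s :=
  (IsRatFun.zpow a.valuation).congr fun s _ => (norm_cpow_eq_zpow ha s).symm

theorem continuous_norm_mul_cpow (α β : ℕ) {s : ℂ} (hs : 0 < s.re) :
    Continuous fun x : ℚ_[p] => (‖x ^ β‖ : ℂ) * (‖x ^ α‖ : ℂ) ^ s := by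
  have h1 : Continuous fun x : ℚ_[p] => (‖x ^ β‖ : ℂ) := by fun_prop
  have h2 : Continuous fun x : ℚ_[p] => ‖x ^ α‖ := by fun_prop
  exact h1.mul ((Complex.continuous_ofReal_cpow_const hs).comp h2)

theorem measureReal_closedBall_norm (x : ℚ_[p]) {e : ℚ_[p]} (he : e ≠ 0) :
    volume.real (Metric.closedBall x ‖e‖) = ‖e‖ := by
  rw [Measure.real, volume_closedBall_norm x he, toReal_enorm]

theorem setIntegral_closedBall_mul {a e : ℚ_[p]} (ha : a ≠ 0) (g : ℚ_[p] → ℂ) :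
    ∫ x in Metric.closedBall 0 ‖a * e‖, g x = ‖a‖ * ∫ x in Metric.closedBall 0 ‖e‖, g (a * x) := by
  have hemb : MeasurableEmbedding fun x : ℚ_[p] => a * x :=
    (Homeomorph.mulLeft₀ a ha).isClosedEmbedding.measurableEmbedding
  have hpre : (fun x : ℚ_[p] => a * x) ⁻¹' Metric.closedBall 0 ‖a * e‖ =
      Metric.closedBall 0 ‖e‖ := by
    ext x
    simp [mul_le_mul_iff_right₀ (norm_pos_iff.2 ha)]
  rw [← hpre, ← hemb.setIntegral_map, map_mul_volume ha, Measure.restrict_smul,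
    integral_smul_measure, ENNReal.toReal_inv, toReal_enorm, Complex.real_smul, Complex.ofReal_inv,
    mul_inv_cancel_left₀ (by simpa using ha)]

theorem isRatFun_closedBall_zero (α β : ℕ) {e : ℚ_[p]} (he : e ≠ 0) :
    IsRatFun p fun s => ∫ x in Metric.closedBall (0 : ℚ_[p]) ‖e‖,
      (‖x ^ β‖ : ℂ) * (‖x ^ α‖ : ℂ) ^ s := by
  have hp0 : (p : ℚ_[p]) ≠ 0 := Nat.cast_ne_zero.2 (Fact.out : p.Prime).ne_zero
  have hp1 : (1 : ℝ) < p := by exact_mod_cast (Fact.out : p.Prime).one_lt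
  have hlt : ‖(p : ℚ_[p]) * e‖ < ‖e‖ := by
    rw [norm_mul, Padic.norm_p]
    exact mul_lt_of_lt_one_left (norm_pos_iff.2 he) (inv_lt_one_of_one_lt₀ hp1)
  set S : Set ℚ_[p] := Metric.closedBall 0 ‖e‖ \ Metric.closedBall 0 ‖(p : ℚ_[p]) * e‖ with hS
  have hSn : ∀ x ∈ S, ‖x‖ = ‖e‖ := by
    rintro x ⟨hx1, hx2⟩
    rw [mem_closedBall_zero_iff] at hx1 hx2
    refine le_antisymm hx1 ?_
    by_contra! hx
    refine hx2 ?_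
    rcases eq_or_ne x 0 with rfl | hx0
    · rw [norm_zero]; exact norm_nonneg _
    rw [norm_mul, Padic.norm_p]
    rw [Padic.norm_eq_zpow_neg_valuation he] at hx ⊢
    rw [Padic.norm_eq_zpow_neg_valuation hx0] at hx ⊢
    have := (zpow_lt_zpow_iff_right₀ hp1).1 hx
    rw [← zpow_neg_one, ← zpow_add₀ (by positivity)]
    exact zpow_le_zpow_right₀ hp1.le (by linarith)
  have hkey : ∀ s : ℂ, 0 < s.re → (∫ x in Metric.closedBall (0 : ℚ_[p]) ‖e‖,
      (‖x ^ β‖ : ℂ) * (‖x ^ α‖ : ℂ) ^ s) *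
        (1 - ((p : ℂ)⁻¹) ^ (β + 1) * ((p : ℂ) ^ (-s)) ^ α) =
      (‖e‖ - ‖(p : ℚ_[p]) * e‖ : ℂ) * (‖e ^ β‖ * (‖e ^ α‖ : ℂ) ^ s) := by
    intro s hs
    have hc := continuous_norm_mul_cpow (p := p) α β hs
    have hintegrable : ∀ r, IntegrableOn (fun x : ℚ_[p] => (‖x ^ β‖ : ℂ) * (‖x ^ α‖ : ℂ) ^ s)
        (Metric.closedBall 0 r) := fun r =>
      hc.continuousOn.integrableOn_compact (isCompact_closedBall _ _)
    have h1 : ∫ x in S, (‖x ^ β‖ : ℂ) * (‖x ^ α‖ : ℂ) ^ s =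
        (‖e‖ - ‖(p : ℚ_[p]) * e‖ : ℂ) * (‖e ^ β‖ * (‖e ^ α‖ : ℂ) ^ s) := by
      rw [setIntegral_congr_fun (g := fun _ => (‖e ^ β‖ : ℂ) * (‖e ^ α‖ : ℂ) ^ s)
        (Metric.isClosed_closedBall.measurableSet.diff Metric.isClosed_closedBall.measurableSet)
        fun x hx => by simp only [norm_pow, hSn x hx], setIntegral_const,
        measureReal_sdiff (Metric.closedBall_subset_closedBall hlt.le)
          Metric.isClosed_closedBall.measurableSet
          (h₁ := (isCompact_closedBall _ _).measure_lt_top.ne),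
        measureReal_closedBall_norm _ he, measureReal_closedBall_norm _ (mul_ne_zero hp0 he),
        Complex.real_smul, Complex.ofReal_sub]
    have h2 : ∫ x in Metric.closedBall (0 : ℚ_[p]) ‖(p : ℚ_[p]) * e‖,
        (‖x ^ β‖ : ℂ) * (‖x ^ α‖ : ℂ) ^ s = ((p : ℂ)⁻¹) ^ (β + 1) * ((p : ℂ) ^ (-s)) ^ α *
          ∫ x in Metric.closedBall (0 : ℚ_[p]) ‖e‖, (‖x ^ β‖ : ℂ) * (‖x ^ α‖ : ℂ) ^ s := by
      rw [setIntegral_closedBall_mul hp0, ← integral_const_mul, ← integral_const_mul]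
      refine integral_congr_ae (Eventually.of_forall fun x => ?_)
      have h3 : (‖((p : ℚ_[p]) * x) ^ α‖ : ℂ) ^ s = ((p : ℂ) ^ (-s)) ^ α * (‖x ^ α‖ : ℂ) ^ s := by
        rw [mul_pow, norm_mul, Complex.ofReal_mul, Complex.mul_cpow_ofReal_nonneg (norm_nonneg _)
          (norm_nonneg _), norm_cpow_eq_zpow (pow_ne_zero _ hp0)]
        simp
      dsimp only
      rw [h3, mul_pow, norm_mul, norm_pow (p : ℚ_[p]), Padic.norm_p]
      push_cast
      ring
    have h4 := setIntegral_union (μ := volume)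
      (Set.disjoint_sdiff_left (t := Metric.closedBall (0 : ℚ_[p]) ‖e‖)
      (s := Metric.closedBall 0 ‖(p : ℚ_[p]) * e‖)) Metric.isClosed_closedBall.measurableSet
      ((hintegrable _).mono_set Set.sdiff_subset) (hintegrable _)
    rw [Set.sdiff_union_of_subset (Metric.closedBall_subset_closedBall hlt.le), ← hS, h1, h2] at h4
    linear_combination h4
  have hrat : IsRatFun p fun s =>
      (‖e‖ - ‖(p : ℚ_[p]) * e‖ : ℂ) * (‖e ^ β‖ * (‖e ^ α‖ : ℂ) ^ s) := by
    refine IsRatFun.mul ?_ ((IsRatFun.norm _).mul (IsRatFun.norm_cpow (pow_ne_zero _ he)))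
    refine ((IsRatFun.norm e).add ((IsRatFun.const (-1)).mul
      (IsRatFun.norm ((p : ℚ_[p]) * e)))).congr
      fun s _ => ?_
    push_cast
    ring
  rcases Nat.eq_zero_or_pos α with rfl | hα
  · have hne : 1 - ((p : ℚ)⁻¹) ^ (β + 1) ≠ 0 := by
      have hp1' : (1 : ℚ) < p := by exact_mod_cast (Fact.out : p.Prime).one_lt
      have := pow_lt_one₀ (inv_nonneg.2 (by positivity)) (inv_lt_one_of_one_lt₀ hp1')
        (Nat.succ_ne_zero β)
      exact (sub_pos.2 this).ne'
    refine (hrat.mul (IsRatFun.const ((1 - ((p : ℚ)⁻¹) ^ (β + 1))⁻¹))).congr fun s hs => ?_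
    have hne' : (1 : ℂ) - ((p : ℂ)⁻¹) ^ (β + 1) ≠ 0 := by
      have := (Rat.cast_ne_zero (α := ℂ)).2 hne
      push_cast at this
      exact this
    have := hkey s hs
    rw [pow_zero ((p : ℂ) ^ (-s)), mul_one] at this
    rw [← this]
    push_cast
    rw [mul_assoc, mul_inv_cancel₀ hne', mul_one]
  · exact IsRatFun.of_mul_one_sub ⟨α, hα⟩ ⟨β + 1, β.succ_pos⟩
      (hrat.congr fun s hs => (hkey s hs).symm)

theorem isRatFun_closedBall (α β : ℕ) (a : ℚ_[p]) {e : ℚ_[p]} (he : e ≠ 0) :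
    IsRatFun p fun s => ∫ x in Metric.closedBall a ‖e‖, (‖x ^ β‖ : ℂ) * (‖x ^ α‖ : ℂ) ^ s := by
  by_cases ha : ‖a‖ ≤ ‖e‖
  · rw [← IsUltrametricDist.closedBall_eq_of_mem (mem_closedBall_zero_iff.2 ha)]
    exact isRatFun_closedBall_zero α β he
  · have ha0 : a ≠ 0 := by rintro rfl; simp at ha
    refine ((IsRatFun.norm e).mul ((IsRatFun.norm (a ^ β)).mul
      (IsRatFun.norm_cpow (pow_ne_zero α ha0)))).congr fun s _ => ?_
    rw [setIntegral_congr_fun (g := fun _ => (‖a ^ β‖ : ℂ) * (‖a ^ α‖ : ℂ) ^ s)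
      Metric.isClosed_closedBall.measurableSet fun x hx => ?_, setIntegral_const,
      measureReal_closedBall_norm _ he, Complex.real_smul]
    rw [mem_closedBall_iff_norm] at hx
    simp only [norm_pow, norm_eq_of_norm_sub_lt (hx.trans_lt (not_le.1 ha))]

end Monomial

section Leaf

variable {p : ℕ} [Fact p.Prime] {n : ℕ} {f J : (Fin n → ℚ_[p]) → ℚ_[p]}
  {U : Set (Fin n → ℚ_[p])}

theorem aestronglyMeasurable_cpow {s : ℂ} (hs : 0 < s.re) (ν : Measure ℝ) :
    AEStronglyMeasurable (fun t : ℝ => (t : ℂ) ^ s) ν :=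
  (Complex.continuous_ofReal_cpow_const hs).aestronglyMeasurable

theorem integral_lvl (hf : Measurable f) (hJ : Measurable J) {s : ℂ} (hs : 0 < s.re) :
    ∫ t : ℝ, (t : ℂ) ^ s ∂lvl f J U = ∫ x in U, (‖J x‖ : ℂ) * (‖f x‖ : ℂ) ^ s := by
  rw [lvl, integral_map hf.norm.aemeasurable (aestronglyMeasurable_cpow hs _),
    integral_withDensity_eq_integral_toReal_smul hJ.enorm (Eventually.of_forall fun x => by simp)]
  simp

theorem integrable_lvl_iff (hf : Measurable f) (hJ : Measurable J) {s : ℂ} (hs : 0 < s.re) :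
    Integrable (fun t : ℝ => (t : ℂ) ^ s) (lvl f J U) ↔
      IntegrableOn (fun x => (‖J x‖ : ℂ) * (‖f x‖ : ℂ) ^ s) U := by
  rw [lvl, integrable_map_measure (aestronglyMeasurable_cpow hs _) hf.norm.aemeasurable,
    integrable_withDensity_iff_integrable_smul' hJ.enorm (Eventually.of_forall fun x => by simp)]
  simp [IntegrableOn]

theorem prod_ofReal_cpow {ι : Type*} (t : Finset ι) {r : ι → ℝ} (hr : ∀ i ∈ t, 0 ≤ r i) (s : ℂ) :
    (∏ i ∈ t, (r i : ℂ)) ^ s = ∏ i ∈ t, (r i : ℂ) ^ s := by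
  classical
  induction t using Finset.induction_on with
  | empty => simp
  | insert a t ha ih =>
    rw [Finset.forall_mem_insert] at hr
    rw [Finset.prod_insert ha, Finset.prod_insert ha, ← ih hr.2, ← Complex.ofReal_prod,
      Complex.mul_cpow_ofReal_nonneg hr.1 (Finset.prod_nonneg hr.2)]

theorem isRatMeasure_closedBall (hf : Measurable f) (hJ : Measurable J) {α β : Fin n → ℕ}
    {u v e : ℚ_[p]} (hu : u ≠ 0) (he : e ≠ 0) {a : Fin n → ℚ_[p]}
    (hfm : ∀ x ∈ Metric.closedBall a ‖e‖, ‖f x‖ = ‖u‖ * ‖mono α x‖)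
    (hJm : ∀ x ∈ Metric.closedBall a ‖e‖, ‖J x‖ = ‖v‖ * ‖mono β x‖) :
    IsRatMeasure p (lvl f J (Metric.closedBall a ‖e‖)) := by
  have hB : MeasurableSet (Metric.closedBall a ‖e‖) := Metric.isClosed_closedBall.measurableSet
  have hμ : volume.restrict (Metric.closedBall a ‖e‖) =
      Measure.pi fun i => (volume : Measure ℚ_[p]).restrict (Metric.closedBall (a i) ‖e‖) := by
    rw [closedBall_pi _ (norm_nonneg e), volume_pi, Measure.restrict_pi_pi]
  have heq : ∀ s : ℂ, Set.EqOn (fun x => (‖J x‖ : ℂ) * (‖f x‖ : ℂ) ^ s)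
      (fun x => ‖v‖ * (‖u‖ : ℂ) ^ s * ∏ i, (‖x i ^ β i‖ : ℂ) * (‖x i ^ α i‖ : ℂ) ^ s)
      (Metric.closedBall a ‖e‖) := by
    intro s x hx
    dsimp only
    rw [hfm x hx, hJm x hx, Finset.prod_mul_distrib, mono, mono, norm_prod, norm_prod,
      Complex.ofReal_mul, Complex.ofReal_mul, Complex.mul_cpow_ofReal_nonneg (norm_nonneg _)
      (Finset.prod_nonneg fun i _ => norm_nonneg _), Complex.ofReal_prod, Complex.ofReal_prod,
      prod_ofReal_cpow _ fun i _ => norm_nonneg _]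
    ring
  refine ⟨fun s hs => ?_, ?_⟩
  · rw [integrable_lvl_iff hf hJ hs, integrableOn_congr_fun (heq s) hB, IntegrableOn, hμ]
    exact (Integrable.fintype_prod fun i => (continuous_norm_mul_cpow (α i) (β i)
      hs).continuousOn.integrableOn_compact (isCompact_closedBall _ _)).const_mul _
  · refine (((IsRatFun.norm v).mul (IsRatFun.norm_cpow hu)).mul
      (IsRatFun.prod Finset.univ fun i _ =>
      isRatFun_closedBall (α i) (β i) (a i) he)).congr fun s hs => ?_
    rw [integral_lvl hf hJ hs, setIntegral_congr_fun hB (heq s), hμ, integral_const_mul,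
      integral_fintype_prod_eq_prod fun i (x : ℚ_[p]) => (‖x ^ β i‖ : ℂ) * (‖x ^ α i‖ : ℂ) ^ s]

theorem isRatMeasure_iUnion_closedBall (hf : Measurable f) {δ : ℝ}
    (t : Finset (Fin n → ℚ_[p]))
    (h : ∀ a ∈ t, IsRatMeasure p (lvl f J (Metric.closedBall a δ))) :
    IsRatMeasure p (lvl f J (⋃ a ∈ t, Metric.closedBall a δ)) := by
  classical
  induction t using Finset.induction_on with
  | empty => simpa [lvl] using IsRatMeasure.zero
  | insert a t ha ih =>
    have ih' := ih fun b hb => h b (Finset.mem_insert_of_mem hb)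
    rw [Finset.set_biUnion_insert]
    by_cases hB : ∃ b ∈ t, Metric.closedBall a δ = Metric.closedBall b δ
    · obtain ⟨b, hb, hab⟩ := hB
      rwa [Set.union_eq_self_of_subset_left]
      rw [hab]
      exact Set.subset_biUnion_of_mem (u := fun b => Metric.closedBall b δ) hb
    · push Not at hB
      have hdisj : Disjoint (Metric.closedBall a δ) (⋃ b ∈ t, Metric.closedBall b δ) :=
        Set.disjoint_iUnion₂_right.2 fun b hb =>
          (IsUltrametricDist.closedBall_eq_or_disjoint a b δ).resolve_left (hB b hb)
      rw [← lvl_inter_add_diff hf (B := Metric.closedBall a δ)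
        Metric.isClosed_closedBall.measurableSet, Set.inter_eq_right.2 Set.subset_union_left,
        Set.union_sdiff_cancel_left hdisj.le_bot]
      exact (h a (Finset.mem_insert_self _ _)).add ih'

theorem eventually_norm_eq {u : (Fin n → ℚ_[p]) → ℚ_[p]} (hu : ContinuousAt u 0) (hu0 : u 0 ≠ 0) :
    ∀ᶠ x in 𝓝 0, ‖u x‖ = ‖u 0‖ := by
  filter_upwards [hu.eventually (Metric.ball_mem_nhds (u 0) (norm_pos_iff.2 hu0))] with x hx
  exact norm_eq_of_norm_sub_lt (mem_ball_iff_norm.1 hx)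

theorem RatAt.of_isNC (hf : Measurable f) (hJ : Measurable J) (hfn : IsNC f) (hJn : IsNC J) :
    RatAt f J 0 := by
  obtain ⟨α, u, hua, hu0, hu⟩ := hfn
  obtain ⟨β, v, hva, hv0, hv⟩ := hJn
  obtain ⟨ε, hε, hball⟩ := Metric.eventually_nhds_iff_ball.1
    (((hu.and hv).and (eventually_norm_eq hua.continuousAt hu0)).and
      (eventually_norm_eq hva.continuousAt hv0))
  refine ⟨_, Metric.isOpen_ball, Metric.mem_ball_self hε, fun U hU hUc hUo => ?_⟩
  obtain ⟨δ, hδ, hδU⟩ := hUc.exists_thickening_subset_open hUo subset_rfl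
  obtain ⟨e, he, heδ⟩ := NormedField.exists_norm_lt ℚ_[p] hδ
  have he0 : e ≠ 0 := norm_pos_iff.1 he
  obtain ⟨t, ht, hcover⟩ := hUc.elim_nhds_subcover (fun a => Metric.closedBall a ‖e‖)
    fun a _ => Metric.closedBall_mem_nhds a he
  have hsub : ∀ a ∈ U, Metric.closedBall a ‖e‖ ⊆ U := fun a ha x hx =>
    hδU (Metric.mem_thickening_iff.2 ⟨a, ha, (Metric.mem_closedBall.1 hx).trans_lt heδ⟩)
  rw [hcover.antisymm (Set.iUnion₂_subset fun a ha => hsub a (ht a ha))]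
  refine isRatMeasure_iUnion_closedBall hf t fun a ha =>
    isRatMeasure_closedBall hf hJ (α := α) (β := β) hu0 he0 (fun x hx => ?_)
      (v := v 0) fun x hx => ?_
  · obtain ⟨⟨⟨h1, h2⟩, h3⟩, h4⟩ := hball x (hU (hsub a (ht a ha) hx))
    rw [h1, norm_mul, h3, mul_comm]
  · obtain ⟨⟨⟨h1, h2⟩, h3⟩, h4⟩ := hball x (hU (hsub a (ht a ha) hx))
    rw [h2, norm_mul, h4, mul_comm]

theorem RatAt.of_tree (hT : Tree (fun f J => IsNC f ∧ IsNC J) f J) (hf : Measurable f)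
    (hJ : Measurable J) : RatAt f J 0 := by
  induction hT with
  | leaf h => exact RatAt.of_isNC hf hJ h.1 h.2
  | shear i φ _ h0 hcont hinv _ ih =>
    have := hcont.measurable
    exact RatAt.of_shear hf hJ i h0 hcont hinv (ih (by fun_prop) (by fun_prop))
  | blowup i j hij _ _ ih ih' =>
    exact RatAt.of_blowup hf hJ hij (fun c => ih c (by fun_prop) (by fun_prop))
      (ih' (by fun_prop) (by fun_prop))
  | power i N hN _ ih =>
    exact RatAt.of_power hf hJ i hN fun ρ hρ => ih ρ hρ (by fun_prop) (by fun_prop)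

/-- Analytic functions with a nonzero germ have local zeta functions that are rational near the
origin. -/
theorem RatAt.of_analyticAt (hf : Measurable f) (hfa : AnalyticAt ℚ_[p] f 0)
    (hf0 : ¬ f =ᶠ[𝓝 0] 0) : RatAt f (fun _ => 1) 0 := by
  refine RatAt.of_tree ?_ hf measurable_const
  have := (resolvable n f hfa hf0).transport (Q := fun f J => IsNC f ∧ IsNC J) f (fun _ => 1)
    fun Ψ J h => .leaf (by simpa [IsLeaf] using h.1)
  simpa using this

end Leaf

section Global

variable {p : ℕ} [Fact p.Prime] {n : ℕ}

theorem aeval_not_eventuallyEq_zero {f : MvPolynomial (Fin n) ℤ_[p]} (hf : f ≠ 0)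
    (a : Fin n → ℚ_[p]) : ¬ (fun x => MvPolynomial.aeval x f : (Fin n → ℚ_[p]) → ℚ_[p])
      =ᶠ[𝓝 a] 0 := by
  intro h
  obtain ⟨ε, hε, hball⟩ := Metric.eventually_nhds_iff_ball.1 h
  refine hf (MvPolynomial.map_injective (algebraMap ℤ_[p] ℚ_[p])
    (FaithfulSMul.algebraMap_injective _ _) ?_)
  rw [map_zero]
  refine MvPolynomial.funext_set (fun i => Metric.ball (a i) ε)
    (fun i => infinite_of_mem_nhds (a i) (Metric.ball_mem_nhds _ hε)) fun x hx => ?_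
  rw [← ball_pi _ hε] at hx
  rw [MvPolynomial.eval_map, map_zero]
  exact hball x hx

theorem isRatFun_setIntegral_aeval {f : MvPolynomial (Fin n) ℤ_[p]} (hf : f ≠ 0) :
    IsRatFun p fun s => ∫ x in Metric.closedBall (0 : Fin n → ℚ_[p]) 1,
      (‖(MvPolynomial.aeval x f : ℚ_[p])‖ : ℂ) ^ s := by
  have han : ∀ a, AnalyticAt ℚ_[p] (fun x : Fin n → ℚ_[p] => (MvPolynomial.aeval x f : ℚ_[p])) a :=
    fun a => AnalyticAt.aeval_mvPolynomial
      (fun i => (ContinuousLinearMap.proj (R := ℚ_[p])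
        (φ := fun _ : Fin n => ℚ_[p]) i).analyticAt a) f
  have hm : Measurable fun x : Fin n → ℚ_[p] => (MvPolynomial.aeval x f : ℚ_[p]) :=
    (continuous_iff_continuousAt.2 fun a => (han a).continuousAt).measurable
  have hrat : ∀ a, RatAt (fun x : Fin n → ℚ_[p] => (MvPolynomial.aeval x f : ℚ_[p]))
      (fun _ => 1) a := by
    intro a
    have hadd : ContinuousAt (fun x : Fin n → ℚ_[p] => x - a) a := by fun_prop
    refine RatAt.of_translate hm measurable_const
      (RatAt.of_analyticAt (hm.comp (measurable_add_const a)) ?_ fun h => ?_)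
    · exact AnalyticAt.comp_of_eq (g := fun x : Fin n → ℚ_[p] => (MvPolynomial.aeval x f : ℚ_[p]))
        (han a) (analyticAt_id.add analyticAt_const) (zero_add a)
    · refine aeval_not_eventuallyEq_zero hf a ?_
      have := hadd.eventually (by rwa [sub_self] : _ ∈ 𝓝 (a - a))
      filter_upwards [this] with x hx
      simpa using hx
  obtain ⟨W, -, hW, hgood⟩ := exists_isGood_of_isCompact hm
    (isCompact_closedBall (0 : Fin n → ℚ_[p]) 1) fun a _ => hrat a
  refine (hgood _ hW (isCompact_closedBall _ _)
    (IsUltrametricDist.isOpen_closedBall _ one_ne_zero)).2.congr fun s hs => ?_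
  rw [integral_lvl hm measurable_const hs]
  simp

/-- The inclusion of the lattice `ℤ_[p] ^ n` into `ℚ_[p] ^ n`. -/
noncomputable def latticeHom (p : ℕ) [Fact p.Prime] (n : ℕ) :
    (Fin n → ℤ_[p]) →+ (Fin n → ℚ_[p]) where
  toFun z i := z i
  map_zero' := by ext; simp
  map_add' _ _ := by ext; simp

theorem range_latticeHom : Set.range (latticeHom p n) = Metric.closedBall 0 1 := by
  ext x
  rw [mem_closedBall_zero_iff, pi_norm_le_iff_of_nonneg zero_le_one]
  exact ⟨by rintro ⟨z, rfl⟩ i; exact (z i).2, fun h => ⟨fun i => ⟨x i, h i⟩, rfl⟩⟩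

theorem isOpenEmbedding_latticeHom : IsOpenEmbedding (latticeHom p n) := by
  refine ⟨?_, ?_⟩
  · have : Isometry (latticeHom p n) := Isometry.of_dist_eq fun x y => by
      simp only [dist_pi_def]
      rfl
    exact this.isEmbedding
  · rw [range_latticeHom]
    exact IsUltrametricDist.isOpen_closedBall _ one_ne_zero

theorem integral_lattice (μ : Measure (Fin n → ℤ_[p])) [μ.IsAddHaarMeasure] (hμ : μ Set.univ = 1)
    (g : (Fin n → ℚ_[p]) → ℂ) :
    ∫ z, g (latticeHom p n z) ∂μ = ∫ x in Metric.closedBall 0 1, g x := by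
  have hemb := (isOpenEmbedding_latticeHom (p := p) (n := n)).measurableEmbedding
  have : (volume.comap (latticeHom p n)).IsAddHaarMeasure :=
    Measure.IsAddHaarMeasure.comap (mH := inferInstance) volume
      isOpenEmbedding_latticeHom
  have : IsProbabilityMeasure μ := ⟨hμ⟩
  have : IsProbabilityMeasure (volume.comap (latticeHom p n)) := by
    refine ⟨?_⟩
    rw [hemb.comap_apply, Set.image_univ, range_latticeHom, closedBall_pi _ zero_le_one,
      volume_pi_pi]
    simp [volume_closedBall_one]
  rw [Measure.isAddHaarMeasure_eq_of_isProbabilityMeasure μ (volume.comap (latticeHom p n)),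
    ← hemb.integral_map, hemb.map_comap, range_latticeHom]

theorem isRatFun_integral_eval {f : MvPolynomial (Fin n) ℤ_[p]} (hf : f ≠ 0)
    (μ : Measure (Fin n → ℤ_[p])) [μ.IsAddHaarMeasure] (hμ : μ Set.univ = 1) :
    IsRatFun p fun s => ∫ z, (‖MvPolynomial.eval z f‖ : ℂ) ^ s ∂μ := by
  refine (isRatFun_setIntegral_aeval hf).congr fun s _ => ?_
  rw [← integral_lattice μ hμ]
  congr with z
  have : (MvPolynomial.aeval (latticeHom p n z) f : ℚ_[p]) = (MvPolynomial.eval z f : ℤ_[p]) :=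
    MvPolynomial.aeval_algebraMap_apply ℚ_[p] z f
  rw [this, PadicInt.norm_def]

theorem norm_integral_eval_le (f : MvPolynomial (Fin n) ℤ_[p]) (μ : Measure (Fin n → ℤ_[p]))
    (hμ : μ Set.univ = 1) {s : ℂ} (hs : 0 < s.re) :
    ‖∫ z, (‖MvPolynomial.eval z f‖ : ℂ) ^ s ∂μ‖ ≤ 1 := by
  have : IsProbabilityMeasure μ := ⟨hμ⟩
  have h := norm_integral_le_of_norm_le_const (μ := μ) (C := 1)
    (f := fun z => (‖MvPolynomial.eval z f‖ : ℂ) ^ s) (Eventually.of_forall fun z => by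
      rw [Complex.norm_cpow_eq_rpow_re_of_nonneg (norm_nonneg _) hs.ne']
      exact Real.rpow_le_one (norm_nonneg _) (PadicInt.norm_le_one _) hs.le)
  simpa [Measure.real, hμ] using h

end Global

section Denominators

open Polynomial

variable {p : ℕ}

theorem exists_eq_of_mem_denoms {D : ℚ[X]} (hD : D ∈ denoms p) :
    ∃ (M : ℕ) (L : List (ℕ+ × ℕ+)),
      D = X ^ M * (L.map fun c => 1 - C ((p : ℚ)⁻¹ ^ (c.2 : ℕ)) * X ^ (c.1 : ℕ)).prod := by
  induction hD using Submonoid.closure_induction with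
  | mem q hq =>
    obtain rfl | ⟨a, b, rfl⟩ := hq
    · exact ⟨1, [], by simp⟩
    · exact ⟨0, [(a, b)], by simp⟩
  | one => exact ⟨0, [], by simp⟩
  | mul D₁ D₂ _ _ h₁ h₂ =>
    obtain ⟨M₁, L₁, rfl⟩ := h₁
    obtain ⟨M₂, L₂, rfl⟩ := h₂
    refine ⟨M₁ + M₂, L₁ ++ L₂, ?_⟩
    rw [List.map_append, List.prod_append]
    ring

/-- A bounded function of `s` has no pole at `p ^ (-s) = 0`. -/
theorem exists_aeval_eq_of_bounded [Fact p.Prime] {Z : ℂ → ℂ}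
    (hZ : ∀ s : ℂ, 0 < s.re → ‖Z s‖ ≤ 1) (D : ℚ[X]) (M : ℕ) (P : ℚ[X])
    (h : ∀ s : ℂ, 0 < s.re →
      Z s * aeval ((p : ℂ) ^ (-s)) (X ^ M * D) = aeval ((p : ℂ) ^ (-s)) P) :
    ∃ P' : ℚ[X], ∀ s : ℂ, 0 < s.re →
      Z s * aeval ((p : ℂ) ^ (-s)) D = aeval ((p : ℂ) ^ (-s)) P' := by
  have hp : (p : ℂ) ≠ 0 := Nat.cast_ne_zero.2 (Fact.out : p.Prime).ne_zero
  have hp1 : (1 : ℝ) < p := by exact_mod_cast (Fact.out : p.Prime).one_lt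
  induction M generalizing P with
  | zero => exact ⟨P, by simpa using h⟩
  | succ M ih =>
    have hT : Tendsto (fun k : ℕ => (p : ℂ) ^ (-((k + 1 : ℕ) : ℂ))) atTop (𝓝 0) := by
      have h1 : Tendsto (fun k : ℕ => ((p : ℂ)⁻¹) ^ k) atTop (𝓝 0) :=
        tendsto_pow_atTop_nhds_zero_of_norm_lt_one (by simpa using inv_lt_one_of_one_lt₀ hp1)
      refine ((tendsto_add_atTop_iff_nat 1).2 h1).congr fun k => ?_
      rw [Complex.cpow_neg, Complex.cpow_natCast, inv_pow]
    have hre : ∀ k : ℕ, 0 < ((k + 1 : ℕ) : ℂ).re := fun k => by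
      rw [Complex.natCast_re]; positivity
    have hcont : ∀ Q : ℚ[X], Tendsto (fun k : ℕ => aeval ((p : ℂ) ^ (-((k + 1 : ℕ) : ℂ))) Q) atTop
        (𝓝 (aeval (0 : ℂ) Q)) := fun Q => (Q.continuous_aeval.tendsto 0).comp hT
    have hL : Tendsto (fun k : ℕ => aeval ((p : ℂ) ^ (-((k + 1 : ℕ) : ℂ))) P) atTop (𝓝 0) := by
      refine Tendsto.congr (fun k => h _ (hre k)) ?_
      refine squeeze_zero_norm (fun k => ?_) (a := fun k : ℕ =>
        ‖aeval ((p : ℂ) ^ (-((k + 1 : ℕ) : ℂ))) (X ^ (M + 1) * D)‖) ?_; swap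
      · have := (hcont (X ^ (M + 1) * D)).norm
        rwa [map_mul, map_pow, aeval_X, zero_pow M.succ_ne_zero, zero_mul, norm_zero] at this
      rw [norm_mul]
      exact mul_le_of_le_one_left (norm_nonneg _) (hZ _ (hre k))
    have h0 : aeval (0 : ℂ) P = 0 := tendsto_nhds_unique (hcont P) hL
    obtain ⟨Q, rfl⟩ : X ∣ P := by
      rw [X_dvd_iff, coeff_zero_eq_eval_zero]
      rw [← map_zero (algebraMap ℚ ℂ), aeval_algebraMap_apply] at h0
      simpa using h0
    refine ih Q fun s hs => ?_
    have hT0 : (p : ℂ) ^ (-s) ≠ 0 := by simp [Complex.cpow_eq_zero_iff, hp]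
    have := h s hs
    simp only [pow_succ, map_mul, map_pow, aeval_X] at this ⊢
    refine mul_left_cancel₀ hT0 ?_
    linear_combination this

theorem cpow_neg_mul_add [Fact p.Prime] (a b : ℕ) (s : ℂ) :
    (p : ℂ) ^ (-((a : ℂ) * s + (b : ℂ))) = ((p : ℂ)⁻¹) ^ b * ((p : ℂ) ^ (-s)) ^ a := by
  have hp : (p : ℂ) ≠ 0 := Nat.cast_ne_zero.2 (Fact.out : p.Prime).ne_zero
  rw [neg_add, Complex.cpow_add _ _ hp, Complex.cpow_neg _ (b : ℂ), Complex.cpow_natCast, inv_pow,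
    ← mul_neg, Complex.cpow_nat_mul, mul_comm]

theorem IsRatFun.exists_fin [Fact p.Prime] {Z : ℂ → ℂ} (h : IsRatFun p Z)
    (hZ : ∀ s : ℂ, 0 < s.re → ‖Z s‖ ≤ 1) :
    ∃ (r : ℕ) (a b : Fin r → ℕ+) (P : ℚ[X]), ∀ s : ℂ, 0 < s.re →
      Z s * ∏ j : Fin r, (1 - (p : ℂ) ^ (-(((a j : ℕ) : ℂ) * s + ((b j : ℕ) : ℂ)))) =
        aeval ((p : ℂ) ^ (-s)) P := by
  obtain ⟨D, hD, P, hP⟩ := h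
  obtain ⟨M, L, rfl⟩ := exists_eq_of_mem_denoms hD
  obtain ⟨P', hP'⟩ := exists_aeval_eq_of_bounded hZ _ M P hP
  refine ⟨L.length, fun j => L[j].1, fun j => L[j].2, P', fun s hs => ?_⟩
  rw [← hP' s hs, ← Fin.prod_univ_fun_getElem, map_prod]
  congr 1
  refine Finset.prod_congr rfl fun j _ => ?_
  rw [cpow_neg_mul_add]
  simp

end Denominators

end Igusa

/-- (Igusa's rationality theorem, untwisted case.)  There exist
finitely many pairs of positive integers `(a_j, b_j)` and a polynomial
`P ∈ ℚ[T]` such that for all `s` with `Re(s) > 0`,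
`Z(f;s) · ∏_j (1 - p^{-(a_j s + b_j)}) = P(p^{-s})`; in particular
`Z(f;s) = ∫_{ℤ_p^d} |f(z)|_p^s dμ(z)` is a rational function of `t = p^{-s}`. -/
theorem igusa_rationality (p : ℕ) [Fact p.Prime] (d : ℕ) (hd : 1 ≤ d)
    (f : MvPolynomial (Fin d) ℤ_[p])
    (μ : Measure (Fin d → ℤ_[p])) [μ.IsAddHaarMeasure] (hμ : μ Set.univ = 1) :
    ∃ (r : ℕ) (a b : Fin r → ℕ+) (P : Polynomial ℚ),
      ∀ s : ℂ, 0 < s.re →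
        (∫ z : Fin d → ℤ_[p], (‖MvPolynomial.eval z f‖ : ℂ) ^ s ∂μ)
            * ∏ j : Fin r, (1 - (p : ℂ) ^ (-(((a j : ℕ) : ℂ) * s + ((b j : ℕ) : ℂ))))
          = Polynomial.aeval ((p : ℂ) ^ (-s)) P := by
  rcases eq_or_ne f 0 with rfl | hf
  · refine ⟨0, Fin.elim0, Fin.elim0, 0, fun s hs => ?_⟩
    have hs0 : s ≠ 0 := fun h => by simp [h] at hs
    simp [Complex.zero_cpow hs0]
  · exact (Igusa.isRatFun_integral_eval hf μ hμ).exists_fin fun s hs =>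
      Igusa.norm_integral_eval_le f μ hμ hs
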